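/- arXiv:2507.09333 — 2 statements merged into one kernel-verified Lean document; each statement's English description precedes it below -/
import Mathlib

section
/- There exists a constant C>0 such that for every smooth compactly supported function P:ℝ²→ℝ and all smooth compactly supported vector fields u, v:ℝ²→ℝ² with ∇·u = 0, one has |∫_{ℝ²} P(x) Σ_{i,j} ∂_i u_j(x) ∂_j v_i(x) dx| ≤ C ‖∇P‖_{L²(ℝ²)} ‖∇u‖_{L²(ℝ²)} ‖∇v‖_{L²(ℝ²)}. -/
open MeasureTheory

/-- Partial derivative `∂ᵢ f` of a scalar function on `ℝ²`. -/
noncomputable def pd (f : (Fin 2 → ℝ) → ℝ) (i : Fin 2) (x : Fin 2 → ℝ) : ℝ :=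
  fderiv ℝ f x (Pi.single i 1)

/-- The unit square. -/
def sqK : Set (Fin 2 → ℝ) := Set.Icc 0 1

lemma sqK_compact : IsCompact sqK := isCompact_Icc

lemma sqK_meas : MeasurableSet sqK := measurableSet_Icc

lemma sqK_vol : volume sqK = 1 := by
  simp [sqK, Real.volume_Icc_pi]

instance sqK_prob : IsProbabilityMeasure (volume.restrict sqK) :=
  ⟨by simp [sqK_vol]⟩

lemma hasFDerivAt_param {V : Type} [NormedAddCommGroup V] [NormedSpace ℝ V]
    [FiniteDimensional ℝ V]
    (φ : (Fin 3 → ℝ) × (Fin 2 → ℝ) → V) (hφ : ContDiff ℝ (⊤ : ℕ∞) φ) (y : Fin 3 → ℝ) :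
    HasFDerivAt (fun y => ∫ z in sqK, φ (y, z))
      (∫ z in sqK, (fderiv ℝ φ (y, z)).comp (ContinuousLinearMap.inl ℝ _ _)) y := by
  have hc : Continuous φ := hφ.continuous
  have hc' : Continuous (fun p => (fderiv ℝ φ p).comp
      (ContinuousLinearMap.inl ℝ (Fin 3 → ℝ) (Fin 2 → ℝ))) := by
    have := hφ.continuous_fderiv (by simp)
    fun_prop
  obtain ⟨M, hM⟩ := ((isCompact_closedBall y 1).prod sqK_compact).exists_bound_of_continuousOn
    hc'.continuousOn
  refine hasFDerivAt_integral_of_dominated_of_fderiv_le (𝕜 := ℝ)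
    (F := fun y z => φ (y, z)) (F' := fun y z => (fderiv ℝ φ (y, z)).comp
      (ContinuousLinearMap.inl ℝ _ _)) (bound := fun _ => M)
    (Metric.closedBall_mem_nhds y one_pos) ?_ ?_ ?_ ?_ ?_ ?_
  · refine Filter.Eventually.of_forall fun y => ?_
    exact Continuous.aestronglyMeasurable (by fun_prop)
  · exact (Continuous.continuousOn (by fun_prop)).integrableOn_compact sqK_compact
  · exact (hc'.comp (by fun_prop : Continuous fun z : Fin 2 → ℝ => (y, z))).aestronglyMeasurable
  · refine (ae_restrict_mem sqK_meas).mono fun z hz x hx => hM (x, z) ⟨hx, hz⟩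
  · exact integrable_const _
  · refine Filter.Eventually.of_forall fun z x _ => ?_
    have h1 : HasFDerivAt φ (fderiv ℝ φ (x, z)) (x, z) :=
      (hφ.differentiable (by simp) _).hasFDerivAt
    exact h1.comp x (hasFDerivAt_prodMk_left x z)

lemma contDiff_param (n : ℕ) : ∀ {V : Type} [NormedAddCommGroup V] [NormedSpace ℝ V]
    [FiniteDimensional ℝ V]
    (φ : (Fin 3 → ℝ) × (Fin 2 → ℝ) → V) (_ : ContDiff ℝ (⊤ : ℕ∞) φ),
    ContDiff ℝ n (fun y => ∫ z in sqK, φ (y, z)) := by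
  induction n with
  | zero =>
    intro V _ _ _ φ hφ
    have hc := hφ.continuous
    simp only [Nat.cast_zero, contDiff_zero]
    exact continuous_parametric_integral_of_continuous (f := fun y z => φ (y, z))
      (by exact hc) sqK_compact
  | succ n ih =>
    intro V _ _ _ φ hφ
    push_cast
    rw [contDiff_succ_iff_hasFDerivAt]
    refine ⟨_, ih (fun p => (fderiv ℝ φ p).comp
      (ContinuousLinearMap.inl ℝ (Fin 3 → ℝ) (Fin 2 → ℝ))) ?_, hasFDerivAt_param φ hφ⟩
    have : ContDiff ℝ (⊤ : ℕ∞) (fderiv ℝ φ) := hφ.fderiv_right (by simp)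
    exact this.clm_comp contDiff_const

/-- Averages over translated scaled squares. -/
noncomputable def avg (f : (Fin 2 → ℝ) → ℝ) (t : ℝ) (x : Fin 2 → ℝ) : ℝ :=
  ∫ z in sqK, f (x + t • z)

/-- Extension to three variables. -/
noncomputable def ext3 (f : (Fin 2 → ℝ) → ℝ) (y : Fin 3 → ℝ) : ℝ :=
  avg f (y 0) (fun i => y i.succ)

lemma avg_continuous {f : (Fin 2 → ℝ) → ℝ} (hf : Continuous f) :
    Continuous (fun p : ℝ × (Fin 2 → ℝ) => avg f p.1 p.2) := by
  unfold avg
  exact continuous_parametric_integral_of_continuous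
    (f := fun (p : ℝ × (Fin 2 → ℝ)) z => f (p.2 + p.1 • z))
      (by unfold Function.uncurry; fun_prop) sqK_compact

lemma avg_integrable {f : (Fin 2 → ℝ) → ℝ} (hf : Continuous f) (t : ℝ) (x : Fin 2 → ℝ) :
    IntegrableOn (fun z => f (x + t • z)) sqK :=
  (Continuous.continuousOn (by fun_prop)).integrableOn_compact sqK_compact

lemma ext3_smooth_aux {f : (Fin 2 → ℝ) → ℝ} (hf : ContDiff ℝ (⊤ : ℕ∞) f) :
    ContDiff ℝ (⊤ : ℕ∞) (fun p : (Fin 3 → ℝ) × (Fin 2 → ℝ) =>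
      f ((fun i => p.1 i.succ) + p.1 0 • p.2)) := by
  fun_prop

lemma ext3_contDiff {f : (Fin 2 → ℝ) → ℝ} (hf : ContDiff ℝ (⊤ : ℕ∞) f) :
    ContDiff ℝ 2 (ext3 f) := by
  have := contDiff_param 2 _ (ext3_smooth_aux hf)
  exact_mod_cast this

lemma ext3_fderiv {f : (Fin 2 → ℝ) → ℝ} (hf : ContDiff ℝ (⊤ : ℕ∞) f) (y e : Fin 3 → ℝ) :
    fderiv ℝ (ext3 f) y e = ∫ z in sqK,
      fderiv ℝ f ((fun i => y i.succ) + y 0 • z) ((fun i => e i.succ) + e 0 • z) := by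
  have h := hasFDerivAt_param _ (ext3_smooth_aux hf) y
  have h2 : fderiv ℝ (ext3 f) y = _ := h.fderiv
  rw [h2, ContinuousLinearMap.integral_apply]
  · refine setIntegral_congr_fun sqK_meas fun z _ => ?_
    have h1 : HasFDerivAt f (fderiv ℝ f ((fun i => y i.succ) + y 0 • z))
      ((fun i => y i.succ) + y 0 • z) := (hf.differentiable (by simp) _).hasFDerivAt
    have h3 : HasFDerivAt (fun y : Fin 3 → ℝ => ((fun i => y i.succ : Fin 2 → ℝ) + y 0 • z))
        ((ContinuousLinearMap.pi fun i : Fin 2 => ContinuousLinearMap.proj (R := ℝ) (φ := fun _ : Fin 3 => ℝ) i.succ) +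
          (ContinuousLinearMap.proj (R := ℝ) (φ := fun _ : Fin 3 => ℝ) 0).smulRight z) y :=
      ContinuousLinearMap.hasFDerivAt
        ((ContinuousLinearMap.pi fun i : Fin 2 => ContinuousLinearMap.proj (R := ℝ) (φ := fun _ : Fin 3 => ℝ) i.succ) +
          (ContinuousLinearMap.proj (R := ℝ) (φ := fun _ : Fin 3 => ℝ) 0).smulRight z)
    have h4 := h1.comp y h3
    have h5 := HasFDerivAt.comp y ((ext3_smooth_aux hf).differentiable (by simp)
      ((y, z) : (Fin 3 → ℝ) × (Fin 2 → ℝ))).hasFDerivAt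
      (hasFDerivAt_prodMk_left (𝕜 := ℝ) y z)
    have h6 := h5.unique h4
    exact congrArg (fun L => L e) h6
  · have hc' : Continuous (fun p => (fderiv ℝ (fun p : (Fin 3 → ℝ) × (Fin 2 → ℝ) =>
      f ((fun i => p.1 i.succ) + p.1 0 • p.2)) p).comp
      (ContinuousLinearMap.inl ℝ (Fin 3 → ℝ) (Fin 2 → ℝ))) := by
      have := (ext3_smooth_aux hf).continuous_fderiv (by simp)
      fun_prop
    exact (hc'.comp (by fun_prop : Continuous fun z : Fin 2 → ℝ =>
      (y, z))).continuousOn.integrableOn_compact sqK_compact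

/-- The gradient size. -/
noncomputable def gr (f : (Fin 2 → ℝ) → ℝ) (x : Fin 2 → ℝ) : ℝ := |pd f 0 x| + |pd f 1 x|

lemma pd_continuous {f : (Fin 2 → ℝ) → ℝ} (hf : ContDiff ℝ (⊤ : ℕ∞) f) (i : Fin 2) :
    Continuous (pd f i) := by
  have := hf.continuous_fderiv (by simp)
  unfold pd
  fun_prop

lemma gr_continuous {f : (Fin 2 → ℝ) → ℝ} (hf : ContDiff ℝ (⊤ : ℕ∞) f) : Continuous (gr f) := by
  have h0 := pd_continuous hf 0
  have h1 := pd_continuous hf 1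
  unfold gr
  fun_prop

lemma gr_nonneg (f : (Fin 2 → ℝ) → ℝ) (x) : 0 ≤ gr f x := by unfold gr; positivity

lemma fderiv_eq_pd (f : (Fin 2 → ℝ) → ℝ) (x v : Fin 2 → ℝ) :
    fderiv ℝ f x v = v 0 * pd f 0 x + v 1 * pd f 1 x := by
  have : v = v 0 • (Pi.single 0 1 : Fin 2 → ℝ) + v 1 • (Pi.single 1 1 : Fin 2 → ℝ) := by
    ext i; fin_cases i <;> simp
  conv_lhs => rw [this]
  simp only [map_add, map_smul, smul_eq_mul, pd]

lemma ext3_fderiv_le {f : (Fin 2 → ℝ) → ℝ} (hf : ContDiff ℝ (⊤ : ℕ∞) f) (y : Fin 3 → ℝ)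
    (k : Fin 3) :
    |fderiv ℝ (ext3 f) y (Pi.single k 1)| ≤ avg (gr f) (y 0) (fun i => y i.succ) := by
  rw [ext3_fderiv hf]
  refine (abs_integral_le_integral_abs).trans ?_
  unfold avg
  have hd := hf.continuous_fderiv (by simp)
  refine setIntegral_mono_on ?_ (avg_integrable (gr_continuous hf) _ _) sqK_meas ?_
  · exact (Continuous.continuousOn (by fun_prop)).integrableOn_compact sqK_compact
  intro z hz
  rw [fderiv_eq_pd]
  have hz0 : |z 0| ≤ 1 := abs_le.2 ⟨by have := hz.1 0; simp at this; linarith, hz.2 0⟩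
  have hz1 : |z 1| ≤ 1 := abs_le.2 ⟨by have := hz.1 1; simp at this; linarith, hz.2 1⟩
  refine (abs_add_le _ _).trans ?_
  rw [abs_mul, abs_mul]
  unfold gr
  gcongr
  · refine mul_le_of_le_one_left (abs_nonneg _) ?_
    fin_cases k <;> simp [Pi.single_apply, hz0, Fin.succ_ne_zero]
  · refine mul_le_of_le_one_left (abs_nonneg _) ?_
    fin_cases k <;> simp [Pi.single_apply, hz1, Fin.succ_ne_zero]

lemma ext3_fderiv_zero {f : (Fin 2 → ℝ) → ℝ} (hf : ContDiff ℝ (⊤ : ℕ∞) f) (x : Fin 2 → ℝ)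
    (k : Fin 2) :
    fderiv ℝ (ext3 f) (Fin.cons 0 x) (Pi.single k.succ 1) = pd f k x := by
  rw [ext3_fderiv hf]
  have : (fun i : Fin 2 => (Pi.single k.succ 1 : Fin 3 → ℝ) i.succ) = Pi.single k 1 := by
    ext i; simp [Pi.single_apply]
  simp [this, pd, measureReal_def, Fin.succ_ne_zero]

lemma ext3_zero (f : (Fin 2 → ℝ) → ℝ) (x : Fin 2 → ℝ) :
    ext3 f (Fin.cons 0 x) = f x := by
  simp [ext3, avg, measureReal_def]

lemma avg_abs_le {w : (Fin 2 → ℝ) → ℝ} (hw : Continuous w) (hs : HasCompactSupport w)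
    {A t : ℝ} (hA : 0 < A) (ht : 0 < t) (hA2 : ∫ x, w x ^ 2 ≤ A ^ 2) (x : Fin 2 → ℝ) :
    |avg w t x| ≤ A / t := by
  have hi : Integrable (fun y => w y ^ 2) := by
    refine Continuous.integrable_of_hasCompactSupport (by fun_prop) ?_
    exact hs.comp_left (g := fun s : ℝ => s ^ 2) (by simp)
  have hi2 : Integrable (fun z => w (x + t • z) ^ 2) := by
    have := hi.comp_add_left x
    exact this.comp_smul (R := t) ht.ne'
  have h1 : ∫ z, w (x + t • z) ^ 2 = (t ^ 2)⁻¹ * ∫ y, w y ^ 2 := by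
    have := Measure.integral_comp_smul_of_nonneg (μ := volume) (fun z => w (x + z) ^ 2) t (hR := ht.le)
    rw [this, integral_add_left_eq_self (fun y => w y ^ 2) x]
    simp
  have h2 : ∫ z in sqK, w (x + t • z) ^ 2 ≤ (A / t) ^ 2 := by
    refine (setIntegral_le_integral hi2 (Filter.Eventually.of_forall fun _ => sq_nonneg _)).trans ?_
    rw [h1, div_pow, div_eq_inv_mul]
    gcongr
  have hc : 0 < A / t := by positivity
  have h3 : |avg w t x| ≤ ∫ z in sqK, |w (x + t • z)| := abs_integral_le_integral_abs
  have h4 : ∫ z in sqK, 2 * (A / t) * |w (x + t • z)| ≤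
      ∫ z in sqK, ((A / t) ^ 2 + w (x + t • z) ^ 2) := by
    refine integral_mono ?_ ?_ ?_
    · exact (Continuous.continuousOn (by fun_prop)).integrableOn_compact sqK_compact
    · exact (Continuous.continuousOn (by fun_prop)).integrableOn_compact sqK_compact
    · intro z
      have := sq_nonneg (A / t - |w (x + t • z)|)
      have h := sq_abs (w (x + t • z))
      simp only
      nlinarith
  rw [integral_const_mul, integral_add (integrable_const _) hi2.integrableOn] at h4
  simp only [integral_const, probReal_univ, one_smul] at h4
  refine h3.trans ?_
  have h5 : (2 * (A / t)) * ∫ z in sqK, |w (x + t • z)| ≤ (2 * (A / t)) * (A / t) := by nlinarith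
  exact le_of_mul_le_mul_left h5 (by positivity)

lemma min_lintegral {a A : ℝ} (ha : 0 ≤ a) (hA : 0 < A) :
    ∫⁻ t in Set.Ioi (0 : ℝ), ENNReal.ofReal (min a (A / t) ^ 2) ≤ ENNReal.ofReal (2 * a * A) := by
  rcases ha.eq_or_lt with rfl | ha
  · rw [setLIntegral_congr_fun (g := fun _ => 0) measurableSet_Ioi]
    · simp
    · intro t ht
      have : 0 ≤ A / t := div_nonneg hA.le (le_of_lt ht)
      simp [min_eq_left this]
  have hb : 0 < A / a := by positivity
  have hun : Set.Ioi (0 : ℝ) = Set.Ioc 0 (A / a) ∪ Set.Ioi (A / a) :=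
    (Set.Ioc_union_Ioi_eq_Ioi hb.le).symm
  rw [hun]
  refine (lintegral_union_le _ _ _).trans ?_
  have h1 : ∫⁻ t in Set.Ioc (0 : ℝ) (A / a), ENNReal.ofReal (min a (A / t) ^ 2)
      ≤ ENNReal.ofReal (a * A) := by
    calc _ ≤ ∫⁻ t in Set.Ioc (0 : ℝ) (A / a), ENNReal.ofReal (a ^ 2) := by
          refine setLIntegral_mono' measurableSet_Ioc fun t ht => ?_
          have : 0 ≤ A / t := div_nonneg hA.le ht.1.le
          gcongr
          exact min_le_left _ _
      _ = _ := by
          rw [setLIntegral_const, Real.volume_Ioc, ← ENNReal.ofReal_mul (by positivity)]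
          congr 1
          field_simp
          simp
  have h2 : ∫⁻ t in Set.Ioi (A / a), ENNReal.ofReal (min a (A / t) ^ 2)
      ≤ ENNReal.ofReal (a * A) := by
    calc _ ≤ ∫⁻ t in Set.Ioi (A / a), ENNReal.ofReal (A ^ 2 * t ^ (-2 : ℝ)) := by
          refine setLIntegral_mono' measurableSet_Ioi fun t ht => ?_
          have ht0 : 0 < t := hb.trans ht
          have : 0 ≤ A / t := div_nonneg hA.le ht0.le
          have e : A ^ 2 * t ^ (-2 : ℝ) = (A / t) ^ 2 := by
            rw [Real.rpow_neg ht0.le, div_pow, div_eq_mul_inv]; norm_cast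
          rw [e]
          gcongr
          exact min_le_right _ _
      _ = ENNReal.ofReal (∫ t in Set.Ioi (A / a), A ^ 2 * t ^ (-2 : ℝ)) := by
          rw [ofReal_integral_eq_lintegral_ofReal]
          · exact (integrableOn_Ioi_rpow_of_lt (by norm_num) hb).const_mul _
          · refine (ae_restrict_mem measurableSet_Ioi).mono fun t ht => ?_
            have ht0 : 0 < t := hb.trans ht
            simp only [Pi.zero_apply]
            positivity
      _ = _ := by
          rw [integral_const_mul, integral_Ioi_rpow_of_lt (by norm_num) hb]
          congr 1
          norm_num
          rw [Real.rpow_neg hb.le, Real.rpow_one]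
          field_simp
  refine (add_le_add h1 h2).trans ?_
  rw [← ENNReal.ofReal_add (by positivity) (by positivity)]
  exact ENNReal.ofReal_le_ofReal (by linarith)

lemma avg_nonneg {w : (Fin 2 → ℝ) → ℝ} (h0 : ∀ x, 0 ≤ w x) (t x) : 0 ≤ avg w t x :=
  integral_nonneg fun _ => h0 _

lemma cube_pointwise {w : (Fin 2 → ℝ) → ℝ} (hw : Continuous w) (hs : HasCompactSupport w)
    (h0 : ∀ x, 0 ≤ w x)
    {A t : ℝ} (hA : 0 < A) (ht : 0 < t) (hA2 : ∫ x, w x ^ 2 ≤ A ^ 2) (x : Fin 2 → ℝ) :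
    ENNReal.ofReal (avg w t x ^ 3) ≤ ∫⁻ z in sqK,
      ENNReal.ofReal (2 * (w (x + t • z) * min (2 * w (x + t • z)) (A / t) ^ 2)) := by
  have hW0 := avg_nonneg h0 t x
  have hW := (le_abs_self _).trans (avg_abs_le hw hs hA ht hA2 x)
  set W := avg w t x with hWdef
  have hc : 0 < A / t := by positivity
  have hi : IntegrableOn (fun z => 2 * (w (x + t • z) * min (2 * w (x + t • z)) (A / t) ^ 2))
      sqK :=
    (Continuous.continuousOn (by fun_prop)).integrableOn_compact sqK_compact
  rw [← ofReal_integral_eq_lintegral_ofReal hi]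
  · refine ENNReal.ofReal_le_ofReal ?_
    have h1 : ∫ z in sqK, W ^ 2 * w (x + t • z) ≤
        ∫ z in sqK, ((1 / 2) * (2 * (w (x + t • z) * min (2 * w (x + t • z)) (A / t) ^ 2)) + W ^ 3 / 2) := by
      refine integral_mono ?_ ?_ ?_
      · exact (Continuous.continuousOn (by fun_prop)).integrableOn_compact sqK_compact
      · exact (Continuous.continuousOn (by fun_prop)).integrableOn_compact sqK_compact
      · intro z
        have hz := h0 (x + t • z)
        simp only
        generalize w (x + t • z) = s at *
        rcases le_total W (2 * s) with h | h
        · have : W ^ 2 ≤ min (2 * s) (A / t) ^ 2 := by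
            gcongr
            exact le_min h hW
          have h3 : 0 ≤ W ^ 3 := by positivity
          nlinarith
        · have h3 : W ^ 2 * (2 * s) ≤ W ^ 2 * W := by gcongr
          have h4 : 0 ≤ s * min (2 * s) (A / t) ^ 2 := by positivity
          nlinarith
    rw [integral_const_mul, integral_add (hi.const_mul _) (integrable_const _),
      integral_const_mul] at h1
    simp only [integral_const, probReal_univ, one_smul] at h1
    have h2 : ∫ z in sqK, w (x + t • z) = W := rfl
    rw [h2] at h1
    nlinarith
  · refine Filter.Eventually.of_forall fun z => ?_
    have hz := h0 (x + t • z)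
    simp only [Pi.zero_apply]
    positivity

lemma cube_bound {w : (Fin 2 → ℝ) → ℝ} (hw : Continuous w) (hs : HasCompactSupport w)
    (h0 : ∀ x, 0 ≤ w x)
    {A : ℝ} (hA : 0 < A) (hA2 : ∫ x, w x ^ 2 ≤ A ^ 2) :
    ∫⁻ t in Set.Ioi (0 : ℝ), ∫⁻ x, ENNReal.ofReal (avg w t x ^ 3) ≤ ENNReal.ofReal (8 * A ^ 3) := by
  have hm := hw.measurable
  have hi : Integrable (fun y => w y ^ 2) := by
    refine Continuous.integrable_of_hasCompactSupport (by fun_prop) ?_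
    exact hs.comp_left (g := fun s : ℝ => s ^ 2) (by simp)
  calc _ ≤ ∫⁻ t in Set.Ioi (0 : ℝ), ∫⁻ x, ENNReal.ofReal (2 * (w x * min (2 * w x) (A / t) ^ 2)) := by
        refine setLIntegral_mono' measurableSet_Ioi fun t ht => ?_
        calc _ ≤ ∫⁻ x, ∫⁻ z in sqK,
                ENNReal.ofReal (2 * (w (x + t • z) * min (2 * w (x + t • z)) (A / t) ^ 2)) :=
              lintegral_mono fun x => cube_pointwise hw hs h0 hA ht hA2 x
          _ = ∫⁻ z in sqK, ∫⁻ x,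
                ENNReal.ofReal (2 * (w (x + t • z) * min (2 * w (x + t • z)) (A / t) ^ 2)) := by
              refine lintegral_lintegral_swap (Measurable.aemeasurable ?_)
              unfold Function.uncurry
              fun_prop
          _ = ∫⁻ z in sqK, ∫⁻ x, ENNReal.ofReal (2 * (w x * min (2 * w x) (A / t) ^ 2)) := by
              refine lintegral_congr fun z => ?_
              exact lintegral_add_right_eq_self
                (fun x => ENNReal.ofReal (2 * (w x * min (2 * w x) (A / t) ^ 2))) (t • z)
          _ = _ := by simp
    _ = ∫⁻ x, ∫⁻ t in Set.Ioi (0 : ℝ), ENNReal.ofReal (2 * (w x * min (2 * w x) (A / t) ^ 2)) := by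
        refine lintegral_lintegral_swap (Measurable.aemeasurable ?_)
        unfold Function.uncurry
        fun_prop
    _ ≤ ∫⁻ x, ENNReal.ofReal (8 * A * w x ^ 2) := by
        refine lintegral_mono fun x => ?_
        have hx := h0 x
        have e : ∀ t, ENNReal.ofReal (2 * (w x * min (2 * w x) (A / t) ^ 2)) =
          ENNReal.ofReal (2 * w x) * ENNReal.ofReal (min (2 * w x) (A / t) ^ 2) := fun t => by
            rw [← ENNReal.ofReal_mul (by positivity), mul_assoc]
        simp only [e]
        rw [lintegral_const_mul _ (by fun_prop)]
        calc _ ≤ ENNReal.ofReal (2 * w x) * ENNReal.ofReal (2 * (2 * w x) * A) := by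
              gcongr
              exact min_lintegral (by positivity) hA
          _ = _ := by
              rw [← ENNReal.ofReal_mul (by positivity)]
              congr 1; ring
    _ = ENNReal.ofReal (∫ x, 8 * A * w x ^ 2) := by
        rw [ofReal_integral_eq_lintegral_ofReal (hi.const_mul _)]
        exact Filter.Eventually.of_forall fun z => by simp only [Pi.zero_apply]; positivity
    _ ≤ _ := by
        refine ENNReal.ofReal_le_ofReal ?_
        rw [integral_const_mul]
        nlinarith [mul_le_mul_of_nonneg_left hA2 hA.le]

/-- Partial derivatives in three variables. -/
noncomputable def d3 (F : (Fin 3 → ℝ) → ℝ) (k : Fin 3) (y : Fin 3 → ℝ) : ℝ :=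
  fderiv ℝ F y (Pi.single k 1)

/-- The Jacobian determinant in three variables. -/
noncomputable def det3 (F G H : (Fin 3 → ℝ) → ℝ) (y : Fin 3 → ℝ) : ℝ :=
  d3 F 0 y * (d3 G 1 y * d3 H 2 y - d3 G 2 y * d3 H 1 y) +
  d3 F 1 y * (d3 G 2 y * d3 H 0 y - d3 G 0 y * d3 H 2 y) +
  d3 F 2 y * (d3 G 0 y * d3 H 1 y - d3 G 1 y * d3 H 0 y)

/-- The component in direction `k` of the cross product field. -/
noncomputable def vf (F G H : (Fin 3 → ℝ) → ℝ) (k : Fin 3) (y : Fin 3 → ℝ) : ℝ :=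
  F y * (d3 G (k + 1) y * d3 H (k + 2) y - d3 G (k + 2) y * d3 H (k + 1) y)

lemma d3_hasFDerivAt {G : (Fin 3 → ℝ) → ℝ} (hG : ContDiff ℝ 2 G) (k : Fin 3) (y : Fin 3 → ℝ) :
    HasFDerivAt (d3 G k) ((fderiv ℝ (fderiv ℝ G) y).flip (Pi.single k 1)) y := by
  have h : ContDiff ℝ 1 (fderiv ℝ G) := hG.fderiv_right (by norm_num)
  have h1 := (h.differentiable (by simp) y).hasFDerivAt
  have h2 := h1.clm_apply (hasFDerivAt_const (Pi.single k 1 : Fin 3 → ℝ) y)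
  simp only [ContinuousLinearMap.comp_zero, zero_add] at h2
  exact h2

lemma d3_continuous {G : (Fin 3 → ℝ) → ℝ} (hG : ContDiff ℝ 2 G) (k : Fin 3) :
    Continuous (d3 G k) := by
  have := hG.continuous_fderiv (by simp)
  unfold d3
  fun_prop

lemma vf_hasFDerivAt {F G H : (Fin 3 → ℝ) → ℝ} (hF : ContDiff ℝ 2 F) (hG : ContDiff ℝ 2 G)
    (hH : ContDiff ℝ 2 H) (k : Fin 3) (y : Fin 3 → ℝ) :
    HasFDerivAt (vf F G H k) (fderiv ℝ (vf F G H k) y) y ∧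
    fderiv ℝ (vf F G H k) y (Pi.single k 1) =
      d3 F k y * (d3 G (k + 1) y * d3 H (k + 2) y - d3 G (k + 2) y * d3 H (k + 1) y) +
      F y * (fderiv ℝ (fderiv ℝ G) y (Pi.single k 1) (Pi.single (k + 1) 1) * d3 H (k + 2) y
        + d3 G (k + 1) y * fderiv ℝ (fderiv ℝ H) y (Pi.single k 1) (Pi.single (k + 2) 1)
        - fderiv ℝ (fderiv ℝ G) y (Pi.single k 1) (Pi.single (k + 2) 1) * d3 H (k + 1) y
        - d3 G (k + 2) y * fderiv ℝ (fderiv ℝ H) y (Pi.single k 1) (Pi.single (k + 1) 1)) := by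
  have hF1 := (hF.differentiable (by simp) y).hasFDerivAt
  have h := hF1.mul (((d3_hasFDerivAt hG (k + 1) y).mul (d3_hasFDerivAt hH (k + 2) y)).sub
    ((d3_hasFDerivAt hG (k + 2) y).mul (d3_hasFDerivAt hH (k + 1) y)))
  have h' : HasFDerivAt (vf F G H k) _ y := h
  refine ⟨h'.differentiableAt.hasFDerivAt, ?_⟩
  rw [h'.fderiv]
  simp [d3]
  ring

lemma div_vf {F G H : (Fin 3 → ℝ) → ℝ} (hF : ContDiff ℝ 2 F) (hG : ContDiff ℝ 2 G)
    (hH : ContDiff ℝ 2 H) (y : Fin 3 → ℝ) :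
    ∑ k, fderiv ℝ (vf F G H k) y (Pi.single k 1) = det3 F G H y := by
  have sG : ∀ a b, fderiv ℝ (fderiv ℝ G) y a b = fderiv ℝ (fderiv ℝ G) y b a := fun a b =>
    (hG.contDiffAt.isSymmSndFDerivAt (by simp)) a b
  have sH : ∀ a b, fderiv ℝ (fderiv ℝ H) y a b = fderiv ℝ (fderiv ℝ H) y b a := fun a b =>
    (hH.contDiffAt.isSymmSndFDerivAt (by simp)) a b
  simp only [fun k => (vf_hasFDerivAt hF hG hH k y).2]
  simp only [Fin.sum_univ_three]
  have e1 : (0 : Fin 3) + 1 = 1 := rfl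
  have e2 : (0 : Fin 3) + 2 = 2 := rfl
  have e3 : (1 : Fin 3) + 1 = 2 := rfl
  have e4 : (1 : Fin 3) + 2 = 0 := rfl
  have e5 : (2 : Fin 3) + 1 = 0 := rfl
  have e6 : (2 : Fin 3) + 2 = 1 := rfl
  simp only [e1, e2, e3, e4, e5, e6]
  rw [sG (Pi.single 1 1) (Pi.single 0 1), sG (Pi.single 2 1) (Pi.single 0 1),
    sG (Pi.single 2 1) (Pi.single 1 1), sH (Pi.single 1 1) (Pi.single 0 1),
    sH (Pi.single 2 1) (Pi.single 0 1), sH (Pi.single 2 1) (Pi.single 1 1)]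
  unfold det3
  ring

lemma stokes {F G H : (Fin 3 → ℝ) → ℝ} (hF : ContDiff ℝ 2 F) (hG : ContDiff ℝ 2 G)
    (hH : ContDiff ℝ 2 H) {T R : ℝ} (hT : 0 ≤ T) (hR : 0 ≤ R)
    (hlat : ∀ y : Fin 3 → ℝ, 0 ≤ y 0 → y 0 ≤ T → (∃ i : Fin 2, |y i.succ| = R) → F y = 0) :
    ∫ y in Set.Icc (Fin.cons 0 (fun _ => -R) : Fin 3 → ℝ) (Fin.cons T (fun _ => R)), det3 F G H y =
      (∫ x in Set.Icc (fun _ => -R : Fin 2 → ℝ) (fun _ => R), vf F G H 0 (Fin.cons T x)) -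
      ∫ x in Set.Icc (fun _ => -R : Fin 2 → ℝ) (fun _ => R), vf F G H 0 (Fin.cons 0 x) := by
  have hFc := hF.continuous
  have hGc := d3_continuous hG
  have hHc := d3_continuous hH
  have hFd := d3_continuous hF
  have hdet : Continuous (det3 F G H) := by unfold det3; fun_prop
  have hle : (Fin.cons 0 (fun _ => -R) : Fin 3 → ℝ) ≤ Fin.cons T (fun _ => R) := by
    intro i
    refine Fin.cases ?_ (fun j => ?_) i
    · simpa using hT
    · simp; linarith
  have key := integral_divergence_of_hasFDerivAt_off_countable' _ _ hle (fun k => vf F G H k)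
    (fun k y => fderiv ℝ (vf F G H k) y) ∅ Set.countable_empty
    (fun k => by unfold vf; fun_prop)
    (fun y _ k => (vf_hasFDerivAt hF hG hH k y).1)
    (by
      simp only [div_vf hF hG hH]
      exact hdet.continuousOn.integrableOn_compact isCompact_Icc)
  simp only [div_vf hF hG hH] at key
  rw [key, Fin.sum_univ_succ]
  have hz : ∀ (j : Fin 2) (c : ℝ), |c| = R → ∀ x ∈ Set.Icc
      ((Fin.cons 0 (fun _ => -R) : Fin 3 → ℝ) ∘ j.succ.succAbove)
      ((Fin.cons T (fun _ => R) : Fin 3 → ℝ) ∘ j.succ.succAbove),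
      vf F G H j.succ (j.succ.insertNth c x) = 0 := by
    intro j c hc x hx
    have h0 := hx.1 0
    have h1 := hx.2 0
    have e0 : (j.succ.insertNth c x : Fin 3 → ℝ) 0 = x 0 := by
      have : j.succ.succAbove (0 : Fin 2) = 0 := Fin.succ_succAbove_zero j
      conv_lhs => rw [← this]
      exact Fin.insertNth_apply_succAbove (α := fun _ => ℝ) j.succ c x 0
    have hF0 : F (j.succ.insertNth c x) = 0 := by
      refine hlat _ ?_ ?_ ⟨j, ?_⟩
      · rw [e0]; simpa using h0
      · rw [e0]; simpa using h1
      · rw [Fin.insertNth_apply_same]; exact hc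
    simp [vf, hF0]
  have hsum : ∀ j : Fin 2, ((∫ x in Set.Icc
      ((Fin.cons 0 (fun _ => -R) : Fin 3 → ℝ) ∘ j.succ.succAbove)
      ((Fin.cons T (fun _ => R) : Fin 3 → ℝ) ∘ j.succ.succAbove),
      vf F G H j.succ (j.succ.insertNth ((Fin.cons T (fun _ => R) : Fin 3 → ℝ) j.succ) x)) -
      (∫ x in Set.Icc
      ((Fin.cons 0 (fun _ => -R) : Fin 3 → ℝ) ∘ j.succ.succAbove)
      ((Fin.cons T (fun _ => R) : Fin 3 → ℝ) ∘ j.succ.succAbove),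
      vf F G H j.succ (j.succ.insertNth ((Fin.cons 0 (fun _ => -R) : Fin 3 → ℝ) j.succ) x))) = 0 := by
    intro j
    rw [setIntegral_eq_zero_of_forall_eq_zero (hz j _ _),
      setIntegral_eq_zero_of_forall_eq_zero (hz j _ _), sub_zero]
    · simp [abs_of_nonneg hR]
    · simp [abs_of_nonneg hR]
  rw [Finset.sum_eq_zero fun j _ => hsum j, add_zero]
  simp only [Fin.insertNth_zero, Fin.cons_zero]
  rfl

lemma lintegral_half (Φ : ℝ → (Fin 2 → ℝ) → ENNReal) (hΦ : Measurable (Function.uncurry Φ)) :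
    ∫⁻ y in {y : Fin 3 → ℝ | 0 ≤ y 0}, Φ (y 0) (fun i => y i.succ) =
      ∫⁻ t in Set.Ioi (0 : ℝ), ∫⁻ x, Φ t x := by
  have hp := volume_preserving_piFinSuccAbove (fun _ : Fin 3 => ℝ) 0
  have h := hp.setLIntegral_comp_preimage (s := Set.Ici (0 : ℝ) ×ˢ Set.univ)
    (measurableSet_Ici.prod MeasurableSet.univ) hΦ
  have hset : (MeasurableEquiv.piFinSuccAbove (fun _ : Fin 3 => ℝ) 0) ⁻¹'
      (Set.Ici (0 : ℝ) ×ˢ Set.univ) = {y : Fin 3 → ℝ | 0 ≤ y 0} := by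
    ext y
    simp [MeasurableEquiv.piFinSuccAbove, Fin.insertNthEquiv]
  rw [hset] at h
  refine Eq.trans ?_ (h.trans ?_)
  · rfl
  · rw [Measure.volume_eq_prod, ← Measure.prod_restrict, Measure.restrict_univ,
      lintegral_prod _ hΦ.aemeasurable, Measure.restrict_congr_set Ioi_ae_eq_Ici.symm]
    rfl

lemma det3_le {F G H : (Fin 3 → ℝ) → ℝ} {y : Fin 3 → ℝ} {a b c A B D : ℝ}
    (hA : 0 < A) (hB : 0 < B) (hD : 0 < D)
    (ha : ∀ k, |d3 F k y| ≤ a) (hb : ∀ k, |d3 G k y| ≤ b) (hc : ∀ k, |d3 H k y| ≤ c) :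
    |det3 F G H y| ≤ 2 * (A * B * D) * ((A ^ 3)⁻¹ * a ^ 3 + (B ^ 3)⁻¹ * b ^ 3
      + (D ^ 3)⁻¹ * c ^ 3) := by
  have a0 : 0 ≤ a := (abs_nonneg _).trans (ha 0)
  have b0 : 0 ≤ b := (abs_nonneg _).trans (hb 0)
  have c0 : 0 ≤ c := (abs_nonneg _).trans (hc 0)
  have h2 : ∀ i j, |d3 G i y * d3 H j y - d3 G j y * d3 H i y| ≤ b * c + b * c := by
    intro i j
    refine (abs_sub _ _).trans ?_
    rw [abs_mul, abs_mul]
    gcongr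
    exacts [hb _, hc _, hb _, hc _]
  have h3 : ∀ k i j, |d3 F k y * (d3 G i y * d3 H j y - d3 G j y * d3 H i y)| ≤
      a * (b * c + b * c) := by
    intro k i j
    rw [abs_mul]
    gcongr
    exacts [ha _, h2 _ _]
  have h4 : |det3 F G H y| ≤ 6 * (a * b * c) := by
    unfold det3
    refine (abs_add_three _ _ _).trans ?_
    have := h3 0 1 2
    have := h3 1 2 0
    have := h3 2 0 1
    linarith
  refine h4.trans ?_
  obtain ⟨p, rfl⟩ : ∃ p, a = A * p := ⟨a / A, by field_simp⟩
  obtain ⟨q, rfl⟩ : ∃ q, b = B * q := ⟨b / B, by field_simp⟩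
  obtain ⟨r, rfl⟩ : ∃ r, c = D * r := ⟨c / D, by field_simp⟩
  have p0 : 0 ≤ p := nonneg_of_mul_nonneg_right a0 hA
  have q0 : 0 ≤ q := nonneg_of_mul_nonneg_right b0 hB
  have r0 : 0 ≤ r := nonneg_of_mul_nonneg_right c0 hD
  have e : (A ^ 3)⁻¹ * (A * p) ^ 3 + (B ^ 3)⁻¹ * (B * q) ^ 3 + (D ^ 3)⁻¹ * (D * r) ^ 3 =
      p ^ 3 + q ^ 3 + r ^ 3 := by field_simp
  rw [e]
  have h5 : 3 * (p * q * r) ≤ p ^ 3 + q ^ 3 + r ^ 3 := by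
    nlinarith [mul_nonneg (add_nonneg (add_nonneg p0 q0) r0)
      (add_nonneg (add_nonneg (sq_nonneg (p - q)) (sq_nonneg (q - r))) (sq_nonneg (p - r)))]
  have h6 : 0 ≤ A * B * D := by positivity
  nlinarith [mul_le_mul_of_nonneg_left h5 h6]

lemma pd_hasCompactSupport {f : (Fin 2 → ℝ) → ℝ} (hs : HasCompactSupport f) (i : Fin 2) :
    HasCompactSupport (pd f i) :=
  (hs.fderiv (𝕜 := ℝ)).comp_left (g := fun L : (Fin 2 → ℝ) →L[ℝ] ℝ => L (Pi.single i 1)) (by simp)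

lemma gr_hasCompactSupport {f : (Fin 2 → ℝ) → ℝ} (hs : HasCompactSupport f) :
    HasCompactSupport (gr f) :=
  ((pd_hasCompactSupport hs 0).comp_left (g := fun s : ℝ => |s|) (by simp)).add
    ((pd_hasCompactSupport hs 1).comp_left (g := fun s : ℝ => |s|) (by simp))

lemma lintegral_lin3 {X : Type} [MeasurableSpace X] {μ : Measure X} {a b c : X → ENNReal}
    (ha : Measurable a) (hb : Measurable b) (hc : Measurable c) (k p q r : ENNReal) :
    ∫⁻ y, k * (p * a y + q * b y + r * c y) ∂μ =
      k * (p * (∫⁻ y, a y ∂μ) + q * (∫⁻ y, b y ∂μ) + r * (∫⁻ y, c y ∂μ)) := by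
  rw [lintegral_const_mul _ (by fun_prop), lintegral_add_left (by fun_prop),
    lintegral_add_left (by fun_prop), lintegral_const_mul _ ha, lintegral_const_mul _ hb,
    lintegral_const_mul _ hc]

lemma box_bound {f g h : (Fin 2 → ℝ) → ℝ} (hf : ContDiff ℝ (⊤ : ℕ∞) f)
    (hg : ContDiff ℝ (⊤ : ℕ∞) g) (hh : ContDiff ℝ (⊤ : ℕ∞) h)
    (sf : HasCompactSupport f) (sg : HasCompactSupport g) (sh : HasCompactSupport h)
    {A B D : ℝ} (hA : 0 < A) (hB : 0 < B) (hD : 0 < D)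
    (fA : ∫ x, gr f x ^ 2 ≤ A ^ 2) (gB : ∫ x, gr g x ^ 2 ≤ B ^ 2) (hD2 : ∫ x, gr h x ^ 2 ≤ D ^ 2)
    (S : Set (Fin 3 → ℝ)) (hS : S ⊆ {y | 0 ≤ y 0}) :
    |∫ y in S, det3 (ext3 f) (ext3 g) (ext3 h) y| ≤ 48 * (A * B * D) := by
  have cf := avg_continuous (gr_continuous hf)
  have cg := avg_continuous (gr_continuous hg)
  have ch := avg_continuous (gr_continuous hh)
  have nf := avg_nonneg (gr_nonneg f)
  have ng := avg_nonneg (gr_nonneg g)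
  have nh := avg_nonneg (gr_nonneg h)
  have mf : Measurable fun p : ℝ × (Fin 2 → ℝ) => ENNReal.ofReal (avg (gr f) p.1 p.2 ^ 3) :=
    (cf.pow 3).measurable.ennreal_ofReal
  have mg : Measurable fun p : ℝ × (Fin 2 → ℝ) => ENNReal.ofReal (avg (gr g) p.1 p.2 ^ 3) :=
    (cg.pow 3).measurable.ennreal_ofReal
  have mh : Measurable fun p : ℝ × (Fin 2 → ℝ) => ENNReal.ofReal (avg (gr h) p.1 p.2 ^ 3) :=
    (ch.pow 3).measurable.ennreal_ofReal
  have bf := cube_bound (gr_continuous hf) (gr_hasCompactSupport sf) (gr_nonneg f) hA fA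
  have bg := cube_bound (gr_continuous hg) (gr_hasCompactSupport sg) (gr_nonneg g) hB gB
  have bh := cube_bound (gr_continuous hh) (gr_hasCompactSupport sh) (gr_nonneg h) hD hD2
  rw [← lintegral_half (fun t x => ENNReal.ofReal (avg (gr f) t x ^ 3)) mf] at bf
  rw [← lintegral_half (fun t x => ENNReal.ofReal (avg (gr g) t x ^ 3)) mg] at bg
  rw [← lintegral_half (fun t x => ENNReal.ofReal (avg (gr h) t x ^ 3)) mh] at bh
  have mt : Measurable fun y : Fin 3 → ℝ => (y 0, fun i : Fin 2 => y i.succ) :=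
    Continuous.measurable (by fun_prop)
  have mf' := mf.comp mt
  have mg' := mg.comp mt
  have mh' := mh.comp mt
  have key : ‖∫ y in S, det3 (ext3 f) (ext3 g) (ext3 h) y‖ₑ ≤ ENNReal.ofReal (48 * (A * B * D)) := by
    calc _ ≤ ∫⁻ y in S, ‖det3 (ext3 f) (ext3 g) (ext3 h) y‖ₑ := enorm_integral_le_lintegral_enorm _
      _ ≤ ∫⁻ y in {y : Fin 3 → ℝ | 0 ≤ y 0}, ‖det3 (ext3 f) (ext3 g) (ext3 h) y‖ₑ :=
          lintegral_mono_set hS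
      _ ≤ ∫⁻ y in {y : Fin 3 → ℝ | 0 ≤ y 0}, ENNReal.ofReal (2 * (A * B * D)) *
          (ENNReal.ofReal (A ^ 3)⁻¹ * ENNReal.ofReal (avg (gr f) (y 0) (fun i => y i.succ) ^ 3)
          + ENNReal.ofReal (B ^ 3)⁻¹ * ENNReal.ofReal (avg (gr g) (y 0) (fun i => y i.succ) ^ 3)
          + ENNReal.ofReal (D ^ 3)⁻¹ * ENNReal.ofReal (avg (gr h) (y 0) (fun i => y i.succ) ^ 3)) := by
          refine lintegral_mono fun y => ?_
          have n1 := nf (y 0) (fun i => y i.succ)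
          have n2 := ng (y 0) (fun i => y i.succ)
          have n3 := nh (y 0) (fun i => y i.succ)
          rw [Real.enorm_eq_ofReal_abs, ← ENNReal.ofReal_mul (by positivity),
            ← ENNReal.ofReal_mul (by positivity), ← ENNReal.ofReal_mul (by positivity),
            ← ENNReal.ofReal_add (by positivity) (by positivity),
            ← ENNReal.ofReal_add (by positivity) (by positivity),
            ← ENNReal.ofReal_mul (by positivity)]
          exact ENNReal.ofReal_le_ofReal (det3_le hA hB hD (ext3_fderiv_le hf y)
            (ext3_fderiv_le hg y) (ext3_fderiv_le hh y))
      _ = ENNReal.ofReal (2 * (A * B * D)) *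
          (ENNReal.ofReal (A ^ 3)⁻¹ * (∫⁻ y in {y : Fin 3 → ℝ | 0 ≤ y 0},
            ENNReal.ofReal (avg (gr f) (y 0) (fun i => y i.succ) ^ 3))
          + ENNReal.ofReal (B ^ 3)⁻¹ * (∫⁻ y in {y : Fin 3 → ℝ | 0 ≤ y 0},
            ENNReal.ofReal (avg (gr g) (y 0) (fun i => y i.succ) ^ 3))
          + ENNReal.ofReal (D ^ 3)⁻¹ * (∫⁻ y in {y : Fin 3 → ℝ | 0 ≤ y 0},
            ENNReal.ofReal (avg (gr h) (y 0) (fun i => y i.succ) ^ 3))) := by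
          exact lintegral_lin3 mf' mg' mh' _ _ _ _
      _ ≤ ENNReal.ofReal (2 * (A * B * D)) *
          (ENNReal.ofReal (A ^ 3)⁻¹ * ENNReal.ofReal (8 * A ^ 3)
          + ENNReal.ofReal (B ^ 3)⁻¹ * ENNReal.ofReal (8 * B ^ 3)
          + ENNReal.ofReal (D ^ 3)⁻¹ * ENNReal.ofReal (8 * D ^ 3)) := by
          gcongr
      _ = _ := by
          rw [← ENNReal.ofReal_mul (by positivity),
            ← ENNReal.ofReal_mul (by positivity), ← ENNReal.ofReal_mul (by positivity),
            ← ENNReal.ofReal_add (by positivity) (by positivity),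
            ← ENNReal.ofReal_add (by positivity) (by positivity),
            ← ENNReal.ofReal_mul (by positivity)]
          congr 1
          field_simp
          ring
  rw [Real.enorm_eq_ofReal_abs] at key
  exact (ENNReal.ofReal_le_ofReal_iff (by positivity)).1 key

lemma wente {f g h : (Fin 2 → ℝ) → ℝ} (hf : ContDiff ℝ (⊤ : ℕ∞) f)
    (hg : ContDiff ℝ (⊤ : ℕ∞) g) (hh : ContDiff ℝ (⊤ : ℕ∞) h)
    (sf : HasCompactSupport f) (sg : HasCompactSupport g) (sh : HasCompactSupport h)
    {A B D : ℝ} (hA : 0 < A) (hB : 0 < B) (hD : 0 < D)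
    (fA : ∫ x, gr f x ^ 2 ≤ A ^ 2) (gB : ∫ x, gr g x ^ 2 ≤ B ^ 2)
    (hD2 : ∫ x, gr h x ^ 2 ≤ D ^ 2) :
    |∫ x, f x * (pd g 0 x * pd h 1 x - pd g 1 x * pd h 0 x)| ≤ 48 * (A * B * D) := by
  obtain ⟨R0, hR0⟩ : ∃ R0 : ℝ, ∀ x, R0 < ‖x‖ → f x = 0 := by
    obtain ⟨R0, h⟩ := sf.isBounded.exists_norm_le
    refine ⟨R0, fun x hx => ?_⟩
    by_contra hne
    exact absurd (h x (subset_tsupport f hne)) (not_le.2 hx)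
  wlog hR0p : 0 ≤ R0 generalizing R0
  · exact this 0 (fun x hx => hR0 x ((not_le.1 hR0p).trans hx)) le_rfl
  obtain ⟨a, ha, hfa⟩ : ∃ a : ℝ, 0 < a ∧ ∫ x, f x ^ 2 ≤ a ^ 2 := by
    have h0 : 0 ≤ ∫ x, f x ^ 2 := integral_nonneg fun x => sq_nonneg _
    exact ⟨(∫ x, f x ^ 2) + 1, by linarith, by nlinarith⟩
  set J := ∫ x, f x * (pd g 0 x * pd h 1 x - pd g 1 x * pd h 0 x) with hJ
  have main : ∀ T : ℝ, R0 + 1 ≤ T → |J| ≤ 48 * (A * B * D) + 32 * (a * B * D) / T := by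
    intro T hT
    have hT0 : 0 < T := by linarith
    set R := R0 + T + 1 with hR
    have hRp : 0 < R := by linarith
    have hst := stokes (ext3_contDiff hf) (ext3_contDiff hg) (ext3_contDiff hh) hT0.le hRp.le ?_
    · have hb := box_bound hf hg hh sf sg sh hA hB hD fA gB hD2
        (Set.Icc (Fin.cons 0 (fun _ => -R) : Fin 3 → ℝ) (Fin.cons T (fun _ => R)))
        (fun y hy => by have := hy.1 0; simpa using this)
      have hJ0 : ∫ x in Set.Icc (fun _ => -R : Fin 2 → ℝ) (fun _ => R),
          vf (ext3 f) (ext3 g) (ext3 h) 0 (Fin.cons 0 x) = J := by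
        have e : ∀ x, vf (ext3 f) (ext3 g) (ext3 h) 0 (Fin.cons 0 x) =
            f x * (pd g 0 x * pd h 1 x - pd g 1 x * pd h 0 x) := by
          intro x
          have e1 := ext3_fderiv_zero hg x 0
          have e2 := ext3_fderiv_zero hg x 1
          have e3 := ext3_fderiv_zero hh x 0
          have e4 := ext3_fderiv_zero hh x 1
          unfold vf
          rw [ext3_zero, ← e1, ← e2, ← e3, ← e4]
          rfl
        simp only [e]
        refine setIntegral_eq_integral_of_forall_compl_eq_zero fun x hx => ?_
        rw [hR0 x, zero_mul]
        by_contra hcon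
        refine hx ?_
        have : ‖x‖ ≤ R := by linarith
        rw [pi_norm_le_iff_of_nonneg hRp.le] at this
        exact ⟨fun i => (abs_le.1 (this i)).1, fun i => (abs_le.1 (this i)).2⟩
      have hJT : |∫ x in Set.Icc (fun _ => -R : Fin 2 → ℝ) (fun _ => R),
          vf (ext3 f) (ext3 g) (ext3 h) 0 (Fin.cons T x)| ≤ 32 * (a * B * D) / T := by
        have hbd : ∀ x : Fin 2 → ℝ, ‖vf (ext3 f) (ext3 g) (ext3 h) 0 (Fin.cons T x)‖ ≤
            (a / T) * ((B / T) * (D / T) + (B / T) * (D / T)) := by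
          intro x
          have b1 : |ext3 f (Fin.cons T x)| ≤ a / T :=
            avg_abs_le hf.continuous sf ha hT0 hfa _
          have b2 : ∀ k, |d3 (ext3 g) k (Fin.cons T x)| ≤ B / T := fun k =>
            (ext3_fderiv_le hg _ k).trans ((le_abs_self _).trans (avg_abs_le (gr_continuous hg)
              (gr_hasCompactSupport sg) hB hT0 gB _))
          have b3 : ∀ k, |d3 (ext3 h) k (Fin.cons T x)| ≤ D / T := fun k =>
            (ext3_fderiv_le hh _ k).trans ((le_abs_self _).trans (avg_abs_le (gr_continuous hh)
              (gr_hasCompactSupport sh) hD hT0 hD2 _))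
          unfold vf
          rw [Real.norm_eq_abs, abs_mul]
          gcongr
          refine (abs_sub _ _).trans ?_
          rw [abs_mul, abs_mul]
          gcongr
          exacts [b2 _, b3 _, b2 _, b3 _]
        have hv : volume.real (Set.Icc (fun _ => -R : Fin 2 → ℝ) (fun _ => R)) = (2 * R) ^ 2 := by
          rw [measureReal_def, Real.volume_Icc_pi_toReal (fun i => by simp only; linarith)]
          simp
          ring
        have hfin : volume (Set.Icc (fun _ => -R : Fin 2 → ℝ) (fun _ => R)) < ⊤ :=
          isCompact_Icc.measure_lt_top
        refine (norm_setIntegral_le_of_norm_le_const hfin fun x _ => hbd x).trans ?_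
        rw [hv]
        have hR2 : 2 * R ≤ 4 * T := by linarith
        calc _ ≤ (a / T) * ((B / T) * (D / T) + (B / T) * (D / T)) * (4 * T) ^ 2 := by gcongr
          _ = _ := by field_simp; ring
      rw [hJ0] at hst
      have e : J = (∫ x in Set.Icc (fun _ => -R : Fin 2 → ℝ) (fun _ => R),
          vf (ext3 f) (ext3 g) (ext3 h) 0 (Fin.cons T x)) - ∫ y in Set.Icc
          (Fin.cons 0 (fun _ => -R) : Fin 3 → ℝ) (Fin.cons T (fun _ => R)),
          det3 (ext3 f) (ext3 g) (ext3 h) y := by linarith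
      rw [e]
      refine (abs_sub _ _).trans ?_
      linarith
    · rintro y hy0 hyT ⟨i, hi⟩
      unfold ext3 avg
      refine setIntegral_eq_zero_of_forall_eq_zero fun z hz => hR0 _ ?_
      have h1 := norm_le_pi_norm ((fun i => y i.succ) + y 0 • z : Fin 2 → ℝ) i
      refine lt_of_lt_of_le ?_ h1
      simp only [Pi.add_apply, Pi.smul_apply, smul_eq_mul, Real.norm_eq_abs]
      have hz0 : 0 ≤ z i := hz.1 i
      have hz1 : z i ≤ 1 := hz.2 i
      have h2 : |y 0 * z i| ≤ T := by
        rw [abs_of_nonneg (by positivity)]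
        nlinarith
      have h3 := abs_sub_abs_le_abs_sub (y i.succ) (-(y 0 * z i))
      rw [abs_neg, sub_neg_eq_add, hi] at h3
      linarith
  refine le_of_forall_pos_le_add fun ε hε => ?_
  set M := 32 * (a * B * D) with hM
  have hMp : 0 < M := by positivity
  refine (main (max (R0 + 1) (M / ε)) (le_max_left _ _)).trans ?_
  gcongr
  rw [div_le_iff₀ (lt_of_lt_of_le (by positivity) (le_max_right _ _))]
  calc M = ε * (M / ε) := by field_simp
    _ ≤ _ := by gcongr; exact le_max_right _ _

lemma gr_sq_integral {f : (Fin 2 → ℝ) → ℝ} (hf : ContDiff ℝ (⊤ : ℕ∞) f)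
    (sf : HasCompactSupport f) {N : (Fin 2 → ℝ) → ℝ} (hN : Integrable N)
    (hle : ∀ x, ∑ i, pd f i x ^ 2 ≤ N x) {ε : ℝ} (hε : 0 < ε) :
    ∫ x, gr f x ^ 2 ≤ (2 * (Real.sqrt (∫ x, N x) + ε)) ^ 2 := by
  have hc := gr_continuous hf
  have hi : Integrable (fun y => gr f y ^ 2) := by
    refine Continuous.integrable_of_hasCompactSupport (by fun_prop) ?_
    exact (gr_hasCompactSupport sf).comp_left (g := fun s : ℝ => s ^ 2) (by simp)
  have h1 : ∫ x, gr f x ^ 2 ≤ ∫ x, 2 * N x := by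
    refine integral_mono hi (hN.const_mul 2) fun x => ?_
    have := hle x
    rw [Fin.sum_univ_two] at this
    simp only [gr]
    nlinarith [sq_nonneg (|pd f 0 x| - |pd f 1 x|), sq_abs (pd f 0 x), sq_abs (pd f 1 x)]
  have h0 : 0 ≤ ∫ x, N x := integral_nonneg fun x =>
    (Finset.sum_nonneg fun i _ => sq_nonneg _).trans (hle x)
  rw [integral_const_mul] at h1
  have h2 := Real.sq_sqrt h0
  have h3 := Real.sqrt_nonneg (∫ x, N x)
  nlinarith

lemma pd_sq_integrable {f : (Fin 2 → ℝ) → ℝ} (hf : ContDiff ℝ (⊤ : ℕ∞) f)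
    (sf : HasCompactSupport f) (i : Fin 2) : Integrable (fun x => pd f i x ^ 2) := by
  have hc := pd_continuous hf i
  refine Continuous.integrable_of_hasCompactSupport (by fun_prop) ?_
  exact (pd_hasCompactSupport sf i).comp_left (g := fun s : ℝ => s ^ 2) (by simp)

lemma jac_integrable {f g h : (Fin 2 → ℝ) → ℝ} (hf : ContDiff ℝ (⊤ : ℕ∞) f)
    (hg : ContDiff ℝ (⊤ : ℕ∞) g) (hh : ContDiff ℝ (⊤ : ℕ∞) h) (sf : HasCompactSupport f) :
    Integrable (fun x => f x * (pd g 0 x * pd h 1 x - pd g 1 x * pd h 0 x)) := by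
  have c0 := hf.continuous
  have c1 := pd_continuous hg
  have c2 := pd_continuous hh
  exact Continuous.integrable_of_hasCompactSupport (by fun_prop) sf.mul_right

/-- div-curl (compensated compactness / `ℋ¹`-BMO duality) estimate
for the pressure term on `ℝ²`. -/
theorem div_curl_pressure_estimate :
    ∃ C > 0, ∀ (P : (Fin 2 → ℝ) → ℝ) (u v : (Fin 2 → ℝ) → Fin 2 → ℝ),
      ContDiff ℝ (⊤ : ℕ∞) P → ContDiff ℝ (⊤ : ℕ∞) u → ContDiff ℝ (⊤ : ℕ∞) v →
      HasCompactSupport P → HasCompactSupport u → HasCompactSupport v →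
      (∀ x, ∑ i, pd (fun y => u y i) i x = 0) →
      |∫ x, P x * ∑ i, ∑ j, pd (fun y => u y j) i x * pd (fun y => v y i) j x|
        ≤ C * Real.sqrt (∫ x, ∑ i, (pd P i x) ^ 2)
            * Real.sqrt (∫ x, ∑ i, ∑ j, (pd (fun y => u y j) i x) ^ 2)
            * Real.sqrt (∫ x, ∑ i, ∑ j, (pd (fun y => v y j) i x) ^ 2) := by
  refine ⟨768, by norm_num, ?_⟩
  intro P u v hP hu hv sP su sv hdiv
  have hu' : ∀ i, ContDiff ℝ (⊤ : ℕ∞) (fun y => u y i) := fun i => by fun_prop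
  have hv' : ∀ i, ContDiff ℝ (⊤ : ℕ∞) (fun y => v y i) := fun i => by fun_prop
  have su' : ∀ i, HasCompactSupport (fun y => u y i) := fun i =>
    su.comp_left (g := fun a : Fin 2 → ℝ => a i) rfl
  have sv' : ∀ i, HasCompactSupport (fun y => v y i) := fun i =>
    sv.comp_left (g := fun a : Fin 2 → ℝ => a i) rfl
  have iP : Integrable (fun x => ∑ i, (pd P i x) ^ 2) :=
    integrable_finsetSum _ fun i _ => pd_sq_integrable hP sP i
  have iu : Integrable (fun x => ∑ i, ∑ j, (pd (fun y => u y j) i x) ^ 2) :=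
    integrable_finsetSum _ fun i _ => integrable_finsetSum _ fun j _ =>
      pd_sq_integrable (hu' j) (su' j) i
  have iv : Integrable (fun x => ∑ i, ∑ j, (pd (fun y => v y j) i x) ^ 2) :=
    integrable_finsetSum _ fun i _ => integrable_finsetSum _ fun j _ =>
      pd_sq_integrable (hv' j) (sv' j) i
  have lu : ∀ k x, ∑ i, pd (fun y => u y k) i x ^ 2 ≤
      ∑ i, ∑ j, (pd (fun y => u y j) i x) ^ 2 := fun k x =>
    Finset.sum_le_sum fun i _ => Finset.single_le_sum
      (f := fun j => pd (fun y => u y j) i x ^ 2) (fun j _ => sq_nonneg _) (Finset.mem_univ k)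
  have lv : ∀ k x, ∑ i, pd (fun y => v y k) i x ^ 2 ≤
      ∑ i, ∑ j, (pd (fun y => v y j) i x) ^ 2 := fun k x =>
    Finset.sum_le_sum fun i _ => Finset.single_le_sum
      (f := fun j => pd (fun y => v y j) i x ^ 2) (fun j _ => sq_nonneg _) (Finset.mem_univ k)
  have hrew : ∀ x, P x * ∑ i, ∑ j, pd (fun y => u y j) i x * pd (fun y => v y i) j x =
      P x * (pd (fun y => u y 1) 0 x * pd (fun y => v y 0) 1 x
        - pd (fun y => u y 1) 1 x * pd (fun y => v y 0) 0 x) -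
      P x * (pd (fun y => u y 0) 0 x * pd (fun y => v y 1) 1 x
        - pd (fun y => u y 0) 1 x * pd (fun y => v y 1) 0 x) := by
    intro x
    have := hdiv x
    simp only [Fin.sum_univ_two] at this ⊢
    have e : pd (fun y => u y 0) 0 x = - pd (fun y => u y 1) 1 x := by linarith
    rw [e]
    ring
  simp only [hrew]
  rw [integral_sub (jac_integrable hP (hu' 1) (hv' 0) sP) (jac_integrable hP (hu' 0) (hv' 1) sP)]
  set a := Real.sqrt (∫ x, ∑ i, (pd P i x) ^ 2) with ha
  set b := Real.sqrt (∫ x, ∑ i, ∑ j, (pd (fun y => u y j) i x) ^ 2) with hb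
  set c := Real.sqrt (∫ x, ∑ i, ∑ j, (pd (fun y => v y j) i x) ^ 2) with hc
  have a0 : 0 ≤ a := Real.sqrt_nonneg _
  have b0 : 0 ≤ b := Real.sqrt_nonneg _
  have c0 : 0 ≤ c := Real.sqrt_nonneg _
  have hlim : Filter.Tendsto (fun ε : ℝ => 768 * (a + ε) * (b + ε) * (c + ε))
      (nhdsWithin 0 (Set.Ioi 0)) (nhds (768 * a * b * c)) := by
    have : Continuous (fun ε : ℝ => 768 * (a + ε) * (b + ε) * (c + ε)) := by fun_prop
    have h := (this.tendsto 0).mono_left (nhdsWithin_le_nhds (s := Set.Ioi (0 : ℝ)))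
    simpa using h
  refine ge_of_tendsto hlim ?_
  filter_upwards [self_mem_nhdsWithin] with ε hε
  have hε : 0 < ε := hε
  have w1 := wente hP (hu' 1) (hv' 0) sP (su' 1) (sv' 0) (A := 2 * (a + ε)) (B := 2 * (b + ε))
    (D := 2 * (c + ε)) (by positivity) (by positivity) (by positivity)
    (gr_sq_integral hP sP iP (fun x => le_rfl) hε)
    (gr_sq_integral (hu' 1) (su' 1) iu (lu 1) hε)
    (gr_sq_integral (hv' 0) (sv' 0) iv (lv 0) hε)
  have w2 := wente hP (hu' 0) (hv' 1) sP (su' 0) (sv' 1) (A := 2 * (a + ε)) (B := 2 * (b + ε))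
    (D := 2 * (c + ε)) (by positivity) (by positivity) (by positivity)
    (gr_sq_integral hP sP iP (fun x => le_rfl) hε)
    (gr_sq_integral (hu' 0) (su' 0) iu (lu 0) hε)
    (gr_sq_integral (hv' 1) (sv' 1) iv (lv 1) hε)
  refine (abs_sub _ _).trans ((add_le_add w1 w2).trans (le_of_eq ?_))
  ring
end

section
/- Let p ∈ (2,∞). There exist δ ∈ (0,1) and, for every μ̄ > 0 and ρ^M > 0, a constant C>0 depending only on p, δ, μ̄ and ρ^M, such that the following holds. Let μ:𝕋²→ℝ be smooth with ‖μ/μ̄ − 1‖_{L^∞} < δ, let ρ:𝕋²→[0,ρ^M] be smooth, and let v, h:𝕋²→ℝ² and P:𝕋²→ℝ be smooth with ∇·v = 0 and ρ h = ∇·(μ 𝔻v) − ∇P pointwise on 𝕋². Then ‖∇v‖_{L^p(𝕋²)} ≤ C ‖√μ 𝔻v‖^{2/p}_{L²(𝕋²)} ‖√ρ h‖^{1−2/p}_{L²(𝕋²)}. -/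
open MeasureTheory

/-- A function on `ℝ²` is `ℤ²`-periodic, i.e. descends to the torus `𝕋² = (ℝ/ℤ)²`. -/
def Per (f : (Fin 2 → ℝ) → ℝ) : Prop :=
  ∀ (x : Fin 2 → ℝ) (k : Fin 2 → ℤ), f (x + fun i => (k i : ℝ)) = f x

/-- The fundamental domain of the torus `𝕋² = (ℝ/ℤ)²`. -/
def T2 : Set (Fin 2 → ℝ) := Set.Icc 0 1

/-- The symmetric gradient `(𝔻v)_{jk} = ∂_j v_k + ∂_k v_j` of a vector field. -/
noncomputable def Dsym (v : (Fin 2 → ℝ) → Fin 2 → ℝ) (j k : Fin 2) (x : Fin 2 → ℝ) : ℝ :=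
  pd (fun y => v y k) j x + pd (fun y => v y j) k x

open MeasureTheory

noncomputable def ee (n : Fin 2 → ℤ) (x : Fin 2 → ℝ) : ℂ :=
  Complex.exp (2 * Real.pi * Complex.I * (n 0 * x 0 + n 1 * x 1))

noncomputable def tp (S : Finset (Fin 2 → ℤ)) (a : (Fin 2 → ℤ) → ℂ) (x : Fin 2 → ℝ) : ℂ :=
  ∑ n ∈ S, a n * ee n x

noncomputable def fc (g : (Fin 2 → ℝ) → ℂ) (n : Fin 2 → ℤ) : ℂ :=
  ∫ x in T2, g x * ee (-n) x

lemma ee_add (m n : Fin 2 → ℤ) (x : Fin 2 → ℝ) : ee (m + n) x = ee m x * ee n x := by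
  unfold ee
  rw [← Complex.exp_add]
  congr 1
  simp only [Pi.add_apply, Int.cast_add]
  ring

lemma ee_zero (x : Fin 2 → ℝ) : ee 0 x = 1 := by
  simp [ee]

lemma ee_eq (n : Fin 2 → ℤ) (x : Fin 2 → ℝ) :
    ee n x = Complex.exp (((2 * Real.pi * (n 0 * x 0 + n 1 * x 1) : ℝ) : ℂ) * Complex.I) := by
  unfold ee
  congr 1
  push_cast
  ring

lemma norm_ee (n : Fin 2 → ℤ) (x : Fin 2 → ℝ) : ‖ee n x‖ = 1 := by
  rw [ee_eq, Complex.norm_exp_ofReal_mul_I]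

lemma conj_ee (n : Fin 2 → ℤ) (x : Fin 2 → ℝ) : (starRingEnd ℂ) (ee n x) = ee (-n) x := by
  unfold ee
  rw [← Complex.exp_conj]
  congr 1
  simp [map_ofNat]
  ring

@[fun_prop]
lemma continuous_ee (n : Fin 2 → ℤ) : Continuous (ee n) := by
  unfold ee
  fun_prop

@[fun_prop]
lemma continuous_tp (S : Finset (Fin 2 → ℤ)) (a : (Fin 2 → ℤ) → ℂ) : Continuous (tp S a) := by
  unfold tp
  fun_prop

lemma isCompact_T2 : IsCompact T2 := isCompact_Icc

lemma measurableSet_T2 : MeasurableSet T2 := measurableSet_Icc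

lemma volume_T2 : volume T2 = 1 := by
  unfold T2
  rw [Real.volume_Icc_pi]
  simp

instance instProbT2 : IsProbabilityMeasure (volume.restrict T2) :=
  ⟨by rw [Measure.restrict_apply_univ, volume_T2]⟩

lemma intOn_T2 {E : Type*} [NormedAddCommGroup E] {f : (Fin 2 → ℝ) → E} (hf : Continuous f) :
    Integrable f (volume.restrict T2) :=
  hf.continuousOn.integrableOn_compact isCompact_T2

lemma int2 {E : Type*} [NormedAddCommGroup E] [NormedSpace ℝ E] [CompleteSpace E]
    {f : (Fin 2 → ℝ) → E} (hf : Continuous f) :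
    ∫ x in T2, f x = ∫ s in (0:ℝ)..1, ∫ t in (0:ℝ)..1, f ![s, t] := by
  have hmp := (volume_preserving_finTwoArrow ℝ).symm
  have h1 : ∫ x in T2, f x
      = ∫ z in (Set.Icc (0:ℝ) 1 ×ˢ Set.Icc (0:ℝ) 1), f ![z.1, z.2] := by
    have := hmp.setIntegral_preimage_emb
      (MeasurableEquiv.finTwoArrow (α := ℝ)).symm.measurableEmbedding f T2
    rw [← this]
    have hs : ((MeasurableEquiv.finTwoArrow (α := ℝ)).symm ⁻¹' T2)
        = (Set.Icc (0:ℝ) 1 ×ˢ Set.Icc (0:ℝ) 1) := by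
      ext ⟨a, b⟩
      simp [T2, MeasurableEquiv.finTwoArrow, Set.mem_Icc, Pi.le_def, Fin.forall_fin_two]
    rw [hs]
    rfl
  rw [h1, Measure.volume_eq_prod, setIntegral_prod]
  · rw [intervalIntegral.integral_of_le zero_le_one, integral_Icc_eq_integral_Ioc]
    refine setIntegral_congr_fun measurableSet_Ioc fun s _ => ?_
    simp only
    rw [intervalIntegral.integral_of_le zero_le_one, integral_Icc_eq_integral_Ioc]
  · apply ContinuousOn.integrableOn_compact (isCompact_Icc.prod isCompact_Icc)
    apply Continuous.continuousOn
    apply hf.comp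
    apply continuous_pi
    intro i
    fin_cases i <;> simp <;> fun_prop

lemma cont_vec : Continuous (fun z : ℝ × ℝ => (![z.1, z.2] : Fin 2 → ℝ)) := by
  apply continuous_pi
  intro i
  fin_cases i <;> simp <;> fun_prop

lemma int2' {E : Type*} [NormedAddCommGroup E] [NormedSpace ℝ E] [CompleteSpace E]
    {f : (Fin 2 → ℝ) → E} (hf : Continuous f) :
    ∫ x in T2, f x = ∫ t in (0:ℝ)..1, ∫ s in (0:ℝ)..1, f ![s, t] := by
  rw [int2 hf]
  apply intervalIntegral_intervalIntegral_swap
  rw [Set.uIoc_of_le zero_le_one]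
  have : IntegrableOn (fun z : ℝ × ℝ => f ![z.1, z.2])
      (Set.Icc (0:ℝ) 1 ×ˢ Set.Icc (0:ℝ) 1) (volume.prod volume) :=
    (hf.comp cont_vec).continuousOn.integrableOn_compact (isCompact_Icc.prod isCompact_Icc)
  exact this.mono_set (Set.prod_mono Set.Ioc_subset_Icc_self Set.Ioc_subset_Icc_self)

lemma int_exp1 (k : ℤ) : ∫ s in (0:ℝ)..1, Complex.exp (2 * Real.pi * Complex.I * k * s)
    = if k = 0 then 1 else 0 := by
  split_ifs with h
  · simp [h]
  · have hc : (2 * Real.pi * Complex.I * k : ℂ) ≠ 0 := by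
      simp [h, Real.pi_ne_zero]
    rw [integral_exp_mul_complex hc]
    have : Complex.exp (2 * Real.pi * Complex.I * k * (1:ℝ)) = 1 := by
      rw [Complex.exp_eq_one_iff]
      exact ⟨k, by push_cast; ring⟩
    rw [this]
    simp

lemma int_ee (n : Fin 2 → ℤ) : ∫ x in T2, ee n x = if n = 0 then 1 else 0 := by
  rw [int2 (continuous_ee n)]
  have : ∀ s t : ℝ, ee n ![s, t] = Complex.exp (2 * Real.pi * Complex.I * (n 0) * s)
      * Complex.exp (2 * Real.pi * Complex.I * (n 1) * t) := by
    intro s t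
    unfold ee
    rw [← Complex.exp_add]
    congr 1
    simp
    ring
  simp_rw [this, intervalIntegral.integral_const_mul, intervalIntegral.integral_mul_const,
    int_exp1]
  by_cases h0 : n 0 = 0 <;> by_cases h1 : n 1 = 0 <;>
    simp [h0, h1, funext_iff, Fin.forall_fin_two]

lemma int_mul_conj_tp {g : (Fin 2 → ℝ) → ℂ} (hg : Continuous g) (S : Finset (Fin 2 → ℤ))
    (a : (Fin 2 → ℤ) → ℂ) :
    ∫ x in T2, g x * (starRingEnd ℂ) (tp S a x) = ∑ n ∈ S, (starRingEnd ℂ) (a n) * fc g n := by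
  have : ∀ x, g x * (starRingEnd ℂ) (tp S a x)
      = ∑ n ∈ S, (starRingEnd ℂ) (a n) * (g x * ee (-n) x) := by
    intro x
    unfold tp
    rw [map_sum, Finset.mul_sum]
    refine Finset.sum_congr rfl fun n _ => ?_
    rw [map_mul, conj_ee]
    ring
  simp_rw [this]
  rw [integral_finsetSum]
  · refine Finset.sum_congr rfl fun n _ => ?_
    rw [integral_const_mul]
    rfl
  · intro n _
    exact intOn_T2 (by fun_prop)

lemma fc_tp (S : Finset (Fin 2 → ℤ)) (a : (Fin 2 → ℤ) → ℂ) (n : Fin 2 → ℤ) (hn : n ∈ S) :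
    fc (tp S a) n = a n := by
  unfold fc
  have : ∀ x, tp S a x * ee (-n) x = ∑ m ∈ S, a m * ee (m - n) x := by
    intro x
    unfold tp
    rw [Finset.sum_mul]
    refine Finset.sum_congr rfl fun m _ => ?_
    rw [sub_eq_add_neg, ee_add]
    ring
  simp_rw [this]
  rw [integral_finsetSum]
  · simp_rw [integral_const_mul, int_ee, sub_eq_zero]
    simp [hn]
  · intro m _
    exact intOn_T2 (by fun_prop)

lemma tp_sq (S : Finset (Fin 2 → ℤ)) (a : (Fin 2 → ℤ) → ℂ) :
    ∫ x in T2, ‖tp S a x‖ ^ 2 = ∑ n ∈ S, ‖a n‖ ^ 2 := by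
  have h := int_mul_conj_tp (continuous_tp S a) S a
  have h2 : ∀ x, tp S a x * (starRingEnd ℂ) (tp S a x) = ((‖tp S a x‖ ^ 2 : ℝ) : ℂ) := by
    intro x
    rw [Complex.mul_conj']
    push_cast
    rfl
  simp_rw [h2] at h
  rw [integral_complex_ofReal] at h
  have h3 : ∑ n ∈ S, (starRingEnd ℂ) (a n) * fc (tp S a) n = ((∑ n ∈ S, ‖a n‖ ^ 2 : ℝ) : ℂ) := by
    push_cast
    refine Finset.sum_congr rfl fun n hn => ?_
    rw [fc_tp S a n hn, Complex.conj_mul']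
  rw [h3] at h
  exact_mod_cast h

lemma bessel {g : (Fin 2 → ℝ) → ℂ} (hg : Continuous g) (S : Finset (Fin 2 → ℤ)) :
    ∑ n ∈ S, ‖fc g n‖ ^ 2 ≤ ∫ x in T2, ‖g x‖ ^ 2 := by
  have h := int_mul_conj_tp hg S (fc g)
  have h3 : ∑ n ∈ S, (starRingEnd ℂ) (fc g n) * fc g n = ((∑ n ∈ S, ‖fc g n‖ ^ 2 : ℝ) : ℂ) := by
    push_cast
    refine Finset.sum_congr rfl fun n hn => ?_
    rw [Complex.conj_mul']
  rw [h3] at h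
  have hre : ∫ x in T2, (g x * (starRingEnd ℂ) (tp S (fc g) x)).re = ∑ n ∈ S, ‖fc g n‖ ^ 2 := by
    have := integral_re (𝕜 := ℂ) (intOn_T2 (f := fun x => g x * (starRingEnd ℂ) (tp S (fc g) x))
      (by fun_prop))
    simp only [RCLike.re_to_complex] at this
    rw [this, h, Complex.ofReal_re]
  have hpos : 0 ≤ ∫ x in T2, ‖g x - tp S (fc g) x‖ ^ 2 := integral_nonneg fun x => by positivity
  have he : ∀ x, ‖g x - tp S (fc g) x‖ ^ 2
      = ‖g x‖ ^ 2 - 2 * (g x * (starRingEnd ℂ) (tp S (fc g) x)).re + ‖tp S (fc g) x‖ ^ 2 := by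
    intro x
    rw [← Complex.normSq_eq_norm_sq, ← Complex.normSq_eq_norm_sq, ← Complex.normSq_eq_norm_sq,
      Complex.normSq_sub]
    ring
  simp_rw [he] at hpos
  rw [integral_add (intOn_T2 (by fun_prop)) (intOn_T2 (by fun_prop)),
    integral_sub (intOn_T2 (by fun_prop)) (intOn_T2 (by fun_prop)), integral_const_mul, hre,
    tp_sq] at hpos
  linarith
open MeasureTheory

lemma pw_ineq (k : ℕ) : ∃ C : ℝ, 0 ≤ C ∧ ∀ x y : ℝ, y ^ (2 * k) ≤ C * x ^ (2 * k)
    + 2 * ((-1 : ℂ) ^ k * ((x : ℂ) + y * Complex.I) ^ (2 * k)).re := by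
  have hcont : ContinuousAt (fun t : ℝ => ((-1 : ℂ) ^ k * ((t : ℂ) + Complex.I) ^ (2 * k)).re) 0 := by
    apply Continuous.continuousAt
    fun_prop
  have h0 : ((-1 : ℂ) ^ k * (((0:ℝ) : ℂ) + Complex.I) ^ (2 * k)).re = 1 := by
    rw [Complex.ofReal_zero, zero_add, pow_mul, Complex.I_sq, ← mul_pow]
    simp
  have hev := hcont.eventually (lt_mem_nhds (show (1/2 : ℝ) < _ by simp only; rw [h0]; norm_num))
  obtain ⟨η, hη, hball⟩ := Metric.eventually_nhds_iff.mp hev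
  refine ⟨(1/η) ^ (2 * k) + 2 * (1 + 1/η) ^ (2 * k), by positivity, fun x y => ?_⟩
  by_cases hxy : |x| < η * |y|
  · have hy : y ≠ 0 := by
      rintro rfl
      simp at hxy
      exact absurd hxy (not_lt.mpr (abs_nonneg x))
    have h1 := hball (y := x / y) (by
      rw [Real.dist_eq, sub_zero, abs_div, div_lt_iff₀ (abs_pos.mpr hy)]
      exact hxy)
    have h2 : ((-1 : ℂ) ^ k * ((x : ℂ) + y * Complex.I) ^ (2 * k)).re
        = y ^ (2 * k) * ((-1 : ℂ) ^ k * (((x / y : ℝ) : ℂ) + Complex.I) ^ (2 * k)).re := by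
      rw [← Complex.re_ofReal_mul]
      congr 1
      have : (x : ℂ) + y * Complex.I = y * (((x / y : ℝ) : ℂ) + Complex.I) := by
        have : (y : ℂ) ≠ 0 := by exact_mod_cast hy
        push_cast
        field_simp
      rw [this, mul_pow]
      push_cast
      ring
    rw [h2]
    have h3 : 0 ≤ y ^ (2 * k) := by rw [pow_mul]; positivity
    have h4 : 0 ≤ x ^ (2 * k) := by rw [pow_mul]; positivity
    have h5 : 0 ≤ ((1/η) ^ (2 * k) + 2 * (1 + 1/η) ^ (2 * k)) * x ^ (2 * k) := by positivity
    nlinarith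
  · push Not at hxy
    have hy : |y| ≤ 1/η * |x| := by
      rw [one_div, inv_mul_eq_div, le_div_iff₀ hη]
      linarith
    have h1 : y ^ (2 * k) ≤ (1/η) ^ (2 * k) * x ^ (2 * k) := by
      have := pow_le_pow_left₀ (abs_nonneg y) hy (2 * k)
      rw [mul_pow, Even.pow_abs (by simp), Even.pow_abs (by simp)] at this
      exact this
    have h2 : ‖(-1 : ℂ) ^ k * ((x : ℂ) + y * Complex.I) ^ (2 * k)‖
        ≤ (1 + 1/η) ^ (2 * k) * x ^ (2 * k) := by
      rw [norm_mul, norm_pow, norm_pow, norm_neg, norm_one, one_pow, one_mul]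
      have h3 : ‖(x : ℂ) + y * Complex.I‖ ≤ (1 + 1/η) * |x| := by
        refine (norm_add_le _ _).trans ?_
        rw [norm_mul, Complex.norm_I, mul_one, Complex.norm_real, Complex.norm_real,
          Real.norm_eq_abs, Real.norm_eq_abs]
        linarith
      have := pow_le_pow_left₀ (norm_nonneg _) h3 (2 * k)
      rw [mul_pow, Even.pow_abs (by simp)] at this
      exact this
    have h3 := (abs_le.mp ((Complex.abs_re_le_norm _).trans h2)).1
    linarith

/-- span of positive-frequency exponentials -/
noncomputable def PosSp (l : (Fin 2 → ℤ) → ℝ) : Submodule ℂ ((Fin 2 → ℝ) → ℂ) :=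
  Submodule.span ℂ (ee '' {n | 0 < l n})

lemma posSp_mul {l : (Fin 2 → ℤ) → ℝ} (hl : ∀ m n, l (m + n) = l m + l n)
    {f g : (Fin 2 → ℝ) → ℂ} (hf : f ∈ PosSp l) (hg : g ∈ PosSp l) : f * g ∈ PosSp l := by
  induction hf using Submodule.span_induction with
  | mem f hf =>
    induction hg using Submodule.span_induction with
    | mem g hg =>
      obtain ⟨m, hm, rfl⟩ := hf
      obtain ⟨n, hn, rfl⟩ := hg
      refine Submodule.subset_span ⟨m + n, ?_, ?_⟩
      · simp only [Set.mem_ofPred_eq] at *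
        rw [hl]
        linarith
      · ext x
        simp [ee_add]
    | zero => simp
    | add f g _ _ h1 h2 => rw [mul_add]; exact Submodule.add_mem _ h1 h2
    | smul c f _ h => rw [mul_smul_comm]; exact Submodule.smul_mem _ _ h
  | zero => simp
  | add f g _ _ h1 h2 => rw [add_mul]; exact Submodule.add_mem _ h1 h2
  | smul c f _ h => rw [smul_mul_assoc]; exact Submodule.smul_mem _ _ h

lemma posSp_pow {l : (Fin 2 → ℤ) → ℝ} (hl : ∀ m n, l (m + n) = l m + l n)
    {f : (Fin 2 → ℝ) → ℂ} (hf : f ∈ PosSp l) (k : ℕ) : f ^ (k + 1) ∈ PosSp l := by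
  induction k with
  | zero => simpa using hf
  | succ k ih => rw [pow_succ]; exact posSp_mul hl ih hf

lemma posSp_int {l : (Fin 2 → ℤ) → ℝ} (hl : ∀ m n, l (m + n) = l m + l n)
    {f : (Fin 2 → ℝ) → ℂ} (hf : f ∈ PosSp l) : Continuous f ∧ ∫ x in T2, f x = 0 := by
  have hl0 : l 0 = 0 := by
    have := hl 0 0
    simp at this
    exact this
  induction hf using Submodule.span_induction with
  | mem f hf =>
    obtain ⟨m, hm, rfl⟩ := hf
    refine ⟨by fun_prop, ?_⟩
    rw [int_ee, if_neg]
    rintro rfl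
    simp [hl0] at hm
  | zero => exact ⟨continuous_zero, by simp⟩
  | add f g _ _ h1 h2 =>
    refine ⟨h1.1.add h2.1, ?_⟩
    simp only [Pi.add_apply]
    rw [integral_add (intOn_T2 h1.1) (intOn_T2 h2.1), h1.2, h2.2, add_zero]
  | smul c f _ h =>
    refine ⟨h.1.const_smul c, ?_⟩
    simp only [Pi.smul_apply]
    rw [integral_smul, h.2, smul_zero]

noncomputable def sg (y : ℝ) : ℝ := if 0 < y then 1 else -1

lemma sg_neg {y : ℝ} (hy : y ≠ 0) : sg (-y) = - sg y := by
  unfold sg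
  rcases lt_or_gt_of_ne hy with h | h
  · simp [h, not_lt.mpr h.le]
  · simp [h, not_lt.mpr h.le]

lemma abs_sg (y : ℝ) : |sg y| = 1 := by
  unfold sg
  split_ifs <;> simp

lemma tp_add (S : Finset (Fin 2 → ℤ)) (a b : (Fin 2 → ℤ) → ℂ) (x : Fin 2 → ℝ) :
    tp S (fun n => a n + b n) x = tp S a x + tp S b x := by
  simp [tp, add_mul, Finset.sum_add_distrib]

lemma tp_smul (S : Finset (Fin 2 → ℤ)) (c : ℂ) (b : (Fin 2 → ℤ) → ℂ) (x : Fin 2 → ℝ) :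
    tp S (fun n => c * b n) x = c * tp S b x := by
  simp [tp, Finset.mul_sum, mul_assoc]

lemma conj_tp {S : Finset (Fin 2 → ℤ)} (hS : ∀ n ∈ S, -n ∈ S) (a : (Fin 2 → ℤ) → ℂ)
    (x : Fin 2 → ℝ) :
    (starRingEnd ℂ) (tp S a x) = tp S (fun n => (starRingEnd ℂ) (a (-n))) x := by
  unfold tp
  rw [map_sum]
  refine Finset.sum_nbij' (fun n => -n) (fun n => -n) hS hS (by simp) (by simp) ?_
  intro n _
  simp [conj_ee]

lemma hilbert_real (k : ℕ) : ∃ C : ℝ, 0 ≤ C ∧ ∀ (S : Finset (Fin 2 → ℤ)) (a : (Fin 2 → ℤ) → ℂ)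
    (l : (Fin 2 → ℤ) → ℝ), (∀ n ∈ S, -n ∈ S) → (∀ m n, l (m + n) = l m + l n) →
    (∀ n ∈ S, l n ≠ 0) → (∀ n, (starRingEnd ℂ) (a (-n)) = a n) →
    ∫ x in T2, ‖tp S (fun n => sg (l n) * a n) x‖ ^ (2 * (k + 1))
      ≤ C * ∫ x in T2, ‖tp S a x‖ ^ (2 * (k + 1)) := by
  obtain ⟨C, hC, hpw⟩ := pw_ineq (k + 1)
  refine ⟨C, hC, fun S a l hS hl hlS ha => ?_⟩
  have hl0 : ∀ n, l (-n) = - l n := by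
    intro n
    have h1 := hl 0 0
    have h2 := hl n (-n)
    simp at h1 h2
    linarith
  set H := tp S (fun n => sg (l n) * a n) with hH
  have hre : ∀ x, tp S a x = (((tp S a x).re : ℝ) : ℂ) := by
    intro x
    symm
    rw [← Complex.conj_eq_iff_re, conj_tp hS]
    simp_rw [ha]
  have him : ∀ x, H x = ((H x).im : ℝ) * Complex.I := by
    intro x
    have h1 : (starRingEnd ℂ) (H x) = - H x := by
      rw [hH, conj_tp hS]
      unfold tp
      rw [← Finset.sum_neg_distrib]
      refine Finset.sum_congr rfl fun n hn => ?_
      simp only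
      rw [map_mul, ha, hl0, sg_neg (hlS n hn), Complex.conj_ofReal]
      push_cast
      ring
    have h2 := congrArg Complex.re h1
    simp at h2
    apply Complex.ext
    · simp; linarith
    · simp
  have hF : (fun x => tp S a x + H x) ∈ PosSp l := by
    have : (fun x => tp S a x + H x) = ∑ n ∈ S, ((1 + sg (l n)) * a n : ℂ) • ee n := by
      ext x
      simp only [hH, tp, Finset.sum_apply, Pi.smul_apply, smul_eq_mul, ← Finset.sum_add_distrib]
      refine Finset.sum_congr rfl fun n _ => ?_
      ring
    rw [this]
    refine Submodule.sum_mem _ fun n hn => ?_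
    by_cases hp : 0 < l n
    · exact Submodule.smul_mem _ _ (Submodule.subset_span ⟨n, hp, rfl⟩)
    · simp [sg, hp]
  have hint := (posSp_int hl (posSp_pow hl hF (2 * k + 1))).2
  simp only [Pi.pow_apply] at hint
  have hHc : Continuous H := continuous_tp _ _
  have hac : Continuous (tp S a) := continuous_tp _ _
  have key : ∀ x, ‖H x‖ ^ (2 * (k + 1)) ≤ C * ‖tp S a x‖ ^ (2 * (k + 1))
      + 2 * ((-1 : ℂ) ^ (k + 1) * (tp S a x + H x) ^ (2 * k + 1 + 1)).re := by
    intro x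
    have := hpw (tp S a x).re (H x).im
    rw [← hre, ← him] at this
    have e1 : ‖H x‖ ^ (2 * (k + 1)) = (H x).im ^ (2 * (k + 1)) := by
      conv_lhs => rw [him x]
      rw [norm_mul, Complex.norm_I, mul_one, Complex.norm_real, Real.norm_eq_abs,
        Even.pow_abs (by simp)]
    have e2 : ‖tp S a x‖ ^ (2 * (k + 1)) = (tp S a x).re ^ (2 * (k + 1)) := by
      conv_lhs => rw [hre x]
      rw [Complex.norm_real, Real.norm_eq_abs, Even.pow_abs (by simp)]
    rw [e1, e2]
    exact this
  calc ∫ x in T2, ‖H x‖ ^ (2 * (k + 1))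
      ≤ ∫ x in T2, (C * ‖tp S a x‖ ^ (2 * (k + 1))
      + 2 * ((-1 : ℂ) ^ (k + 1) * (tp S a x + H x) ^ (2 * k + 1 + 1)).re) := by
        apply integral_mono (intOn_T2 (by fun_prop)) (intOn_T2 (by fun_prop)) key
    _ = C * ∫ x in T2, ‖tp S a x‖ ^ (2 * (k + 1)) := by
        rw [integral_add (intOn_T2 (by fun_prop)) (intOn_T2 (by fun_prop)), integral_const_mul,
          integral_const_mul]
        have := integral_re (𝕜 := ℂ) (intOn_T2 (f := fun x =>
          (-1 : ℂ) ^ (k + 1) * (tp S a x + H x) ^ (2 * k + 1 + 1)) (by fun_prop))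
        simp only [RCLike.re_to_complex] at this
        rw [this, integral_const_mul, hint]
        simp

lemma add_pow_le' {x y : ℝ} (hx : 0 ≤ x) (hy : 0 ≤ y) (k : ℕ) :
    (x + y) ^ k ≤ 2 ^ k * (x ^ k + y ^ k) := by
  have h1 : (max x y) ^ k ≤ x ^ k + y ^ k := by
    rcases max_choice x y with h | h <;> rw [h]
    · linarith [pow_nonneg hy k]
    · linarith [pow_nonneg hx k]
  calc (x + y) ^ k ≤ (2 * max x y) ^ k := by
        apply pow_le_pow_left₀ (by positivity)
        linarith [le_max_left x y, le_max_right x y]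
    _ = 2 ^ k * (max x y) ^ k := mul_pow _ _ _
    _ ≤ _ := by gcongr

lemma hilbert_cpx (k : ℕ) : ∃ C : ℝ, 0 ≤ C ∧ ∀ (S : Finset (Fin 2 → ℤ)) (a : (Fin 2 → ℤ) → ℂ)
    (l : (Fin 2 → ℤ) → ℝ), (∀ n ∈ S, -n ∈ S) → (∀ m n, l (m + n) = l m + l n) →
    (∀ n ∈ S, l n ≠ 0) →
    ∫ x in T2, ‖tp S (fun n => sg (l n) * a n) x‖ ^ (2 * (k + 1))
      ≤ C * ∫ x in T2, ‖tp S a x‖ ^ (2 * (k + 1)) := by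
  obtain ⟨C, hC, hr⟩ := hilbert_real k
  refine ⟨2 ^ (2 * (k + 1)) * (2 * C), by positivity, fun S a l hS hl hlS => ?_⟩
  set b : (Fin 2 → ℤ) → ℂ := fun n => (a n + (starRingEnd ℂ) (a (-n))) / 2 with hb
  set c : (Fin 2 → ℤ) → ℂ := fun n => (a n - (starRingEnd ℂ) (a (-n))) / (2 * Complex.I) with hc
  have hI : Complex.I ≠ 0 := Complex.I_ne_zero
  have h1 := hr S b l hS hl hlS (by
    intro n; simp [hb, map_ofNat]; ring)
  have h2 := hr S c l hS hl hlS (by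
    intro n; simp [hc, map_ofNat]; field_simp; ring)
  have hbx : ∀ x, tp S b x = ((tp S a x).re : ℂ) := by
    intro x
    rw [Complex.re_eq_add_conj, conj_tp hS]
    simp only [tp, hb, ← Finset.sum_add_distrib, Finset.sum_div]
    refine Finset.sum_congr rfl fun n _ => ?_
    ring
  have hcx : ∀ x, tp S c x = ((tp S a x).im : ℂ) := by
    intro x
    rw [Complex.im_eq_sub_conj, conj_tp hS]
    simp only [tp, hc, ← Finset.sum_sub_distrib, Finset.sum_div]
    refine Finset.sum_congr rfl fun n _ => ?_
    ring
  have hsum : ∀ x, tp S (fun n => sg (l n) * a n) x = tp S (fun n => sg (l n) * b n) x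
      + Complex.I * tp S (fun n => sg (l n) * c n) x := by
    intro x
    rw [← tp_smul, ← tp_add]
    congr 1
    ext n
    simp only [hb, hc]
    field_simp
    ring
  have h1' : ∫ x in T2, ‖tp S b x‖ ^ (2 * (k + 1)) ≤ ∫ x in T2, ‖tp S a x‖ ^ (2 * (k + 1)) := by
    apply integral_mono (intOn_T2 (by fun_prop)) (intOn_T2 (by fun_prop))
    intro x
    simp only
    rw [hbx, Complex.norm_real]
    exact pow_le_pow_left₀ (norm_nonneg _) (Complex.abs_re_le_norm _) _
  have h2' : ∫ x in T2, ‖tp S c x‖ ^ (2 * (k + 1)) ≤ ∫ x in T2, ‖tp S a x‖ ^ (2 * (k + 1)) := by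
    apply integral_mono (intOn_T2 (by fun_prop)) (intOn_T2 (by fun_prop))
    intro x
    simp only
    rw [hcx, Complex.norm_real]
    exact pow_le_pow_left₀ (norm_nonneg _) (Complex.abs_im_le_norm _) _
  calc ∫ x in T2, ‖tp S (fun n => sg (l n) * a n) x‖ ^ (2 * (k + 1))
      ≤ ∫ x in T2, 2 ^ (2 * (k + 1)) * (‖tp S (fun n => sg (l n) * b n) x‖ ^ (2 * (k + 1))
        + ‖tp S (fun n => sg (l n) * c n) x‖ ^ (2 * (k + 1))) := by
        apply integral_mono (intOn_T2 (by fun_prop)) (intOn_T2 (by fun_prop))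
        intro x
        simp only
        rw [hsum]
        refine le_trans ?_ (add_pow_le' (norm_nonneg _) (norm_nonneg _) _)
        apply pow_le_pow_left₀ (norm_nonneg _)
        refine (norm_add_le _ _).trans ?_
        rw [norm_mul, Complex.norm_I, one_mul]
    _ = 2 ^ (2 * (k + 1)) * ((∫ x in T2, ‖tp S (fun n => sg (l n) * b n) x‖ ^ (2 * (k + 1)))
        + ∫ x in T2, ‖tp S (fun n => sg (l n) * c n) x‖ ^ (2 * (k + 1))) := by
        rw [integral_const_mul, integral_add (intOn_T2 (by fun_prop)) (intOn_T2 (by fun_prop))]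
    _ ≤ 2 ^ (2 * (k + 1)) * (C * (∫ x in T2, ‖tp S a x‖ ^ (2 * (k + 1)))
        + C * ∫ x in T2, ‖tp S a x‖ ^ (2 * (k + 1))) := by
        gcongr
        · exact h1.trans (by gcongr)
        · exact h2.trans (by gcongr)
    _ = _ := by ring
open MeasureTheory

lemma jensen_pow {α : Type*} [MeasurableSpace α] {μ : Measure α} [IsProbabilityMeasure μ]
    {f : α → ℂ} (hf : Integrable f μ) (k : ℕ) (hfk : Integrable (fun x => ‖f x‖ ^ k) μ) :
    ‖∫ x, f x ∂μ‖ ^ k ≤ ∫ x, ‖f x‖ ^ k ∂μ := by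
  have h1 : (∫ x, ‖f x‖ ∂μ) ^ k ≤ ∫ x, ‖f x‖ ^ k ∂μ := by
    apply ConvexOn.map_integral_le (convexOn_pow k) (continuous_pow k).continuousOn isClosed_Ici
      (Filter.Eventually.of_forall fun x => norm_nonneg (f x)) hf.norm hfk
  exact (pow_le_pow_left₀ (norm_nonneg _) (norm_integral_le_integral_norm f) k).trans h1

noncomputable def nrm (n : Fin 2 → ℤ) : ℝ := Real.sqrt ((n 0 : ℝ) ^ 2 + (n 1 : ℝ) ^ 2)

lemma nrm_pos {n : Fin 2 → ℤ} (hn : n ≠ 0) : 0 < nrm n := by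
  unfold nrm
  apply Real.sqrt_pos.mpr
  by_contra h
  apply hn
  have h0 : (n 0 : ℝ) = 0 := by nlinarith [sq_nonneg (n 0 : ℝ), sq_nonneg (n 1 : ℝ)]
  have h1 : (n 1 : ℝ) = 0 := by nlinarith [sq_nonneg (n 0 : ℝ), sq_nonneg (n 1 : ℝ)]
  ext i
  fin_cases i
  · simpa using h0
  · simpa using h1

lemma nrm_sq (n : Fin 2 → ℤ) : nrm n ^ 2 = (n 0 : ℝ) ^ 2 + (n 1 : ℝ) ^ 2 :=
  Real.sq_sqrt (by positivity)

lemma polar_n (n : Fin 2 → ℤ) (hn : n ≠ 0) :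
    ∃ α : ℝ, (n 0 : ℝ) = nrm n * Real.cos α ∧ (n 1 : ℝ) = nrm n * Real.sin α := by
  have hz : (⟨n 0, n 1⟩ : ℂ) ≠ 0 := by
    intro h
    have h0 := congrArg Complex.re h
    have h1 := congrArg Complex.im h
    simp at h0 h1
    apply hn
    ext i
    fin_cases i
    · simpa using h0
    · simpa using h1
  have hnorm : ‖(⟨n 0, n 1⟩ : ℂ)‖ = nrm n := by
    rw [Complex.norm_def, Complex.normSq_mk, nrm]
    congr 1
    ring
  have hp := nrm_pos hn
  refine ⟨Complex.arg ⟨n 0, n 1⟩, ?_, ?_⟩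
  · rw [Complex.cos_arg hz, hnorm]
    field_simp
  · rw [Complex.sin_arg, hnorm]
    field_simp

lemma measurable_sg : Measurable sg := by
  unfold sg
  exact Measurable.ite measurableSet_Ioi measurable_const measurable_const

lemma sg_mul_pos {r y : ℝ} (hr : 0 < r) : sg (r * y) = sg y := by
  unfold sg
  simp [hr]

noncomputable def ld (u : ℝ) (n : Fin 2 → ℤ) : ℝ :=
  n 0 * Real.cos (2 * Real.pi * u) + n 1 * Real.sin (2 * Real.pi * u)

lemma ld_polar {n : Fin 2 → ℤ} {α : ℝ} (h : (n 0 : ℝ) = nrm n * Real.cos α ∧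
    (n 1 : ℝ) = nrm n * Real.sin α) (u : ℝ) :
    ld u n = nrm n * Real.cos (2 * Real.pi * u - α) := by
  unfold ld
  rw [h.1, h.2, Real.cos_sub]
  ring

lemma ii_bdd {f : ℝ → ℝ} (hf : Measurable f) (hb : ∀ x, |f x| ≤ 1) (a b : ℝ) :
    IntervalIntegrable f volume a b := by
  apply (intervalIntegrable_const (c := (1:ℝ))).mono_fun hf.aestronglyMeasurable
  refine Filter.Eventually.of_forall fun x => ?_
  simpa using hb x

lemma int_base (γ : ℝ) : ∫ s in (-(Real.pi / 2))..(-(Real.pi / 2) + 2 * Real.pi),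
    Real.cos (s + γ) * sg (Real.cos s) = 4 * Real.cos γ := by
  have hm : Measurable (fun s => Real.cos (s + γ) * sg (Real.cos s)) := by
    have := measurable_sg
    fun_prop
  have hb : ∀ s, |Real.cos (s + γ) * sg (Real.cos s)| ≤ 1 := by
    intro s
    rw [abs_mul, abs_sg, mul_one]
    exact Real.abs_cos_le_one _
  have hpi := Real.pi_pos
  rw [← intervalIntegral.integral_add_adjacent_intervals (b := Real.pi / 2)
    (ii_bdd hm hb _ _) (ii_bdd hm hb _ _)]
  have h1 : ∫ s in (-(Real.pi / 2))..(Real.pi / 2), Real.cos (s + γ) * sg (Real.cos s)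
      = ∫ s in (-(Real.pi / 2))..(Real.pi / 2), Real.cos (s + γ) := by
    apply intervalIntegral.integral_congr_Ioo_of_le (by linarith)
    intro s hs
    have : 0 < Real.cos s := Real.cos_pos_of_mem_Ioo hs
    simp [sg, this]
  have h2 : ∫ s in (Real.pi / 2)..(-(Real.pi / 2) + 2 * Real.pi),
        Real.cos (s + γ) * sg (Real.cos s)
      = ∫ s in (Real.pi / 2)..(-(Real.pi / 2) + 2 * Real.pi), -Real.cos (s + γ) := by
    apply intervalIntegral.integral_congr_Ioo_of_le (by linarith)
    intro s hs
    have : Real.cos s < 0 := Real.cos_neg_of_pi_div_two_lt_of_lt hs.1 (by linarith [hs.2])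
    simp [sg, not_lt.mpr this.le]
  rw [h1, h2, intervalIntegral.integral_neg, intervalIntegral.integral_comp_add_right
    (fun s => Real.cos s), intervalIntegral.integral_comp_add_right (fun s => Real.cos s),
    integral_cos, integral_cos]
  have e1 : Real.sin (Real.pi / 2 + γ) = Real.cos γ := by
    rw [add_comm, Real.sin_add_pi_div_two]
  have e2 : Real.sin (-(Real.pi / 2) + γ) = - Real.cos γ := by
    rw [neg_add_eq_sub, Real.sin_sub_pi_div_two]
  have e3 : Real.sin (-(Real.pi / 2) + 2 * Real.pi + γ) = - Real.cos γ := by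
    rw [show -(Real.pi / 2) + 2 * Real.pi + γ = -(Real.pi / 2) + γ + 2 * Real.pi by ring,
      Real.sin_add_two_pi, e2]
  rw [e1, e2, e3]
  ring

lemma int_cos_sg (α β : ℝ) :
    ∫ u in (0:ℝ)..1, Real.cos (2 * Real.pi * u - β) * sg (Real.cos (2 * Real.pi * u - α))
      = 2 / Real.pi * Real.cos (α - β) := by
  have hpi := Real.pi_pos
  have h1 : ∀ u : ℝ, Real.cos (2 * Real.pi * u - β) * sg (Real.cos (2 * Real.pi * u - α))
      = (fun s => Real.cos (s + (α - β)) * sg (Real.cos s)) (2 * Real.pi * u - α) := by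
    intro u
    simp only
    congr 2
    ring
  simp_rw [h1]
  rw [intervalIntegral.integral_comp_mul_sub
    (fun s => Real.cos (s + (α - β)) * sg (Real.cos s)) (by positivity : 2 * Real.pi ≠ 0)]
  have hper : Function.Periodic (fun s => Real.cos (s + (α - β)) * sg (Real.cos s))
      (2 * Real.pi) := by
    intro s
    simp only
    rw [Real.cos_add_two_pi, show s + 2 * Real.pi + (α - β) = s + (α - β) + 2 * Real.pi by ring,
      Real.cos_add_two_pi]
  have h2 := hper.intervalIntegral_add_eq (-α) (-(Real.pi / 2))
  rw [int_base] at h2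
  rw [show 2 * Real.pi * 0 - α = -α by ring, show 2 * Real.pi * 1 - α = -α + 2 * Real.pi by ring,
    h2, smul_eq_mul]
  field_simp
  ring

noncomputable def cc (j : Fin 2) (u : ℝ) : ℝ :=
  if j = 0 then Real.cos (2 * Real.pi * u) else Real.sin (2 * Real.pi * u)

lemma abs_cc (j : Fin 2) (u : ℝ) : |cc j u| ≤ 1 := by
  unfold cc
  split_ifs
  · exact Real.abs_cos_le_one _
  · exact Real.abs_sin_le_one _

lemma measurable_cc (j : Fin 2) : Measurable (cc j) := by
  unfold cc
  split_ifs <;> fun_prop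

lemma measurable_ld (n : Fin 2 → ℤ) : Measurable (fun u => ld u n) := by
  unfold ld
  fun_prop

lemma int_cc_sg (j : Fin 2) (n : Fin 2 → ℤ) (hn : n ≠ 0) :
    ∫ u in (0:ℝ)..1, cc j u * sg (ld u n) = 2 / Real.pi * (n j / nrm n) := by
  obtain ⟨α, hα⟩ := polar_n n hn
  have hp := nrm_pos hn
  simp_rw [ld_polar hα, sg_mul_pos hp]
  fin_cases j
  · have := int_cos_sg α 0
    simp only [sub_zero] at this
    simp only [cc, Fin.zero_eta, if_true]
    rw [this, hα.1]
    field_simp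
  · have := int_cos_sg α (Real.pi / 2)
    simp only [Real.cos_sub_pi_div_two] at this
    simp only [cc, Fin.mk_one, one_ne_zero, if_false]
    rw [this, hα.2]
    field_simp

lemma ld_ne_zero_ae (S : Finset (Fin 2 → ℤ)) (hS0 : (0 : Fin 2 → ℤ) ∉ S) :
    ∀ᵐ u : ℝ, ∀ n ∈ S, ld u n ≠ 0 := by
  rw [Filter.eventually_all_finset]
  intro n hn
  have hn0 : n ≠ 0 := by rintro rfl; exact hS0 hn
  obtain ⟨α, hα⟩ := polar_n n hn0
  have hp := nrm_pos hn0
  have hpi := Real.pi_pos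
  rw [ae_iff]
  apply Set.Countable.measure_zero
  apply Set.Countable.mono (s₂ := Set.range (fun k : ℤ => ((2 * k + 1) * Real.pi / 2 + α)
    / (2 * Real.pi))) _ (Set.countable_range _)
  intro u hu
  simp only [ne_eq, not_not, Set.mem_ofPred_eq] at hu
  rw [ld_polar hα] at hu
  have hc : Real.cos (2 * Real.pi * u - α) = 0 := by
    rcases mul_eq_zero.mp hu with h | h
    · exact absurd h hp.ne'
    · exact h
  obtain ⟨k, hk⟩ := Real.cos_eq_zero_iff.mp hc
  refine ⟨k, ?_⟩
  simp only
  rw [← hk]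
  field_simp
  ring

lemma ld_add (u : ℝ) (m n : Fin 2 → ℤ) : ld u (m + n) = ld u m + ld u n := by
  simp [ld]
  ring

instance instProbI : IsProbabilityMeasure (volume.restrict (Set.Ioc (0:ℝ) 1)) :=
  ⟨by simp⟩

noncomputable def Phi (S : Finset (Fin 2 → ℤ)) (a : (Fin 2 → ℤ) → ℂ) (u : ℝ) (x : Fin 2 → ℝ) : ℂ :=
  tp S (fun n => sg (ld u n) * a n) x

lemma Phi_meas (S : Finset (Fin 2 → ℤ)) (a : (Fin 2 → ℤ) → ℂ) :
    Measurable (fun z : ℝ × (Fin 2 → ℝ) => Phi S a z.1 z.2) := by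
  simp only [Phi, tp]
  apply Finset.measurable_sum
  intro n _
  have h1 := measurable_sg
  have h2 := measurable_ld n
  have h3 : Measurable (ee n) := (continuous_ee n).measurable
  fun_prop

lemma Phi_meas' (S : Finset (Fin 2 → ℤ)) (a : (Fin 2 → ℤ) → ℂ) (x : Fin 2 → ℝ) :
    Measurable (fun u => Phi S a u x) := by
  simp only [Phi, tp]
  apply Finset.measurable_sum
  intro n _
  have h1 := measurable_sg
  have h2 := measurable_ld n
  fun_prop

lemma Phi_bdd (S : Finset (Fin 2 → ℤ)) (a : (Fin 2 → ℤ) → ℂ) (u : ℝ) (x : Fin 2 → ℝ) :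
    ‖Phi S a u x‖ ≤ ∑ n ∈ S, ‖a n‖ := by
  simp only [Phi, tp]
  refine (norm_sum_le _ _).trans (Finset.sum_le_sum fun n _ => ?_)
  rw [norm_mul, norm_mul, norm_ee, mul_one, Complex.norm_real, Real.norm_eq_abs, abs_sg, one_mul]

lemma riesz_rep (S : Finset (Fin 2 → ℤ)) (a : (Fin 2 → ℤ) → ℂ) (j : Fin 2)
    (hS0 : (0 : Fin 2 → ℤ) ∉ S) (x : Fin 2 → ℝ) :
    tp S (fun n => ((n j / nrm n : ℝ) : ℂ) * a n) x
      = (Real.pi / 2 : ℝ) * ∫ u in Set.Ioc (0:ℝ) 1, (cc j u : ℂ) * Phi S a u x := by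
  have hpi := Real.pi_pos
  have hccm := measurable_cc j
  have e1 : ∀ u, (cc j u : ℂ) * Phi S a u x
      = ∑ n ∈ S, ((cc j u * sg (ld u n) : ℝ) : ℂ) * (a n * ee n x) := by
    intro u
    simp only [Phi, tp, Finset.mul_sum]
    refine Finset.sum_congr rfl fun n _ => ?_
    push_cast
    ring
  simp_rw [e1]
  rw [integral_finsetSum]
  · simp_rw [integral_mul_const, integral_complex_ofReal]
    unfold tp
    rw [Finset.mul_sum]
    refine Finset.sum_congr rfl fun n hn => ?_
    have hn0 : n ≠ 0 := by rintro rfl; exact hS0 hn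
    have := int_cc_sg j n hn0
    rw [intervalIntegral.integral_of_le zero_le_one] at this
    rw [this]
    have hpc : (Real.pi : ℂ) ≠ 0 := by exact_mod_cast hpi.ne'
    push_cast
    field_simp
  · intro n _
    apply Integrable.mul_const
    apply Integrable.ofReal
    have := ii_bdd (f := fun u => cc j u * sg (ld u n)) (by
      have h1 := measurable_sg
      have h2 := measurable_ld n
      fun_prop) (by
        intro u
        rw [abs_mul, abs_sg, mul_one]
        exact abs_cc j u) 0 1
    exact (intervalIntegrable_iff_integrableOn_Ioc_of_le zero_le_one).mp this

lemma riesz_pt (S : Finset (Fin 2 → ℤ)) (a : (Fin 2 → ℤ) → ℂ) (j : Fin 2) (m : ℕ)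
    (hS0 : (0 : Fin 2 → ℤ) ∉ S) (x : Fin 2 → ℝ) :
    ‖tp S (fun n => ((n j / nrm n : ℝ) : ℂ) * a n) x‖ ^ m
      ≤ (Real.pi / 2) ^ m * ∫ u in Set.Ioc (0:ℝ) 1, ‖Phi S a u x‖ ^ m := by
  have hpi := Real.pi_pos
  have hccm := measurable_cc j
  rw [riesz_rep S a j hS0, norm_mul, mul_pow, Complex.norm_real, Real.norm_eq_abs,
    abs_of_pos (by positivity)]
  have hΦx' := Phi_meas' S a x
  have hΦb := Phi_bdd S a
  have hle : ∀ u, ‖(cc j u : ℂ) * Phi S a u x‖ ≤ ‖Phi S a u x‖ := by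
    intro u
    rw [norm_mul, Complex.norm_real, Real.norm_eq_abs]
    exact mul_le_of_le_one_left (norm_nonneg _) (abs_cc j u)
  have i1 : Integrable (fun u => (cc j u : ℂ) * Phi S a u x) (volume.restrict (Set.Ioc (0:ℝ) 1)) := by
    apply Integrable.of_bound (C := ∑ n ∈ S, ‖a n‖)
    · exact Measurable.aestronglyMeasurable (by fun_prop)
    · exact Filter.Eventually.of_forall fun u => (hle u).trans (hΦb u x)
  have i2 : Integrable (fun u => ‖(cc j u : ℂ) * Phi S a u x‖ ^ m)
      (volume.restrict (Set.Ioc (0:ℝ) 1)) := by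
    apply Integrable.of_bound (C := (∑ n ∈ S, ‖a n‖) ^ m)
    · exact Measurable.aestronglyMeasurable (by fun_prop)
    · refine Filter.Eventually.of_forall fun u => ?_
      rw [norm_pow, norm_norm]
      exact pow_le_pow_left₀ (norm_nonneg _) ((hle u).trans (hΦb u x)) _
  have i3 : Integrable (fun u => ‖Phi S a u x‖ ^ m) (volume.restrict (Set.Ioc (0:ℝ) 1)) := by
    apply Integrable.of_bound (C := (∑ n ∈ S, ‖a n‖) ^ m)
    · exact Measurable.aestronglyMeasurable (by fun_prop)
    · refine Filter.Eventually.of_forall fun u => ?_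
      rw [norm_pow, norm_norm]
      exact pow_le_pow_left₀ (norm_nonneg _) (hΦb u x) _
  gcongr
  refine (jensen_pow i1 m i2).trans (integral_mono i2 i3 fun u => ?_)
  exact pow_le_pow_left₀ (norm_nonneg _) (hle u) _

lemma Phi_prod (S : Finset (Fin 2 → ℤ)) (a : (Fin 2 → ℤ) → ℂ) (m : ℕ) :
    Integrable (Function.uncurry fun u x => ‖Phi S a u x‖ ^ m)
      ((volume.restrict (Set.Ioc (0:ℝ) 1)).prod (volume.restrict T2)) := by
  apply Integrable.of_bound (C := (∑ n ∈ S, ‖a n‖) ^ m)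
  · apply Measurable.aestronglyMeasurable
    exact ((Phi_meas S a).norm).pow_const m
  · refine Filter.Eventually.of_forall fun z => ?_
    simp only [Function.uncurry_def]
    rw [norm_pow, norm_norm]
    exact pow_le_pow_left₀ (norm_nonneg _) (Phi_bdd S a _ _) _

lemma riesz_aux (S : Finset (Fin 2 → ℤ)) (a : (Fin 2 → ℤ) → ℂ) (j : Fin 2) (m : ℕ)
    (hS0 : (0 : Fin 2 → ℤ) ∉ S) (K : ℝ)
    (hK : ∀ u, (∀ n ∈ S, ld u n ≠ 0) → ∫ x in T2, ‖Phi S a u x‖ ^ m ≤ K) :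
    ∫ x in T2, ‖tp S (fun n => ((n j / nrm n : ℝ) : ℂ) * a n) x‖ ^ m
      ≤ (Real.pi / 2) ^ m * K := by
  have hpi := Real.pi_pos
  have hprod := Phi_prod S a m
  calc ∫ x in T2, ‖tp S (fun n => ((n j / nrm n : ℝ) : ℂ) * a n) x‖ ^ m
      ≤ ∫ x in T2, (Real.pi / 2) ^ m * ∫ u in Set.Ioc (0:ℝ) 1, ‖Phi S a u x‖ ^ m := by
        apply integral_mono (intOn_T2 (by fun_prop)) _ (fun x => riesz_pt S a j m hS0 x)
        exact (hprod.integral_prod_right).const_mul _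
    _ = (Real.pi / 2) ^ m * ∫ u in Set.Ioc (0:ℝ) 1, ∫ x in T2, ‖Phi S a u x‖ ^ m := by
        rw [integral_const_mul, integral_integral_swap hprod]
    _ ≤ (Real.pi / 2) ^ m * ∫ u in Set.Ioc (0:ℝ) 1, K := by
        apply mul_le_mul_of_nonneg_left _ (by positivity)
        apply integral_mono_ae hprod.integral_prod_left (integrable_const _)
        filter_upwards [ae_restrict_of_ae (ld_ne_zero_ae S hS0)] with u hu
        exact hK u hu
    _ = _ := by
        rw [integral_const]
        simp

/-- `L^{2(k+1)}` bound for the Riesz transforms. -/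
lemma riesz (k : ℕ) : ∃ C : ℝ, 0 ≤ C ∧ ∀ (S : Finset (Fin 2 → ℤ)) (a : (Fin 2 → ℤ) → ℂ)
    (j : Fin 2), (∀ n ∈ S, -n ∈ S) → (0 : Fin 2 → ℤ) ∉ S →
    ∫ x in T2, ‖tp S (fun n => ((n j / nrm n : ℝ) : ℂ) * a n) x‖ ^ (2 * (k + 1))
      ≤ C * ∫ x in T2, ‖tp S a x‖ ^ (2 * (k + 1)) := by
  obtain ⟨C, hC, hh⟩ := hilbert_cpx k
  have hpi := Real.pi_pos
  refine ⟨(Real.pi / 2) ^ (2 * (k + 1)) * C, by positivity, fun S a j hS hS0 => ?_⟩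
  rw [mul_assoc]
  exact riesz_aux S a j (2 * (k + 1)) hS0 _ (fun u hu => hh S a (ld u) hS (ld_add u) hu)
open MeasureTheory

/-- complex partial derivative along coordinates, via explicit curves -/
def HasPd (i : Fin 2) (u u' : (Fin 2 → ℝ) → ℂ) : Prop :=
  ∀ x : Fin 2 → ℝ, HasDerivAt (fun t : ℝ => u (Function.update x i t)) (u' x) (x i)

lemma upd0 (s t r : ℝ) : Function.update (![s, t] : Fin 2 → ℝ) 0 r = ![r, t] := by
  ext i; fin_cases i <;> simp

lemma upd1 (s t r : ℝ) : Function.update (![s, t] : Fin 2 → ℝ) 1 r = ![s, r] := by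
  ext i; fin_cases i <;> simp

lemma sob1 {f f' : ℝ → ℂ} (hf : ∀ t, HasDerivAt f (f' t) t) (hf' : Continuous f') (x : ℝ)
    (hx : x ∈ Set.Icc (0:ℝ) 1) : ‖f x‖ ≤ ∫ s in (0:ℝ)..1, (‖f s‖ + ‖f' s‖) := by
  have hfc : Continuous f := continuous_iff_continuousAt.mpr fun t => (hf t).continuousAt
  have h1 : ∀ s ∈ Set.Icc (0:ℝ) 1, ‖f x‖ ≤ ‖f s‖ + ∫ r in (0:ℝ)..1, ‖f' r‖ := by
    intro s hs
    have e : ∫ r in s..x, f' r = f x - f s :=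
      intervalIntegral.integral_eq_sub_of_hasDerivAt (fun t _ => hf t) (hf'.intervalIntegrable _ _)
    have h2 : ‖∫ r in s..x, f' r‖ ≤ ∫ r in (0:ℝ)..1, ‖f' r‖ := by
      refine (intervalIntegral.norm_integral_le_integral_norm_uIoc).trans ?_
      rw [intervalIntegral.integral_of_le zero_le_one]
      apply setIntegral_mono_set
      · exact (hf'.norm.integrableOn_Ioc)
      · exact Filter.Eventually.of_forall fun _ => norm_nonneg _
      · apply Filter.Eventually.of_forall
        intro y hy
        rcases Set.mem_uIoc.mp hy with h | h
        · exact ⟨lt_of_le_of_lt hs.1 h.1, h.2.trans hx.2⟩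
        · exact ⟨lt_of_le_of_lt hx.1 h.1, h.2.trans hs.2⟩
    have h3 : f x = f s + ∫ r in s..x, f' r := by rw [e]; ring
    calc ‖f x‖ ≤ ‖f s‖ + ‖∫ r in s..x, f' r‖ := by
          conv_lhs => rw [h3]
          exact norm_add_le _ _
      _ ≤ _ := by gcongr
  have h4 : ∫ s in (0:ℝ)..1, ‖f x‖ ≤ ∫ s in (0:ℝ)..1, (‖f s‖ + ∫ r in (0:ℝ)..1, ‖f' r‖) := by
    apply intervalIntegral.integral_mono_on zero_le_one
    · exact intervalIntegrable_const
    · exact Continuous.intervalIntegrable (by fun_prop) _ _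
    · exact h1
  rw [intervalIntegral.integral_add (hfc.norm.intervalIntegrable _ _) intervalIntegrable_const]
    at h4
  rw [intervalIntegral.integral_add (hfc.norm.intervalIntegrable _ _)
    (hf'.norm.intervalIntegrable _ _)]
  simpa using h4

lemma sob2 {u u0 u1 : (Fin 2 → ℝ) → ℂ} (hu : Continuous u) (h0 : Continuous u0)
    (h1 : Continuous u1) (d0 : HasPd 0 u u0) (d1 : HasPd 1 u u1) :
    ∫ x in T2, ‖u x‖ ^ 2 ≤ (∫ x in T2, (‖u x‖ + ‖u0 x‖)) * (∫ x in T2, (‖u x‖ + ‖u1 x‖)) := by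
  rw [int2 (f := fun x => ‖u x‖ ^ 2) (by fun_prop), int2' (f := fun x => (‖u x‖ + ‖u0 x‖)) (by fun_prop),
    int2 (f := fun x => (‖u x‖ + ‖u1 x‖)) (by fun_prop)]
  set A : ℝ → ℝ := fun t => ∫ s in (0:ℝ)..1, (‖u ![s, t]‖ + ‖u0 ![s, t]‖) with hA
  set B : ℝ → ℝ := fun s => ∫ t in (0:ℝ)..1, (‖u ![s, t]‖ + ‖u1 ![s, t]‖) with hB
  have cu : Continuous fun z : ℝ × ℝ => u ![z.1, z.2] := hu.comp cont_vec
  have c0 : Continuous fun z : ℝ × ℝ => u0 ![z.1, z.2] := h0.comp cont_vec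
  have c1 : Continuous fun z : ℝ × ℝ => u1 ![z.1, z.2] := h1.comp cont_vec
  have cA : Continuous A := by
    apply intervalIntegral.continuous_parametric_intervalIntegral_of_continuous'
    have e1 := cu.comp (continuous_swap)
    have e2 := c0.comp (continuous_swap)
    exact e1.norm.add e2.norm
  have cB : Continuous B := by
    apply intervalIntegral.continuous_parametric_intervalIntegral_of_continuous'
    exact cu.norm.add c1.norm
  have bA : ∀ s ∈ Set.Icc (0:ℝ) 1, ∀ t, ‖u ![s, t]‖ ≤ A t := by
    intro s hs t
    refine sob1 (f := fun r => u ![r, t]) (f' := fun r => u0 ![r, t]) ?_ ?_ s hs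
    · intro r
      have := d0 ![r, t]
      simpa [upd0] using this
    · exact c0.comp (continuous_id.prodMk continuous_const)
  have bB : ∀ t ∈ Set.Icc (0:ℝ) 1, ∀ s, ‖u ![s, t]‖ ≤ B s := by
    intro t ht s
    refine sob1 (f := fun r => u ![s, r]) (f' := fun r => u1 ![s, r]) ?_ ?_ t ht
    · intro r
      have := d1 ![s, r]
      simpa [upd1] using this
    · exact c1.comp (continuous_const.prodMk continuous_id)
  have cin : Continuous fun s => ∫ t in (0:ℝ)..1, ‖u ![s, t]‖ ^ 2 := by
    apply intervalIntegral.continuous_parametric_intervalIntegral_of_continuous'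
    exact cu.norm.pow 2
  calc ∫ s in (0:ℝ)..1, ∫ t in (0:ℝ)..1, ‖u ![s, t]‖ ^ 2
      ≤ ∫ s in (0:ℝ)..1, ∫ t in (0:ℝ)..1, B s * A t := by
        apply intervalIntegral.integral_mono_on zero_le_one (cin.intervalIntegrable _ _)
        · simp_rw [intervalIntegral.integral_const_mul]
          exact Continuous.intervalIntegrable (by fun_prop) _ _
        · intro s hs
          apply intervalIntegral.integral_mono_on zero_le_one
          · apply Continuous.intervalIntegrable
            exact (cu.comp (continuous_const.prodMk continuous_id)).norm.pow 2
          · exact Continuous.intervalIntegrable (by fun_prop) _ _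
          · intro t ht
            rw [sq]
            exact mul_le_mul (bB t ht s) (bA s hs t) (norm_nonneg _)
              ((norm_nonneg _).trans (bB t ht s))
    _ = _ := by
        simp_rw [intervalIntegral.integral_const_mul, intervalIntegral.integral_mul_const]
        ring

lemma cs_int {f g : (Fin 2 → ℝ) → ℝ} (hf : Continuous f) (hg : Continuous g) :
    (∫ x in T2, f x * g x) ^ 2 ≤ (∫ x in T2, f x ^ 2) * ∫ x in T2, g x ^ 2 := by
  set a := ∫ x in T2, f x ^ 2
  set b := ∫ x in T2, f x * g x
  set c := ∫ x in T2, g x ^ 2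
  have h : ∀ t : ℝ, 0 ≤ a * (t * t) + (2 * b) * t + c := by
    intro t
    have : a * (t * t) + (2 * b) * t + c = ∫ x in T2, (t * f x + g x) ^ 2 := by
      have e : ∀ x, (t * f x + g x) ^ 2 = (t * t) * (f x ^ 2) + (2 * t) * (f x * g x) + g x ^ 2 := by
        intro x; ring
      simp_rw [e]
      rw [integral_add (intOn_T2 (by fun_prop)) (intOn_T2 (by fun_prop)),
        integral_add (intOn_T2 (by fun_prop)) (intOn_T2 (by fun_prop)), integral_const_mul,
        integral_const_mul]
      ring
    rw [this]
    exact integral_nonneg fun x => sq_nonneg _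
  have := discrim_le_zero h
  unfold discrim at this
  nlinarith

lemma hasPd_ee (i : Fin 2) (n : Fin 2 → ℤ) :
    HasPd i (ee n) (fun x => 2 * Real.pi * Complex.I * n i * ee n x) := by
  intro x
  have key : HasDerivAt (fun t : ℝ => (2 * Real.pi * Complex.I * (n 0 * (Function.update x i t 0 : ℝ)
      + n 1 * (Function.update x i t 1 : ℝ)) : ℂ)) (2 * Real.pi * Complex.I * n i) (x i) := by
    have hid : HasDerivAt (fun t : ℝ => (t : ℂ)) 1 (x i) := by
      simpa using (hasDerivAt_id (x i)).ofReal_comp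
    fin_cases i
    · simp only [Fin.zero_eta, Function.update_self, ne_eq, one_ne_zero, not_false_eq_true,
        Function.update_of_ne]
      simpa using ((hid.const_mul (n 0 : ℂ)).add_const _).const_mul (2 * Real.pi * Complex.I)
    · simp only [Fin.mk_one, Function.update_self, ne_eq, zero_ne_one, not_false_eq_true,
        Function.update_of_ne]
      simpa using ((hid.const_mul (n 1 : ℂ)).const_add _).const_mul (2 * Real.pi * Complex.I)
  have := key.cexp
  simp only [Function.update_eq_self] at this
  simp only
  rw [mul_comm (2 * Real.pi * Complex.I * n i : ℂ)]
  exact this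

lemma hasPd_tp (i : Fin 2) (S : Finset (Fin 2 → ℤ)) (b : (Fin 2 → ℤ) → ℂ) :
    HasPd i (tp S b) (tp S (fun n => 2 * Real.pi * Complex.I * n i * b n)) := by
  intro x
  unfold tp
  have := HasDerivAt.fun_sum (u := S) (fun n _ => (hasPd_ee i n x).const_mul (b n))
  convert! this using 1
  refine Finset.sum_congr rfl fun n _ => ?_
  ring

lemma hasPd_pow {i : Fin 2} {u u' : (Fin 2 → ℝ) → ℂ} (h : HasPd i u u') (m : ℕ) :
    HasPd i (fun x => u x ^ m) (fun x => m * u x ^ (m - 1) * u' x) := by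
  intro x
  have := (h x).fun_pow m
  simpa using this

lemma nrm_ge_one {n : Fin 2 → ℤ} (hn : n ≠ 0) : 1 ≤ nrm n ^ 2 := by
  have h := nrm_pos hn
  have h2 : 0 < nrm n ^ 2 := by positivity
  rw [nrm_sq] at *
  have : 0 < (n 0) ^ 2 + (n 1) ^ 2 := by exact_mod_cast h2
  exact_mod_cast this

/-- Gagliardo–Nirenberg for mean-zero trigonometric polynomials. -/
lemma gn (m : ℕ) : ∃ C : ℝ, 0 ≤ C ∧ ∀ (S : Finset (Fin 2 → ℤ)) (b : (Fin 2 → ℤ) → ℂ),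
    (0 : Fin 2 → ℤ) ∉ S →
    ∫ x in T2, ‖tp S b x‖ ^ (2 * (m + 1))
      ≤ C * (∑ n ∈ S, ‖b n‖ ^ 2) * (∑ n ∈ S, nrm n ^ 2 * ‖b n‖ ^ 2) ^ m := by
  induction m with
  | zero =>
    refine ⟨1, zero_le_one, fun S b _ => ?_⟩
    simp only [zero_add, mul_one, pow_zero, one_mul]
    rw [tp_sq]
  | succ m ih =>
    obtain ⟨C, hC, ih⟩ := ih
    have hpi := Real.pi_pos
    refine ⟨((m + 2 : ℝ) * (1 + 2 * Real.pi)) ^ 2 * C, by positivity, fun S b hS0 => ?_⟩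
    specialize ih S b hS0
    set g := tp S b with hg
    set D := ∑ n ∈ S, nrm n ^ 2 * ‖b n‖ ^ 2 with hD
    have hD0 : 0 ≤ D := Finset.sum_nonneg fun n _ => by positivity
    have gc : Continuous g := continuous_tp _ _
    set N := ∫ x in T2, ‖g x‖ ^ (2 * (m + 1)) with hN
    have hN0 : 0 ≤ N := integral_nonneg fun x => by positivity
    have hg2 : ∫ x in T2, ‖g x‖ ^ 2 ≤ D := by
      rw [hg, tp_sq]
      refine Finset.sum_le_sum fun n hn => ?_
      have hn0 : n ≠ 0 := by rintro rfl; exact hS0 hn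
      nlinarith [nrm_ge_one hn0, sq_nonneg ‖b n‖]
    have hdg : ∀ i, ∫ x in T2, ‖tp S (fun n => 2 * Real.pi * Complex.I * n i * b n) x‖ ^ 2
        ≤ (2 * Real.pi) ^ 2 * D := by
      intro i
      rw [tp_sq, hD, Finset.mul_sum]
      refine Finset.sum_le_sum fun n hn => ?_
      have : ‖(2 * Real.pi * Complex.I * n i * b n : ℂ)‖ ^ 2
          = (2 * Real.pi) ^ 2 * ((n i : ℝ) ^ 2 * ‖b n‖ ^ 2) := by
        simp only [norm_mul, Complex.norm_I, Complex.norm_real, Complex.norm_intCast,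
          Complex.norm_ofNat, Real.norm_eq_abs, abs_of_pos hpi, mul_pow, sq_abs]
        ring
      rw [this]
      have hle : (n i : ℝ) ^ 2 ≤ nrm n ^ 2 := by
        rw [nrm_sq]
        fin_cases i <;> simp <;> positivity
      have := mul_le_mul_of_nonneg_right hle (sq_nonneg ‖b n‖)
      exact mul_le_mul_of_nonneg_left this (by positivity)
    have half : ∀ i, ∫ x in T2, (‖g x ^ (m + 2)‖ + ‖((m + 2 : ℕ) : ℂ) * g x ^ (m + 1) *
        tp S (fun n => 2 * Real.pi * Complex.I * n i * b n) x‖)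
        ≤ (m + 2) * (1 + 2 * Real.pi) * Real.sqrt (N * D) := by
      intro i
      set d := tp S (fun n => 2 * Real.pi * Complex.I * n i * b n) with hd
      have dc : Continuous d := continuous_tp _ _
      rw [integral_add (intOn_T2 (by fun_prop)) (intOn_T2 (by fun_prop))]
      have e1 : ∫ x in T2, ‖g x ^ (m + 2)‖ ≤ Real.sqrt (N * D) := by
        apply Real.le_sqrt_of_sq_le
        have e : ∀ x, ‖g x ^ (m + 2)‖ = ‖g x‖ ^ (m + 1) * ‖g x‖ := by
          intro x; rw [norm_pow]; ring
        simp_rw [e]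
        refine (cs_int (by fun_prop) (by fun_prop)).trans ?_
        simp_rw [← pow_mul, mul_comm (m + 1) 2]
        gcongr
      have e2 : ∫ x in T2, ‖((m + 2 : ℕ) : ℂ) * g x ^ (m + 1) * d x‖
          ≤ (m + 2) * (2 * Real.pi * Real.sqrt (N * D)) := by
        have e : ∀ x, ‖((m + 2 : ℕ) : ℂ) * g x ^ (m + 1) * d x‖
            = (m + 2) * (‖g x‖ ^ (m + 1) * ‖d x‖) := by
          intro x
          rw [norm_mul, norm_mul, norm_pow, Complex.norm_natCast]
          push_cast
          ring
        simp_rw [e]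
        rw [integral_const_mul]
        gcongr
        rw [show 2 * Real.pi = Real.sqrt ((2 * Real.pi) ^ 2) from
          (Real.sqrt_sq (by positivity)).symm, ← Real.sqrt_mul (by positivity)]
        apply Real.le_sqrt_of_sq_le
        refine (cs_int (by fun_prop) (by fun_prop)).trans ?_
        simp_rw [← pow_mul, mul_comm (m + 1) 2]
        calc N * ∫ x in T2, ‖d x‖ ^ 2 ≤ N * ((2 * Real.pi) ^ 2 * D) := by
              gcongr
              exact hdg i
          _ = _ := by ring
      have hs := Real.sqrt_nonneg (N * D)
      have hm : (0:ℝ) ≤ m := Nat.cast_nonneg m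
      nlinarith [mul_nonneg hm hs]
    have hp : ∀ i, HasPd i (fun x => g x ^ (m + 2)) (fun x => ((m + 2 : ℕ) : ℂ) * g x ^ (m + 1) *
        tp S (fun n => 2 * Real.pi * Complex.I * n i * b n) x) := by
      intro i
      exact hasPd_pow (hasPd_tp i S b) (m + 2)
    have hs := sob2 (by fun_prop) (by fun_prop) (by fun_prop) (hp 0) (hp 1)
    have e : ∀ x, ‖g x ^ (m + 2)‖ ^ 2 = ‖g x‖ ^ (2 * (m + 1 + 1)) := by
      intro x
      rw [norm_pow, ← pow_mul]
      congr 1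
      ring
    simp_rw [e] at hs
    calc ∫ x in T2, ‖g x‖ ^ (2 * (m + 1 + 1)) ≤ _ := hs
      _ ≤ ((m + 2) * (1 + 2 * Real.pi) * Real.sqrt (N * D))
          * ((m + 2) * (1 + 2 * Real.pi) * Real.sqrt (N * D)) := by
          apply mul_le_mul (half 0) (half 1)
          · exact integral_nonneg fun x => by positivity
          · positivity
      _ = ((m + 2 : ℝ) * (1 + 2 * Real.pi)) ^ 2 * (Real.sqrt (N * D)) ^ 2 := by ring
      _ = ((m + 2 : ℝ) * (1 + 2 * Real.pi)) ^ 2 * (N * D) := by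
          rw [Real.sq_sqrt (by positivity)]
      _ ≤ ((m + 2 : ℝ) * (1 + 2 * Real.pi)) ^ 2 * (C * (∑ n ∈ S, ‖b n‖ ^ 2) * D ^ m * D) := by
          gcongr
      _ = _ := by ring
open MeasureTheory

/-- smooth periodic scalar functions -/
structure SP (g : (Fin 2 → ℝ) → ℝ) : Prop where
  cd : ContDiff ℝ (⊤ : ℕ∞) g
  per : Per g

lemma SP.cont {g} (hg : SP g) : Continuous g := hg.cd.continuous

lemma SP.contC {g} (hg : SP g) : Continuous (fun x => (g x : ℂ)) :=
  Complex.continuous_ofReal.comp hg.cont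

lemma SP.add {f g} (hf : SP f) (hg : SP g) : SP (fun x => f x + g x) :=
  ⟨hf.cd.add hg.cd, fun x k => by simp only [hf.per x k, hg.per x k]⟩

lemma SP.sub {f g} (hf : SP f) (hg : SP g) : SP (fun x => f x - g x) :=
  ⟨hf.cd.sub hg.cd, fun x k => by simp only [hf.per x k, hg.per x k]⟩

lemma SP.mul {f g} (hf : SP f) (hg : SP g) : SP (fun x => f x * g x) :=
  ⟨hf.cd.mul hg.cd, fun x k => by simp only [hf.per x k, hg.per x k]⟩

lemma SP.const (c : ℝ) : SP (fun _ => c) := ⟨contDiff_const, fun _ _ => rfl⟩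

lemma SP.pd {g} (hg : SP g) (i : Fin 2) : SP (pd g i) := by
  constructor
  · unfold _root_.pd
    exact (hg.cd.fderiv_right (m := (⊤ : ℕ∞)) (by simp)).clm_apply contDiff_const
  · intro x k
    unfold _root_.pd
    have h : (fun y => g (y + fun i => (k i : ℝ))) = g := funext fun y => hg.per y k
    have := fderiv_comp_add_right (𝕜 := ℝ) (f := g) (x := x) (fun i => (k i : ℝ))
    rw [h] at this
    rw [this]

lemma SP.hasPd {g} (hg : SP g) (i : Fin 2) :
    HasPd i (fun x => (g x : ℂ)) (fun x => (_root_.pd g i x : ℂ)) := by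
  intro x
  have hd : DifferentiableAt ℝ g x := hg.cd.differentiable (by simp) x
  have h1 : HasFDerivAt g (fderiv ℝ g x) (Function.update x i (x i)) := by
    rw [Function.update_eq_self]; exact hd.hasFDerivAt
  have h2 := h1.comp_hasDerivAt (x i) (hasDerivAt_update x i (x i))
  exact h2.ofReal_comp

lemma ee_per (n : Fin 2 → ℤ) (x : Fin 2 → ℝ) (k : Fin 2 → ℤ) :
    ee n (x + fun i => (k i : ℝ)) = ee n x := by
  unfold ee
  rw [Complex.exp_eq_exp_iff_exists_int]
  refine ⟨n 0 * k 0 + n 1 * k 1, ?_⟩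
  simp only [Pi.add_apply]
  push_cast
  ring

lemma int_hasPd_zero {W W' : (Fin 2 → ℝ) → ℂ} {i : Fin 2} (hW' : Continuous W')
    (hd : HasPd i W W') (hper : ∀ (x : Fin 2 → ℝ) (k : Fin 2 → ℤ), W (x + fun i => (k i : ℝ)) = W x) :
    ∫ x in T2, W' x = 0 := by
  have key : ∀ t : ℝ, W ![1, t] = W ![0, t] := by
    intro t
    have := hper ![0, t] ![1, 0]
    rw [← this]; congr 1; ext j; fin_cases j <;> simp
  have key' : ∀ t : ℝ, W ![t, 1] = W ![t, 0] := by
    intro t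
    have := hper ![t, 0] ![0, 1]
    rw [← this]; congr 1; ext j; fin_cases j <;> simp
  have c' := hW'.comp cont_vec
  fin_cases i
  · rw [int2' hW']
    have : ∀ t : ℝ, ∫ s in (0:ℝ)..1, W' ![s, t] = 0 := by
      intro t
      rw [intervalIntegral.integral_eq_sub_of_hasDerivAt (f := fun s => W ![s, t]), key, sub_self]
      · intro s _
        have := hd ![s, t]
        simp only [Fin.zero_eta, upd0] at this
        simpa using this
      · apply Continuous.intervalIntegrable
        exact c'.comp (f := fun s : ℝ => (s, t)) (by fun_prop)
    simp [this]
  · rw [int2 hW']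
    have : ∀ t : ℝ, ∫ s in (0:ℝ)..1, W' ![t, s] = 0 := by
      intro t
      rw [intervalIntegral.integral_eq_sub_of_hasDerivAt (f := fun s => W ![t, s]), key', sub_self]
      · intro s _
        have := hd ![t, s]
        simp only [Fin.mk_one, upd1] at this
        simpa using this
      · apply Continuous.intervalIntegrable
        exact c'.comp (f := fun s : ℝ => (t, s)) (by fun_prop)
    simp [this]

/-- Fourier coefficient of a real function -/
noncomputable def fr (g : (Fin 2 → ℝ) → ℝ) (n : Fin 2 → ℤ) : ℂ := fc (fun x => (g x : ℂ)) n

lemma fr_pd {g} (hg : SP g) (i : Fin 2) (n : Fin 2 → ℤ) :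
    fr (pd g i) n = 2 * Real.pi * Complex.I * n i * fr g n := by
  have hd : HasPd i (fun x => (g x : ℂ) * ee (-n) x)
      (fun x => (pd g i x : ℂ) * ee (-n) x
        + (g x : ℂ) * (2 * Real.pi * Complex.I * ((-n) i : ℤ) * ee (-n) x)) := by
    intro x
    have := (hg.hasPd i x).mul (hasPd_ee i (-n) x)
    simp only [Function.update_eq_self] at this
    exact this
  have c1 := hg.contC
  have c2 := (hg.pd i).contC
  have h0 := int_hasPd_zero (by fun_prop) hd (by
    intro x k
    rw [ee_per, hg.per])
  rw [integral_add (intOn_T2 (by fun_prop)) (intOn_T2 (by fun_prop))] at h0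
  have e : ∫ x in T2, (g x : ℂ) * (2 * Real.pi * Complex.I * ((-n) i : ℤ) * ee (-n) x)
      = -(2 * Real.pi * Complex.I * n i) * ∫ x in T2, (g x : ℂ) * ee (-n) x := by
    rw [← integral_const_mul]
    congr 1; ext x
    simp only [Pi.neg_apply]; push_cast; ring
  rw [e] at h0
  unfold fr fc
  linear_combination h0

lemma fr_add {f g} (hf : SP f) (hg : SP g) (n) : fr (fun x => f x + g x) n = fr f n + fr g n := by
  unfold fr fc
  have c1 := hf.contC
  have c2 := hg.contC
  rw [← integral_add (intOn_T2 (by fun_prop)) (intOn_T2 (by fun_prop))]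
  congr 1; ext x; push_cast; ring

lemma fr_sub {f g} (hf : SP f) (hg : SP g) (n) : fr (fun x => f x - g x) n = fr f n - fr g n := by
  unfold fr fc
  have c1 := hf.contC
  have c2 := hg.contC
  rw [← integral_sub (intOn_T2 (by fun_prop)) (intOn_T2 (by fun_prop))]
  congr 1; ext x; push_cast; ring

lemma fr_cmul (c : ℝ) (f) (n) : fr (fun x => c * f x) n = c * fr f n := by
  unfold fr fc
  rw [← integral_const_mul]
  congr 1; ext x; push_cast; ring

lemma norm_fr_le {g} (hg : SP g) (n) : ‖fr g n‖ ≤ ∫ x in T2, |g x| := by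
  unfold fr fc
  refine (norm_integral_le_integral_norm _).trans (le_of_eq ?_)
  congr 1; ext x
  rw [norm_mul, norm_ee, mul_one, Complex.norm_real, Real.norm_eq_abs]

lemma fr_decay {g} (hg : SP g) : ∃ M : ℝ, 0 ≤ M ∧ ∀ n,
    ‖fr g n‖ ≤ M * ((1 / (1 + (n 0 : ℝ) ^ 2)) * (1 / (1 + (n 1 : ℝ) ^ 2))) := by
  have step : ∀ (g) (_ : SP g) (i : Fin 2), SP (fun x => g x - pd (pd g i) i x) ∧
      ∀ n, fr (fun x => g x - pd (pd g i) i x) n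
        = ((1 + 4 * Real.pi ^ 2 * (n i : ℝ) ^ 2 : ℝ) : ℂ) * fr g n := by
    intro g hg i
    refine ⟨hg.sub ((hg.pd i).pd i), fun n => ?_⟩
    rw [fr_sub hg ((hg.pd i).pd i), fr_pd (hg.pd i), fr_pd hg]
    push_cast
    linear_combination (-(4 * Real.pi ^ 2 * (n i) ^ 2 * fr g n) : ℂ) * Complex.I_sq
  obtain ⟨h1, e1⟩ := step g hg 0
  obtain ⟨h2, e2⟩ := step _ h1 1
  refine ⟨∫ x in T2, |(fun x => (fun x => g x - pd (pd g 0) 0 x) x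
    - pd (pd (fun x => g x - pd (pd g 0) 0 x) 1) 1 x) x|, integral_nonneg fun _ => abs_nonneg _,
    fun n => ?_⟩
  have h := norm_fr_le h2 n
  rw [e2, e1, norm_mul, norm_mul, Complex.norm_real, Complex.norm_real, Real.norm_eq_abs,
    Real.norm_eq_abs, abs_of_pos (by positivity), abs_of_pos (by positivity)] at h
  have hpi : 1 ≤ 4 * Real.pi ^ 2 := by nlinarith [Real.pi_gt_three]
  have a0 : (1 + (n 0 : ℝ) ^ 2) ≤ 1 + 4 * Real.pi ^ 2 * (n 0 : ℝ) ^ 2 := by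
    nlinarith [sq_nonneg (n 0 : ℝ)]
  have a1 : (1 + (n 1 : ℝ) ^ 2) ≤ 1 + 4 * Real.pi ^ 2 * (n 1 : ℝ) ^ 2 := by
    nlinarith [sq_nonneg (n 1 : ℝ)]
  have h3 : (1 + (n 1 : ℝ) ^ 2) * ((1 + (n 0 : ℝ) ^ 2) * ‖fr g n‖)
      ≤ (1 + 4 * Real.pi ^ 2 * (n 1 : ℝ) ^ 2) * ((1 + 4 * Real.pi ^ 2 * (n 0 : ℝ) ^ 2) * ‖fr g n‖) := by
    gcongr
  have h4 := h3.trans h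
  have e : ∀ M a b : ℝ, M * ((1 / a) * (1 / b)) = M / (a * b) := by
    intro M a b; rw [one_div_mul_one_div, mul_one_div]
  rw [e, le_div_iff₀ (by positivity)]
  linarith

lemma summable_inv_sq : Summable (fun n : ℤ => 1 / (1 + (n : ℝ) ^ 2)) := by
  have h := (Real.summable_one_div_int_pow (p := 2)).mpr (by norm_num)
  rw [← Set.Finite.summable_compl_iff (Set.finite_singleton (0:ℤ))] at h ⊢
  refine Summable.of_nonneg_of_le (fun n => by simp only [Function.comp]; positivity) (fun n => ?_) h
  have : (n : ℤ) ≠ 0 := n.2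
  have : ((n : ℤ) : ℝ) ≠ 0 := by exact_mod_cast this
  simp only [Function.comp]
  apply one_div_le_one_div_of_le (by positivity)
  linarith

lemma summable_fr {g} (hg : SP g) : Summable (fun n => ‖fr g n‖) := by
  obtain ⟨M, hM, h⟩ := fr_decay hg
  refine Summable.of_nonneg_of_le (fun n => norm_nonneg _) h ?_
  apply Summable.mul_left
  have h1 := summable_inv_sq.mul_of_nonneg summable_inv_sq (fun n => by positivity)
    (fun n => by positivity)
  rw [← (finTwoArrowEquiv ℤ).symm.summable_iff]
  exact h1
open MeasureTheory

/-- covering map of the torus -/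
def cov (x : Fin 2 → ℝ) : UnitAddTorus (Fin 2) := fun i => (x i : UnitAddCircle)

lemma cov_open : IsOpenQuotientMap cov :=
  IsOpenQuotientMap.piMap (fun _ : Fin 2 => QuotientAddGroup.isOpenQuotientMap_mk)

noncomputable def lft (g : (Fin 2 → ℝ) → ℝ) (y : UnitAddTorus (Fin 2)) : ℂ :=
  ((g fun i => (AddCircle.equivIoc 1 0 (y i)).1 : ℝ) : ℂ)

lemma lft_cov {g} (hg : Per g) (x : Fin 2 → ℝ) : lft g (cov x) = g x := by
  unfold lft
  congr 1
  have h : ∀ i, ∃ k : ℤ, (AddCircle.equivIoc (1:ℝ) 0 (cov x i)).1 = x i + k := by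
    intro i
    have h1 : (((AddCircle.equivIoc (1:ℝ) 0 (cov x i)).1 : ℝ) : AddCircle (1:ℝ)) = (x i : AddCircle (1:ℝ)) :=
      AddCircle.coe_equivIoc ..
    rw [← sub_eq_zero, ← AddCircle.coe_sub, AddCircle.coe_eq_zero_iff] at h1
    obtain ⟨k, hk⟩ := h1
    refine ⟨k, ?_⟩
    simp only [zsmul_eq_mul, mul_one] at hk
    linarith
  choose k hk using h
  rw [← hg x k]
  congr 1
  ext i
  simp [hk]

lemma mFourier_cov (n : Fin 2 → ℤ) (x : Fin 2 → ℝ) : UnitAddTorus.mFourier n (cov x) = ee n x := by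
  simp only [UnitAddTorus.mFourier, cov, ContinuousMap.coe_mk, fourier_coe_apply, Fin.prod_univ_two]
  rw [← Complex.exp_add]
  unfold ee
  congr 1
  push_cast
  ring

lemma hasSum_fr {g} (hg : SP g) (x : Fin 2 → ℝ) : HasSum (fun n => fr g n * ee n x) (g x : ℂ) := by
  have hc : Continuous (lft g) := by
    rw [cov_open.isQuotientMap.continuous_iff]
    have : lft g ∘ cov = fun x => (g x : ℂ) := funext fun x => lft_cov hg.per x
    rw [this]
    exact hg.contC
  have hco : ∀ n, UnitAddTorus.mFourierCoeff (⟨lft g, hc⟩ : C(UnitAddTorus (Fin 2), ℂ)) n = fr g n := by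
    intro n
    rw [UnitAddTorus.mFourierCoeff_eq_integral _ n 0]
    unfold fr fc T2
    have hae : {x : Fin 2 → ℝ | ∀ i, x i ∈ Set.Ioc ((0 : Fin 2 → ℝ) i) ((0 : Fin 2 → ℝ) i + 1)}
        =ᵐ[volume] Set.Icc (0 : Fin 2 → ℝ) 1 := by
      have := Measure.univ_pi_Ioc_ae_eq_Icc (μ := fun _ : Fin 2 => (volume : Measure ℝ))
        (f := (0 : Fin 2 → ℝ)) (g := 1)
      have e : {x : Fin 2 → ℝ | ∀ i, x i ∈ Set.Ioc ((0 : Fin 2 → ℝ) i) ((0 : Fin 2 → ℝ) i + 1)}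
        = Set.univ.pi fun i => Set.Ioc ((0 : Fin 2 → ℝ) i) ((1 : Fin 2 → ℝ) i) := by
        ext x; simp
      rw [e]
      exact this
    rw [setIntegral_congr_set hae]
    congr 1
    ext x
    have e1 := mFourier_cov (-n) x
    have e2 := lft_cov hg.per x
    unfold cov at e1 e2
    rw [e1]
    simp only [ContinuousMap.coe_mk, e2, smul_eq_mul]
    ring
  have hs : Summable (UnitAddTorus.mFourierCoeff (⟨lft g, hc⟩ : C(UnitAddTorus (Fin 2), ℂ))) := by
    have : UnitAddTorus.mFourierCoeff (⟨lft g, hc⟩ : C(UnitAddTorus (Fin 2), ℂ)) = fr g := funext hco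
    rw [this]
    exact (summable_fr hg).of_norm
  have := UnitAddTorus.hasSum_mFourier_series_apply_of_summable hs (cov x)
  simp only [mFourier_cov, smul_eq_mul] at this
  have e : (fun n => fr g n * ee n x) = fun n =>
      UnitAddTorus.mFourierCoeff (⟨lft g, hc⟩ : C(UnitAddTorus (Fin 2), ℂ)) n * ee n x := by
    ext n; rw [hco]
  rw [e, ← lft_cov hg.per]
  exact this
open MeasureTheory Filter Topology

/-- symmetric boxes of nonzero frequencies -/
noncomputable def bx (N : ℕ) : Finset (Fin 2 → ℤ) :=
  (Finset.Icc (fun _ => -(N : ℤ)) (fun _ => (N : ℤ))).erase 0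

lemma bx_neg (N : ℕ) : ∀ n ∈ bx N, -n ∈ bx N := by
  intro n hn
  simp only [bx, Finset.mem_erase, Finset.mem_Icc, Pi.le_def, Fin.forall_fin_two, Pi.neg_apply,
    ne_eq, neg_eq_zero] at hn ⊢
  refine ⟨hn.1, ⟨?_, ?_⟩, ⟨?_, ?_⟩⟩ <;> omega

lemma bx_zero (N : ℕ) : (0 : Fin 2 → ℤ) ∉ bx N := by simp [bx]

lemma bx_tendsto : Tendsto (fun N : ℕ => Finset.Icc (fun _ : Fin 2 => -(N : ℤ)) (fun _ => (N : ℤ)))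
    atTop atTop := by
  apply tendsto_atTop_finset_of_monotone
  · intro a b hab
    apply Finset.Icc_subset_Icc <;> intro i <;> simp [hab]
  · intro n
    refine ⟨(n 0).natAbs + (n 1).natAbs, ?_⟩
    simp only [Finset.mem_Icc, Pi.le_def, Fin.forall_fin_two]
    push_cast
    refine ⟨⟨?_, ?_⟩, ⟨?_, ?_⟩⟩ <;> grind

lemma tp_bx (N : ℕ) (a : (Fin 2 → ℤ) → ℂ) (x) : tp (bx N) a x
    = (∑ n ∈ Finset.Icc (fun _ : Fin 2 => -(N : ℤ)) (fun _ => (N : ℤ)), a n * ee n x) - a 0 := by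
  unfold tp bx
  rw [Finset.sum_erase_eq_sub, ee_zero, mul_one]
  simp [Pi.le_def]

lemma tp_lim {g} (hg : SP g) (x) :
    Tendsto (fun N => tp (bx N) (fr g) x) atTop (𝓝 ((g x : ℂ) - fr g 0)) := by
  simp_rw [tp_bx]
  exact ((hasSum_fr hg x).comp bx_tendsto).sub_const _

lemma int_lim {g} (hg : SP g) (k : ℕ) :
    Tendsto (fun N => ∫ x in T2, ‖tp (bx N) (fr g) x‖ ^ k) atTop
      (𝓝 (∫ x in T2, ‖(g x : ℂ) - fr g 0‖ ^ k)) := by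
  apply tendsto_integral_of_dominated_convergence (fun _ => (∑' n, ‖fr g n‖) ^ k)
  · intro N
    exact Continuous.aestronglyMeasurable (by fun_prop)
  · exact integrable_const _
  · intro N
    filter_upwards with x
    rw [Real.norm_eq_abs, abs_of_nonneg (by positivity)]
    gcongr
    unfold tp
    refine (norm_sum_le _ _).trans ?_
    simp_rw [norm_mul, norm_ee, mul_one]
    exact (summable_fr hg).sum_le_tsum _ (fun _ _ => norm_nonneg _)
  · filter_upwards with x
    exact ((tp_lim hg x).norm).pow k

/-- `L²` bound from coefficient bounds -/
lemma L2_le {g} (hg : SP g) (h0 : fr g 0 = 0) {A : ℝ}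
    (hA : ∀ S : Finset (Fin 2 → ℤ), ∑ n ∈ S, ‖fr g n‖ ^ 2 ≤ A) :
    ∫ x in T2, g x ^ 2 ≤ A := by
  have := int_lim hg 2
  simp_rw [h0, sub_zero, tp_sq, Complex.norm_real, Real.norm_eq_abs, sq_abs] at this
  exact le_of_tendsto' this (fun N => hA _)

lemma int_sub_mean {g} (hg : SP g) (k : ℕ) :
    ∫ x in T2, ‖(g x : ℂ) - fr g 0‖ ^ k ≤ 2 ^ k * 2 * ∫ x in T2, |g x| ^ k := by
  have c := hg.contC
  have c' := hg.cont
  have h1 : ‖fr g 0‖ ^ k ≤ ∫ x in T2, |g x| ^ k := by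
    have := jensen_pow (μ := volume.restrict T2) (f := fun x => (g x : ℂ)) (intOn_T2 c) k
      (intOn_T2 (by fun_prop))
    simp only [Complex.norm_real, Real.norm_eq_abs] at this
    unfold fr fc
    simpa [ee_zero] using this
  have h2 : ∫ x in T2, ‖(g x : ℂ) - fr g 0‖ ^ k ≤ ∫ x in T2, 2 ^ k * (|g x| ^ k + ‖fr g 0‖ ^ k) := by
    apply integral_mono (intOn_T2 (by fun_prop)) (intOn_T2 (by fun_prop))
    intro x
    simp only
    calc ‖(g x : ℂ) - fr g 0‖ ^ k ≤ (|g x| + ‖fr g 0‖) ^ k := by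
          gcongr
          refine (norm_sub_le _ _).trans ?_
          rw [Complex.norm_real, Real.norm_eq_abs]
      _ ≤ _ := add_pow_le' (abs_nonneg _) (norm_nonneg _) k
  rw [integral_const_mul, integral_add (intOn_T2 (by fun_prop)) (integrable_const _)] at h2
  simp only [integral_const, probReal_univ, one_smul] at h2
  have : (0:ℝ) < 2 ^ k := by positivity
  nlinarith

/-- unit frequency vector and its rotation -/
noncomputable def mr (j : Fin 2) (n : Fin 2 → ℤ) : ℝ := n j / nrm n

noncomputable def rt (j : Fin 2) (n : Fin 2 → ℤ) : ℝ := if j = 0 then - mr 1 n else mr 0 n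

def Mult (q : ℕ) (C : ℝ) (c : (Fin 2 → ℤ) → ℝ) : Prop :=
  0 ≤ C ∧ ∀ (S : Finset (Fin 2 → ℤ)) (a : (Fin 2 → ℤ) → ℂ), (∀ n ∈ S, -n ∈ S) → 0 ∉ S →
    ∫ x in T2, ‖tp S (fun n => (c n : ℂ) * a n) x‖ ^ q ≤ C * ∫ x in T2, ‖tp S a x‖ ^ q

lemma Mult.comp {q C1 C2 c1 c2} (h1 : Mult q C1 c1) (h2 : Mult q C2 c2) :
    Mult q (C1 * C2) (fun n => c1 n * c2 n) := by
  refine ⟨mul_nonneg h1.1 h2.1, fun S a hS h0 => ?_⟩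
  have e := h1.2 S (fun n => (c2 n : ℂ) * a n) hS h0
  simp only [Complex.ofReal_mul, mul_assoc] at e ⊢
  exact e.trans (mul_le_mul_of_nonneg_left (h2.2 S a hS h0) h1.1)

lemma Mult.neg {q C c} (h : Mult q C c) : Mult q C (fun n => - c n) := by
  refine ⟨h.1, fun S a hS h0 => ?_⟩
  have : ∀ x, ‖tp S (fun n => ((- c n : ℝ) : ℂ) * a n) x‖ = ‖tp S (fun n => (c n : ℂ) * a n) x‖ := by
    intro x
    rw [← norm_neg]
    congr 1
    unfold tp
    rw [← Finset.sum_neg_distrib]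
    refine Finset.sum_congr rfl fun n _ => ?_
    push_cast; ring
  simp_rw [this]
  exact h.2 S a hS h0

lemma mult_mr (k : ℕ) : ∃ C, (∀ j, Mult (2 * (k + 1)) C (mr j)) ∧ ∀ j, Mult (2 * (k + 1)) C (rt j) := by
  obtain ⟨C, hC, h⟩ := riesz k
  have h1 : ∀ j, Mult (2 * (k + 1)) C (mr j) := fun j => ⟨hC, fun S a hS h0 => h S a j hS h0⟩
  refine ⟨C, h1, fun j => ?_⟩
  have : rt j = if j = 0 then (fun n => - mr 1 n) else mr 0 := by
    ext n; unfold rt; split_ifs <;> rfl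
  rw [this]
  split_ifs
  · exact (h1 1).neg
  · exact h1 0

/-- the Stokes multiplier -/
noncomputable def st (k i a b : Fin 2) (n : Fin 2 → ℤ) : ℝ := mr k n * (rt i n * (rt a n * mr b n))

lemma mult_st (k : ℕ) : ∃ C, 0 ≤ C ∧ ∀ l i a b, Mult (2 * (k + 1)) C (st l i a b) := by
  obtain ⟨C, h1, h2⟩ := mult_mr k
  exact ⟨C * (C * (C * C)), by have := (h1 0).1; positivity,
    fun l i a b => (h1 l).comp ((h2 i).comp ((h2 a).comp (h1 b)))⟩

lemma pow5 (x y z w g : ℝ) (hx : 0 ≤ x) (hy : 0 ≤ y) (hz : 0 ≤ z) (hw : 0 ≤ w) (hg : 0 ≤ g) (q : ℕ) :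
    (x + y + (z + w) + g) ^ q ≤ 8 ^ q * (x ^ q + y ^ q + z ^ q + w ^ q + g ^ q) := by
  have h1 := add_pow_le' (x := x + y + (z + w)) (y := g) (by positivity) hg q
  have h2 := add_pow_le' (x := x + y) (y := z + w) (by positivity) (by positivity) q
  have h3 := add_pow_le' (x := x) (y := y) hx hy q
  have h4 := add_pow_le' (x := z) (y := w) hz hw q
  have p1 : (1:ℝ) ≤ 2 ^ q := one_le_pow₀ (by norm_num)
  have e : (8:ℝ) ^ q = 2 ^ q * (2 ^ q * 2 ^ q) := by rw [← mul_pow, ← mul_pow]; norm_num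
  have hgq : 0 ≤ g ^ q := by positivity
  calc _ ≤ _ := h1
    _ ≤ 2 ^ q * (2 ^ q * (2 ^ q * (x ^ q + y ^ q) + 2 ^ q * (z ^ q + w ^ q)) + (2 ^ q * 2 ^ q) * g ^ q) := by
        have : g ^ q ≤ (2 ^ q * 2 ^ q) * g ^ q := le_mul_of_one_le_left hgq (by nlinarith)
        gcongr
        exact h2.trans (by gcongr)
    _ = _ := by rw [e]; ring

lemma main_abs (k : ℕ) : ∃ K : ℝ, 0 ≤ K ∧ ∀ (l i : Fin 2) (w : (Fin 2 → ℝ) → ℝ)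
    (F : Fin 2 → Fin 2 → (Fin 2 → ℝ) → ℝ) (b : (Fin 2 → ℤ) → ℂ) (A B : ℝ),
    SP w → (∀ a c, SP (F a c)) → fr w 0 = 0 →
    (∀ n, n ≠ 0 → fr w n = b n - ∑ a, ∑ c, (st l i a c n : ℂ) * fr (F a c) n) →
    (∀ S : Finset (Fin 2 → ℤ), 0 ∉ S → ∑ n ∈ S, ‖b n‖ ^ 2 ≤ A) →
    (∀ S : Finset (Fin 2 → ℤ), 0 ∉ S → ∑ n ∈ S, nrm n ^ 2 * ‖b n‖ ^ 2 ≤ B) →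
    ∫ x in T2, |w x| ^ (2 * (k + 1)) ≤
      K * ((∑ a, ∑ c, ∫ x in T2, |F a c x| ^ (2 * (k + 1))) + A * B ^ k) := by
  obtain ⟨C, hC, hst⟩ := mult_st k
  obtain ⟨Cg, hCg, hgn⟩ := gn k
  set q := 2 * (k + 1) with hq
  refine ⟨8 ^ q * (C * (2 ^ q * 2) + Cg), by positivity, ?_⟩
  intro l i w F b A B hw hF h0 hrel hA hB
  have hA0 : 0 ≤ A := by simpa using hA ∅ (by simp)
  have hB0 : 0 ≤ B := by simpa using hB ∅ (by simp)
  have fin : ∀ N, ∫ x in T2, ‖tp (bx N) (fr w) x‖ ^ q ≤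
      8 ^ q * ((∑ a, ∑ c, C * ∫ x in T2, ‖tp (bx N) (fr (F a c)) x‖ ^ q) + Cg * A * B ^ k) := by
    intro N
    set t : Fin 2 → Fin 2 → (Fin 2 → ℝ) → ℂ :=
      fun a c => tp (bx N) (fun n => (st l i a c n : ℂ) * fr (F a c) n) with ht
    have ct : ∀ a c, Continuous (t a c) := fun a c => continuous_tp _ _
    have e : ∀ x, tp (bx N) (fr w) x = tp (bx N) b x - ∑ a, ∑ c, t a c x := by
      intro x
      simp only [ht, tp, Fin.sum_univ_two, ← Finset.sum_add_distrib, ← Finset.sum_sub_distrib]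
      refine Finset.sum_congr rfl fun n hn => ?_
      rw [hrel n (fun h => bx_zero N (h ▸ hn))]
      simp only [Fin.sum_univ_two]
      ring
    have hpt : ∀ x, ‖tp (bx N) (fr w) x‖ ^ q ≤ 8 ^ q * (‖t 0 0 x‖ ^ q + ‖t 0 1 x‖ ^ q + ‖t 1 0 x‖ ^ q
        + ‖t 1 1 x‖ ^ q + ‖tp (bx N) b x‖ ^ q) := by
      intro x
      refine le_trans ?_ (pow5 _ _ _ _ _ (norm_nonneg _) (norm_nonneg _) (norm_nonneg _)
        (norm_nonneg _) (norm_nonneg _) q)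
      gcongr
      rw [e]
      simp only [Fin.sum_univ_two]
      have n1 := norm_sub_le (tp (bx N) b x) (t 0 0 x + t 0 1 x + (t 1 0 x + t 1 1 x))
      have n2 := norm_add_le (t 0 0 x + t 0 1 x) (t 1 0 x + t 1 1 x)
      have n3 := norm_add_le (t 0 0 x) (t 0 1 x)
      have n4 := norm_add_le (t 1 0 x) (t 1 1 x)
      linarith
    have hint := integral_mono (μ := volume.restrict T2) (intOn_T2 (by fun_prop))
      (intOn_T2 (by fun_prop)) hpt
    refine hint.trans ?_
    rw [integral_const_mul]
    gcongr
    rw [integral_add (intOn_T2 (by fun_prop)) (intOn_T2 (by fun_prop)),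
      integral_add (intOn_T2 (by fun_prop)) (intOn_T2 (by fun_prop)),
      integral_add (intOn_T2 (by fun_prop)) (intOn_T2 (by fun_prop)),
      integral_add (intOn_T2 (by fun_prop)) (intOn_T2 (by fun_prop))]
    have g1 : ∫ x in T2, ‖tp (bx N) b x‖ ^ q ≤ Cg * A * B ^ k := by
      refine (hgn (bx N) b (bx_zero N)).trans ?_
      have s1 := hA (bx N) (bx_zero N)
      have s2 := hB (bx N) (bx_zero N)
      have s3 : 0 ≤ ∑ n ∈ bx N, nrm n ^ 2 * ‖b n‖ ^ 2 := by positivity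
      gcongr
    have g2 : ∀ a c, ∫ x in T2, ‖t a c x‖ ^ q ≤ C * ∫ x in T2, ‖tp (bx N) (fr (F a c)) x‖ ^ q :=
      fun a c => (hst l i a c).2 _ _ (bx_neg N) (bx_zero N)
    simp only [Fin.sum_univ_two]
    linarith [g2 0 0, g2 0 1, g2 1 0, g2 1 1]
  have lim1 := int_lim hw q
  have lim2 : Tendsto (fun N => 8 ^ q * ((∑ a, ∑ c, C * ∫ x in T2, ‖tp (bx N) (fr (F a c)) x‖ ^ q)
      + Cg * A * B ^ k)) atTop (𝓝 (8 ^ q * ((∑ a, ∑ c, C * ∫ x in T2, ‖(F a c x : ℂ) - fr (F a c) 0‖ ^ q)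
      + Cg * A * B ^ k))) := by
    apply Tendsto.const_mul
    apply Tendsto.add_const
    refine tendsto_finsetSum _ fun a _ => tendsto_finsetSum _ fun c _ => ?_
    exact (int_lim (hF a c) q).const_mul C
  have h := le_of_tendsto_of_tendsto' lim1 lim2 fin
  simp_rw [h0, sub_zero, Complex.norm_real, Real.norm_eq_abs] at h
  refine h.trans ?_
  rw [mul_assoc ((8:ℝ) ^ q)]
  apply mul_le_mul_of_nonneg_left _ (by positivity)
  have m1 : ∑ a, ∑ c, C * ∫ x in T2, ‖(F a c x : ℂ) - fr (F a c) 0‖ ^ q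
      ≤ C * (2 ^ q * 2) * ∑ a, ∑ c, ∫ x in T2, |F a c x| ^ q := by
    rw [Finset.mul_sum]
    refine Finset.sum_le_sum fun a _ => ?_
    rw [Finset.mul_sum]
    refine Finset.sum_le_sum fun c _ => ?_
    rw [mul_assoc]
    exact mul_le_mul_of_nonneg_left (int_sub_mean (hF a c) q) hC
  have m2 : 0 ≤ ∑ a, ∑ c, ∫ x in T2, |F a c x| ^ q :=
    Finset.sum_nonneg fun a _ => Finset.sum_nonneg fun c _ => integral_nonneg fun x => by positivity
  have m3 : 0 ≤ A * B ^ k := by positivity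
  have m4 : 0 ≤ C * (2 ^ q * 2) := by positivity
  nlinarith [mul_nonneg m4 m3, mul_nonneg hCg m2]
open MeasureTheory Filter Topology

/-- the Stokes type system on the torus -/
structure Sys (M : ℝ) (μ ρ P : (Fin 2 → ℝ) → ℝ) (v h : (Fin 2 → ℝ) → Fin 2 → ℝ) : Prop where
  hM : 0 < M
  hμ : SP μ
  hρ : SP ρ
  hP : SP P
  hv : ∀ i, SP (fun x => v x i)
  hh : ∀ i, SP (fun x => h x i)
  div : ∀ x, ∑ i, pd (fun y => v y i) i x = 0
  eqn : ∀ x i, ρ x * h x i = (∑ j, pd (fun y => μ y * Dsym v i j y) j x) - pd P i x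

section
variable {M : ℝ} {μ ρ P : (Fin 2 → ℝ) → ℝ} {v h : (Fin 2 → ℝ) → Fin 2 → ℝ}

/-- the perturbation stress -/
noncomputable def FF (M : ℝ) (μ : (Fin 2 → ℝ) → ℝ) (v : (Fin 2 → ℝ) → Fin 2 → ℝ) (a b : Fin 2)
    (x : Fin 2 → ℝ) : ℝ := (M⁻¹ * μ x - 1) * Dsym v a b x

lemma Sys.hD (H : Sys M μ ρ P v h) (a b) : SP (Dsym v a b) :=
  ((H.hv b).pd a).add ((H.hv a).pd b)

lemma Sys.hF (H : Sys M μ ρ P v h) (a b) : SP (FF M μ v a b) :=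
  (((SP.const M⁻¹).mul H.hμ).sub (SP.const 1)).mul (H.hD a b)

lemma Sys.hf (H : Sys M μ ρ P v h) (i) : SP (fun x => ρ x * h x i) := H.hρ.mul (H.hh i)

lemma Sys.fr_D (H : Sys M μ ρ P v h) (a b) (n) : fr (Dsym v a b) n
    = 2 * Real.pi * Complex.I * (n a * fr (fun x => v x b) n + n b * fr (fun x => v x a) n) := by
  have e : Dsym v a b = fun x => pd (fun y => v y b) a x + pd (fun y => v y a) b x := rfl
  rw [e, fr_add ((H.hv b).pd a) ((H.hv a).pd b), fr_pd (H.hv b), fr_pd (H.hv a)]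
  ring

lemma Sys.fr_div (H : Sys M μ ρ P v h) (n) :
    n 0 * fr (fun x => v x 0) n + n 1 * fr (fun x => v x 1) n = 0 := by
  have e : (fun x => pd (fun y => v y 0) 0 x + pd (fun y => v y 1) 1 x) = fun _ => 0 := by
    ext x; simpa [Fin.sum_univ_two] using H.div x
  have h1 := fr_add ((H.hv 0).pd 0) ((H.hv 1).pd 1) n
  rw [e, fr_pd (H.hv 0), fr_pd (H.hv 1)] at h1
  have h2 : fr (fun _ => 0) n = 0 := by simp [fr, fc]
  rw [h2] at h1
  have h3 : (2 * Real.pi * Complex.I : ℂ) ≠ 0 := by simp [Real.pi_ne_zero]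
  apply mul_left_cancel₀ h3
  rw [mul_zero]
  linear_combination -h1

lemma Sys.fr_eqn (H : Sys M μ ρ P v h) (i) (n) :
    fr (fun x => ρ x * h x i) n = M * (2 * Real.pi * Complex.I * (n 0 * (fr (Dsym v i 0) n
      + fr (FF M μ v i 0) n) + n 1 * (fr (Dsym v i 1) n + fr (FF M μ v i 1) n)))
      - 2 * Real.pi * Complex.I * n i * fr P n := by
  have hs : ∀ j, SP (fun y => μ y * Dsym v i j y) := fun j => H.hμ.mul (H.hD i j)
  have e : (fun x => ρ x * h x i) = fun x => (pd (fun y => μ y * Dsym v i 0 y) 0 x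
      + pd (fun y => μ y * Dsym v i 1 y) 1 x) - pd P i x := by
    ext x; rw [H.eqn]; simp [Fin.sum_univ_two]
  have e2 : ∀ j, fr (fun y => μ y * Dsym v i j y) n = M * (fr (Dsym v i j) n + fr (FF M μ v i j) n) := by
    intro j
    have : (fun y => μ y * Dsym v i j y) = fun y => M * (Dsym v i j y + FF M μ v i j y) := by
      ext y; unfold FF; have := H.hM.ne'; field_simp; ring
    rw [this, fr_cmul, fr_add (H.hD i j) (H.hF i j)]
  rw [e, fr_sub (((hs 0).pd 0).add ((hs 1).pd 1)) (H.hP.pd i), fr_add ((hs 0).pd 0) ((hs 1).pd 1),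
    fr_pd (hs 0), fr_pd (hs 1), fr_pd H.hP, e2, e2]
  ring

lemma alg (a b r V0 V1 F00 F01 F10 F11 f0 f1 Q M p : ℂ) (hr : r ^ 2 = a ^ 2 + b ^ 2)
    (div : a * V0 + b * V1 = 0)
    (e0 : f0 = M * (2 * p * Complex.I * (a * (2 * p * Complex.I * (a * V0 + a * V0) + F00)
      + b * (2 * p * Complex.I * (a * V1 + b * V0) + F01))) - 2 * p * Complex.I * a * Q)
    (e1 : f1 = M * (2 * p * Complex.I * (a * (2 * p * Complex.I * (b * V0 + a * V1) + F10)
      + b * (2 * p * Complex.I * (b * V1 + b * V1) + F11))) - 2 * p * Complex.I * b * Q) :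
    r ^ 4 * (4 * p ^ 2 * M * V0) = - b * (2 * p * Complex.I * M * (-b * (a * F00 + b * F01)
      + a * (a * F10 + b * F11)) - (-b * f0 + a * f1)) ∧
    r ^ 4 * (4 * p ^ 2 * M * V1) = a * (2 * p * Complex.I * M * (-b * (a * F00 + b * F01)
      + a * (a * F10 + b * F11)) - (-b * f0 + a * f1)) := by
  have s1 : r ^ 2 * V0 = - b * (-b * V0 + a * V1) := by linear_combination V0 * hr + a * div
  have s1' : r ^ 2 * V1 = a * (-b * V0 + a * V1) := by linear_combination V1 * hr + b * div
  have s2 : -b * f0 + a * f1 = - 4 * p ^ 2 * M * r ^ 2 * (-b * V0 + a * V1) +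
      2 * p * Complex.I * M * (-b * (a * F00 + b * F01) + a * (a * F10 + b * F11)) := by
    linear_combination (-b) * e0 + a * e1
      + 4 * p ^ 2 * M * (-b * V0 + a * V1) * (a ^ 2 + b ^ 2) * Complex.I_sq
      + 4 * p ^ 2 * M * (-b * V0 + a * V1) * hr
  constructor
  · linear_combination 4 * p ^ 2 * M * r ^ 2 * s1 - b * s2
  · linear_combination 4 * p ^ 2 * M * r ^ 2 * s1' + a * s2

/-- the remainder coefficient -/
noncomputable def bb (M : ℝ) (μ : (Fin 2 → ℝ) → ℝ) (v : (Fin 2 → ℝ) → Fin 2 → ℝ) (l i : Fin 2)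
    (n : Fin 2 → ℤ) : ℂ :=
  fr (pd (fun y => v y i) l) n + ∑ a, ∑ c, (st l i a c n : ℂ) * fr (FF M μ v a c) n

lemma Sys.bb_eq (H : Sys M μ ρ P v h) (l i) (n) (hn : n ≠ 0) : bb M μ v l i n
    = -(Complex.I / (2 * Real.pi * M)) * (mr l n) * (rt i n) *
      ((rt 0 n) * fr (fun x => ρ x * h x 0) n + (rt 1 n) * fr (fun x => ρ x * h x 1) n) / nrm n := by
  have hr0 := nrm_pos hn
  have hr : (nrm n : ℂ) ^ 2 = (n 0 : ℂ) ^ 2 + (n 1 : ℂ) ^ 2 := by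
    have := nrm_sq n
    exact_mod_cast congrArg (fun z : ℝ => (z : ℂ)) this
  have hr1 : (nrm n : ℂ) ≠ 0 := by exact_mod_cast hr0.ne'
  have hp : (Real.pi : ℂ) ≠ 0 := by exact_mod_cast Real.pi_ne_zero
  have hM : (M : ℂ) ≠ 0 := by exact_mod_cast H.hM.ne'
  have hne : (nrm n : ℂ) ^ 4 * (4 * Real.pi ^ 2 * M) ≠ 0 := by simp [hr1, hp, hM]
  have e0 := H.fr_eqn 0 n
  have e1 := H.fr_eqn 1 n
  rw [H.fr_D, H.fr_D] at e0 e1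
  obtain ⟨k0, k1⟩ := alg (n 0) (n 1) (nrm n) _ _ _ _ _ _ _ _ _ M Real.pi hr (H.fr_div n) e0 e1
  have d0 : fr (fun x => v x 0) n = _ := (eq_div_iff hne).mpr
    ((by ring : _ = (nrm n : ℂ) ^ 4 * (4 * Real.pi ^ 2 * M * fr (fun x => v x 0) n)).trans k0)
  have d1 : fr (fun x => v x 1) n = _ := (eq_div_iff hne).mpr
    ((by ring : _ = (nrm n : ℂ) ^ 4 * (4 * Real.pi ^ 2 * M * fr (fun x => v x 1) n)).trans k1)
  unfold bb
  rw [fr_pd (H.hv i)]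
  have hI := Complex.I_sq
  fin_cases i
  · simp only [Fin.zero_eta]
    rw [d0]
    simp only [st, rt, mr, Fin.sum_univ_two, if_true, one_ne_zero, if_false]
    push_cast
    field_simp
    ring_nf
    simp only [Complex.I_sq]
    ring
  · simp only [Fin.mk_one]
    rw [d1]
    simp only [st, rt, mr, Fin.sum_univ_two, if_true, one_ne_zero, if_false]
    push_cast
    field_simp
    ring_nf
    simp only [Complex.I_sq]
    ring

lemma abs_mr_le {n : Fin 2 → ℤ} (hn : n ≠ 0) (j) : |mr j n| ≤ 1 := by
  have h := nrm_pos hn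
  unfold mr
  rw [abs_div, abs_of_pos h, div_le_one h]
  apply abs_le_of_sq_le_sq _ h.le
  rw [nrm_sq]
  fin_cases j <;> simp <;> positivity

lemma abs_rt_le {n : Fin 2 → ℤ} (hn : n ≠ 0) (j) : |rt j n| ≤ 1 := by
  unfold rt
  split_ifs
  · rw [abs_neg]; exact abs_mr_le hn _
  · exact abs_mr_le hn _

lemma abs_st_le {n : Fin 2 → ℤ} (hn : n ≠ 0) (l i a c) : |st l i a c n| ≤ 1 := by
  unfold st
  rw [abs_mul, abs_mul, abs_mul]
  have h1 := abs_mr_le hn l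
  have h2 := abs_rt_le hn i
  have h3 := abs_rt_le hn a
  have h4 := abs_mr_le hn c
  exact mul_le_one₀ h1 (by positivity) (mul_le_one₀ h2 (by positivity) (mul_le_one₀ h3 (by positivity) h4))

lemma Sys.bb_B (H : Sys M μ ρ P v h) (l i) (n) (hn : n ≠ 0) : nrm n ^ 2 * ‖bb M μ v l i n‖ ^ 2
    ≤ (M ^ 2)⁻¹ * ∑ j, ‖fr (fun x => ρ x * h x j) n‖ ^ 2 := by
  have hr0 := nrm_pos hn
  have hM := H.hM
  rw [H.bb_eq l i n hn]
  set f0 := fr (fun x => ρ x * h x 0) n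
  set f1 := fr (fun x => ρ x * h x 1) n
  have n1 : ‖(rt 0 n : ℂ) * f0 + (rt 1 n : ℂ) * f1‖ ≤ ‖f0‖ + ‖f1‖ := by
    refine (norm_add_le _ _).trans ?_
    rw [norm_mul, norm_mul, Complex.norm_real, Complex.norm_real]
    gcongr
    · exact mul_le_of_le_one_left (norm_nonneg _) (abs_rt_le hn 0)
    · exact mul_le_of_le_one_left (norm_nonneg _) (abs_rt_le hn 1)
  simp only [norm_mul, norm_div, norm_neg, Complex.norm_real, Complex.norm_I, Real.norm_eq_abs,
    abs_of_pos hr0, abs_of_pos hM, abs_of_pos Real.pi_pos, RCLike.norm_ofNat, Fin.sum_univ_two]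
  have a1 := abs_mr_le hn l
  have a2 := abs_rt_le hn i
  have hpi := Real.pi_gt_three
  have n2 : 1 / (2 * Real.pi * M) * |mr l n| * |rt i n| * ‖(rt 0 n : ℂ) * f0 + (rt 1 n : ℂ) * f1‖
      ≤ 1 / (2 * M) * 1 * 1 * (‖f0‖ + ‖f1‖) := by
    gcongr
    nlinarith
  have e : nrm n ^ 2 * (1 / (2 * Real.pi * M) * |mr l n| * |rt i n| *
      ‖(rt 0 n : ℂ) * f0 + (rt 1 n : ℂ) * f1‖ / nrm n) ^ 2 = (1 / (2 * Real.pi * M) * |mr l n| * |rt i n| *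
      ‖(rt 0 n : ℂ) * f0 + (rt 1 n : ℂ) * f1‖) ^ 2 := by
    field_simp
  rw [e]
  calc _ ≤ (1 / (2 * M) * 1 * 1 * (‖f0‖ + ‖f1‖)) ^ 2 := by gcongr
    _ = (M ^ 2)⁻¹ * ((‖f0‖ + ‖f1‖) ^ 2 / 4) := by field_simp; ring
    _ ≤ _ := by
      gcongr
      nlinarith [sq_nonneg (‖f0‖ - ‖f1‖), sq_nonneg (‖f0‖), sq_nonneg (‖f1‖)]

lemma Sys.korn (H : Sys M μ ρ P v h) (l i) (n) : ‖fr (pd (fun y => v y i) l) n‖ ^ 2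
    ≤ ∑ a, ∑ c, ‖fr (Dsym v a c) n‖ ^ 2 := by
  have hd := H.fr_div n
  have key : ∀ a c, ‖fr (Dsym v a c) n‖ ^ 2 = 4 * Real.pi ^ 2 *
      ‖(n a : ℂ) * fr (fun x => v x c) n + (n c : ℂ) * fr (fun x => v x a) n‖ ^ 2 := by
    intro a c
    rw [H.fr_D]
    simp only [norm_mul, Complex.norm_real, Complex.norm_I, Real.norm_eq_abs,
      abs_of_pos Real.pi_pos, RCLike.norm_ofNat]
    ring
  rw [fr_pd (H.hv i)]
  simp_rw [key]
  simp only [norm_mul, Complex.norm_real, Complex.norm_I, Real.norm_eq_abs,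
      abs_of_pos Real.pi_pos, RCLike.norm_ofNat, Fin.sum_univ_two]
  set V0 := fr (fun x => v x 0) n with hV0
  set V1 := fr (fun x => v x 1) n with hV1
  have sq : ∀ z : ℂ, ‖z‖ ^ 2 = z.re ^ 2 + z.im ^ 2 := by
    intro z; rw [← Complex.normSq_eq_norm_sq, Complex.normSq_apply]; ring
  have hre : (n 0 : ℝ) * V0.re + (n 1 : ℝ) * V1.re = 0 := by simpa using congrArg Complex.re hd
  have him : (n 0 : ℝ) * V0.im + (n 1 : ℝ) * V1.im = 0 := by simpa using congrArg Complex.im hd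
  set a := (n 0 : ℝ)
  set b := (n 1 : ℝ)
  have tot : ‖(n 0 : ℂ) * V0 + (n 0 : ℂ) * V0‖ ^ 2 + ‖(n 0 : ℂ) * V1 + (n 1 : ℂ) * V0‖ ^ 2 +
      (‖(n 1 : ℂ) * V0 + (n 0 : ℂ) * V1‖ ^ 2 + ‖(n 1 : ℂ) * V1 + (n 1 : ℂ) * V1‖ ^ 2)
      = 2 * (a ^ 2 + b ^ 2) * (‖V0‖ ^ 2 + ‖V1‖ ^ 2) := by
    simp only [sq]
    simp only [Complex.add_re, Complex.add_im, Complex.mul_re, Complex.mul_im, Complex.intCast_re,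
      Complex.intCast_im, zero_mul, sub_zero, add_zero]
    change (a * V0.re + a * V0.re) ^ 2 + (a * V0.im + a * V0.im) ^ 2 +
      ((a * V1.re + b * V0.re) ^ 2 + (a * V1.im + b * V0.im) ^ 2) +
      ((b * V0.re + a * V1.re) ^ 2 + (b * V0.im + a * V1.im) ^ 2 +
      ((b * V1.re + b * V1.re) ^ 2 + (b * V1.im + b * V1.im) ^ 2)) = _
    linear_combination 2 * (a * V0.re + b * V1.re) * hre + 2 * (a * V0.im + b * V1.im) * him
  have fin : ‖(n l : ℂ)‖ ^ 2 * ‖fr (fun x => v x i) n‖ ^ 2 ≤ 2 * (a ^ 2 + b ^ 2) * (‖V0‖ ^ 2 + ‖V1‖ ^ 2) := by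
    have h1 : ‖(n l : ℂ)‖ ^ 2 ≤ 2 * (a ^ 2 + b ^ 2) := by
      have : ‖(n l : ℂ)‖ ^ 2 = (n l : ℝ) ^ 2 := by simp
      rw [this]
      fin_cases l <;> simp <;> nlinarith [sq_nonneg a, sq_nonneg b]
    have h2 : ‖fr (fun x => v x i) n‖ ^ 2 ≤ (‖V0‖ ^ 2 + ‖V1‖ ^ 2) := by
      fin_cases i <;> simp [V0, V1]
    gcongr
  have : 0 ≤ 4 * Real.pi ^ 2 := by positivity
  calc _ = 4 * Real.pi ^ 2 * (‖(n l : ℂ)‖ ^ 2 * ‖fr (fun x => v x i) n‖ ^ 2) := by ring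
    _ ≤ 4 * Real.pi ^ 2 * (2 * (a ^ 2 + b ^ 2) * (‖V0‖ ^ 2 + ‖V1‖ ^ 2)) := by gcongr
    _ = _ := by rw [← tot]; ring

lemma Sys.bb_A (H : Sys M μ ρ P v h) (l i) (n) (hn : n ≠ 0) : ‖bb M μ v l i n‖ ^ 2
    ≤ 5 * (∑ a, ∑ c, ‖fr (Dsym v a c) n‖ ^ 2 + ∑ a, ∑ c, ‖fr (FF M μ v a c) n‖ ^ 2) := by
  have hk := H.korn l i n
  have hs : ∀ a c, ‖(st l i a c n : ℂ) * fr (FF M μ v a c) n‖ ≤ ‖fr (FF M μ v a c) n‖ := by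
    intro a c
    rw [norm_mul, Complex.norm_real]
    exact mul_le_of_le_one_left (norm_nonneg _) (abs_st_le hn l i a c)
  have hb : ‖bb M μ v l i n‖ ≤ ‖fr (pd (fun y => v y i) l) n‖ + ((‖fr (FF M μ v 0 0) n‖
      + ‖fr (FF M μ v 0 1) n‖) + (‖fr (FF M μ v 1 0) n‖ + ‖fr (FF M μ v 1 1) n‖)) := by
    unfold bb
    refine (norm_add_le _ _).trans ?_
    gcongr
    simp only [Fin.sum_univ_two]
    refine (norm_add_le _ _).trans ?_
    gcongr
    · exact (norm_add_le _ _).trans (add_le_add (hs _ _) (hs _ _))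
    · exact (norm_add_le _ _).trans (add_le_add (hs _ _) (hs _ _))
  have five : ∀ x y z w u : ℝ, (x + (y + z + (w + u))) ^ 2 ≤ 5 * (x ^ 2 + (y ^ 2 + z ^ 2 + (w ^ 2 + u ^ 2))) := by
    intro x y z w u
    nlinarith [sq_nonneg (x - y), sq_nonneg (x - z), sq_nonneg (x - w), sq_nonneg (x - u),
      sq_nonneg (y - z), sq_nonneg (y - w), sq_nonneg (y - u), sq_nonneg (z - w), sq_nonneg (z - u),
      sq_nonneg (w - u)]
  calc _ ≤ _ := pow_le_pow_left₀ (norm_nonneg _) hb 2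
    _ ≤ _ := five _ _ _ _ _
    _ ≤ _ := by
      simp only [Fin.sum_univ_two] at hk ⊢
      gcongr

end
open MeasureTheory Filter Topology

section
variable {M : ℝ} {μ ρ P : (Fin 2 → ℝ) → ℝ} {v h : (Fin 2 → ℝ) → Fin 2 → ℝ}

lemma bessel_fr {g} (hg : SP g) (S : Finset (Fin 2 → ℤ)) :
    ∑ n ∈ S, ‖fr g n‖ ^ 2 ≤ ∫ x in T2, g x ^ 2 := by
  have := bessel hg.contC S
  simpa only [Complex.norm_real, Real.norm_eq_abs, sq_abs, fr] using this

lemma Sys.sumD (H : Sys M μ ρ P v h) (S : Finset (Fin 2 → ℤ)) :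
    ∑ n ∈ S, ∑ a, ∑ c, ‖fr (Dsym v a c) n‖ ^ 2 ≤ ∑ a, ∑ c, ∫ x in T2, Dsym v a c x ^ 2 := by
  rw [Finset.sum_comm]
  refine Finset.sum_le_sum fun a _ => ?_
  rw [Finset.sum_comm]
  exact Finset.sum_le_sum fun c _ => bessel_fr (H.hD a c) S

lemma Sys.abs_FF_le (H : Sys M μ ρ P v h) {δ : ℝ} (hδ : ∀ x, |μ x / M - 1| < δ) (a c x) :
    |FF M μ v a c x| ≤ δ * |Dsym v a c x| := by
  unfold FF
  rw [abs_mul]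
  gcongr
  have := hδ x
  rw [div_eq_inv_mul] at this
  exact this.le

lemma Sys.sumF (H : Sys M μ ρ P v h) {δ : ℝ} (hδ : ∀ x, |μ x / M - 1| < δ) (h1 : δ ≤ 1)
    (S : Finset (Fin 2 → ℤ)) :
    ∑ n ∈ S, ∑ a, ∑ c, ‖fr (FF M μ v a c) n‖ ^ 2 ≤ ∑ a, ∑ c, ∫ x in T2, Dsym v a c x ^ 2 := by
  rw [Finset.sum_comm]
  refine Finset.sum_le_sum fun a _ => ?_
  rw [Finset.sum_comm]
  refine Finset.sum_le_sum fun c _ => (bessel_fr (H.hF a c) S).trans ?_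
  have c1 := (H.hF a c).cont
  have c2 := (H.hD a c).cont
  apply integral_mono (intOn_T2 (by fun_prop)) (intOn_T2 (by fun_prop))
  intro x
  simp only
  apply sq_le_sq.mpr
  exact (H.abs_FF_le hδ a c x).trans (mul_le_of_le_one_left (abs_nonneg _) h1)

lemma Sys.L2v (H : Sys M μ ρ P v h) (l i) :
    ∫ x in T2, pd (fun y => v y i) l x ^ 2 ≤ ∑ a, ∑ c, ∫ x in T2, Dsym v a c x ^ 2 := by
  apply L2_le ((H.hv i).pd l)
  · rw [fr_pd (H.hv i)]; simp
  · intro S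
    exact (Finset.sum_le_sum fun n _ => H.korn l i n).trans (H.sumD S)

lemma Sys.Ebd (H : Sys M μ ρ P v h) {δ : ℝ} (hδ : ∀ x, |μ x / M - 1| < δ) (h1 : δ ≤ 1 / 2) :
    ∑ a, ∑ c, ∫ x in T2, Dsym v a c x ^ 2 ≤
      2 / M * ∫ x in T2, μ x * ∑ j, ∑ k, (Dsym v j k x) ^ 2 := by
  have cD := fun a c => (H.hD a c).cont
  have cμ := H.hμ.cont
  have hM := H.hM
  have e : ∑ a, ∑ c, ∫ x in T2, Dsym v a c x ^ 2 = ∫ x in T2, ∑ a, ∑ c, Dsym v a c x ^ 2 := by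
    rw [integral_finsetSum _ (fun a _ => intOn_T2 (by fun_prop))]
    refine Finset.sum_congr rfl fun a _ => ?_
    rw [integral_finsetSum _ (fun c _ => intOn_T2 (by fun_prop))]
  rw [e, ← integral_const_mul]
  apply integral_mono (intOn_T2 (by fun_prop)) (intOn_T2 (by fun_prop))
  intro x
  simp only
  rw [← mul_assoc]
  apply le_mul_of_one_le_left (by positivity)
  have := (abs_lt.mp (hδ x)).1
  have h2 : 1 / 2 ≤ μ x / M := by linarith
  calc (1:ℝ) ≤ 2 * (μ x / M) := by linarith
    _ = _ := by ring

lemma Sys.sumf (H : Sys M μ ρ P v h) {R : ℝ} (h0 : ∀ x, 0 ≤ ρ x) (h1 : ∀ x, ρ x ≤ R)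
    (S : Finset (Fin 2 → ℤ)) :
    ∑ n ∈ S, ∑ j, ‖fr (fun x => ρ x * h x j) n‖ ^ 2 ≤ R * ∫ x in T2, ρ x * ∑ i, (h x i) ^ 2 := by
  have ch := fun i => (H.hh i).cont
  have cρ := H.hρ.cont
  rw [Finset.sum_comm]
  refine (Finset.sum_le_sum fun j _ => bessel_fr (H.hf j) S).trans ?_
  rw [← integral_finsetSum _ (fun a _ => intOn_T2 (by fun_prop)), ← integral_const_mul]
  apply integral_mono (intOn_T2 (by fun_prop)) (intOn_T2 (by fun_prop))
  intro x
  simp only [Finset.mul_sum]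
  refine Finset.sum_le_sum fun i _ => ?_
  have a := h0 x
  have b := h1 x
  calc (ρ x * h x i) ^ 2 = ρ x * (ρ x * h x i ^ 2) := by ring
    _ ≤ R * (ρ x * h x i ^ 2) := by gcongr

lemma high (k : ℕ) : ∃ δ K : ℝ, 0 < δ ∧ δ ≤ 1 / 2 ∧ 0 ≤ K ∧ ∀ (M R : ℝ) (μ ρ P : (Fin 2 → ℝ) → ℝ)
    (v h : (Fin 2 → ℝ) → Fin 2 → ℝ), Sys M μ ρ P v h → (∀ x, |μ x / M - 1| < δ) → (∀ x, 0 ≤ ρ x) →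
    (∀ x, ρ x ≤ R) → 0 < R →
    ∑ l, ∑ i, ∫ x in T2, |pd (fun y => v y i) l x| ^ (2 * (k + 1)) ≤
      K * ((20 / M * ∫ x in T2, μ x * ∑ j, ∑ k, (Dsym v j k x) ^ 2) *
        ((M ^ 2)⁻¹ * (R * ∫ x in T2, ρ x * ∑ i, (h x i) ^ 2)) ^ k) := by
  obtain ⟨K, hK, hmain⟩ := main_abs k
  set q := 2 * (k + 1) with hq
  refine ⟨1 / (2 * (4 * K * (2 ^ q * 2) + 1)), 8 * K, by positivity, ?_, by positivity, ?_⟩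
  · apply one_div_le_one_div_of_le (by norm_num)
    have : 0 ≤ 4 * K * (2 ^ q * 2) := by positivity
    linarith
  set δ := 1 / (2 * (4 * K * (2 ^ q * 2) + 1)) with hδdef
  have hδ0 : 0 < δ := by positivity
  have hδh : δ ≤ 1 / 2 := by
    apply one_div_le_one_div_of_le (by norm_num)
    have : 0 ≤ 4 * K * (2 ^ q * 2) := by positivity
    linarith
  intro M R μ ρ P v h H hδ hρ0 hρ1 hR
  have hM := H.hM
  set X := ∫ x in T2, μ x * ∑ j, ∑ k, (Dsym v j k x) ^ 2 with hX
  set HH := ∫ x in T2, ρ x * ∑ i, (h x i) ^ 2 with hHH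
  set w : Fin 2 → Fin 2 → (Fin 2 → ℝ) → ℝ := fun l i => pd (fun y => v y i) l with hw
  have cw : ∀ l i, Continuous (w l i) := fun l i => ((H.hv i).pd l).cont
  set Y := ∑ l, ∑ i, ∫ x in T2, |w l i x| ^ q with hY
  have hE := H.Ebd hδ hδh
  have hne : ∀ (S : Finset (Fin 2 → ℤ)), 0 ∉ S → ∀ n ∈ S, n ≠ 0 := fun S hS n hn h0 => hS (h0 ▸ hn)
  have each : ∀ l i, ∫ x in T2, |w l i x| ^ q ≤
      K * ((∑ a, ∑ c, ∫ x in T2, |FF M μ v a c x| ^ q) + (20 / M * X) * ((M ^ 2)⁻¹ * (R * HH)) ^ k) := by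
    intro l i
    apply hmain l i _ _ (bb M μ v l i) _ _ ((H.hv i).pd l) H.hF
    · rw [fr_pd (H.hv i)]; simp
    · intro n _
      unfold bb
      simp
    · intro S hS
      refine (Finset.sum_le_sum fun n hn => H.bb_A l i n (hne S hS n hn)).trans ?_
      rw [← Finset.mul_sum, Finset.sum_add_distrib]
      have s1 := H.sumD S
      have s2 := H.sumF hδ (hδh.trans (by norm_num)) S
      calc _ ≤ 5 * (2 / M * X + 2 / M * X) := by
            have := s1.trans hE
            have := s2.trans hE
            gcongr
        _ = _ := by ring
    · intro S hS
      refine (Finset.sum_le_sum fun n hn => H.bb_B l i n (hne S hS n hn)).trans ?_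
      rw [← Finset.mul_sum]
      have := H.sumf hρ0 hρ1 S
      gcongr
  set Q := (20 / M * X) * ((M ^ 2)⁻¹ * (R * HH)) ^ k with hQ
  have hFq : ∀ a c, ∫ x in T2, |FF M μ v a c x| ^ q ≤
      δ * 2 ^ q * ((∫ x in T2, |w a c x| ^ q) + ∫ x in T2, |w c a x| ^ q) := by
    intro a c
    have c1 := (H.hF a c).cont
    have c2 := cw a c
    have c3 := cw c a
    rw [← integral_add (intOn_T2 (by fun_prop)) (intOn_T2 (by fun_prop)), ← integral_const_mul]
    apply integral_mono (intOn_T2 (by fun_prop)) (intOn_T2 (by fun_prop))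
    intro x
    simp only
    have e1 : |Dsym v a c x| ≤ |w a c x| + |w c a x| := abs_add_le _ _
    have e2 := (H.abs_FF_le hδ a c x)
    have e3 : δ ^ q ≤ δ := pow_le_of_le_one hδ0.le (hδh.trans (by norm_num)) (by omega)
    calc |FF M μ v a c x| ^ q ≤ (δ * (|w a c x| + |w c a x|)) ^ q := by
          gcongr
          exact e2.trans (by gcongr)
      _ = δ ^ q * (|w a c x| + |w c a x|) ^ q := mul_pow _ _ _
      _ ≤ δ * (2 ^ q * (|w a c x| ^ q + |w c a x| ^ q)) := by
          gcongr
          exact add_pow_le' (abs_nonneg _) (abs_nonneg _) q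
      _ = _ := by ring
  have hFs : (∑ a, ∑ c, ∫ x in T2, |FF M μ v a c x| ^ q) ≤ δ * (2 ^ q * 2) * Y := by
    have a00 := hFq 0 0
    have a01 := hFq 0 1
    have a10 := hFq 1 0
    have a11 := hFq 1 1
    simp only [hY, Fin.sum_univ_two]
    calc _ ≤ _ := add_le_add (add_le_add a00 a01) (add_le_add a10 a11)
      _ = _ := by ring
  have hYs : Y ≤ 4 * (K * ((∑ a, ∑ c, ∫ x in T2, |FF M μ v a c x| ^ q) + Q)) := by
    simp only [hY, Fin.sum_univ_two] at *
    linarith [each 0 0, each 0 1, each 1 0, each 1 1]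
  have hY0 : 0 ≤ Y := Finset.sum_nonneg fun a _ => Finset.sum_nonneg fun c _ =>
    integral_nonneg fun x => by positivity
  have hsmall : 4 * K * (2 ^ q * 2) * δ ≤ 1 / 2 := by
    have : 0 ≤ 4 * K * (2 ^ q * 2) := by positivity
    rw [hδdef, mul_one_div, div_le_iff₀ (by positivity)]
    linarith
  have h1 : Y ≤ (4 * K * (2 ^ q * 2) * δ) * Y + 4 * K * Q := by
    calc Y ≤ _ := hYs
      _ ≤ 4 * (K * (δ * (2 ^ q * 2) * Y + Q)) := by gcongr
      _ = _ := by ring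
  have h2 := mul_le_mul_of_nonneg_right hsmall hY0
  linarith

end
open MeasureTheory

lemma holder_interp {u : (Fin 2 → ℝ) → ℝ} (hu : Continuous u) (h0 : ∀ x, 0 ≤ u x) (m : ℕ) {s : ℝ}
    (hs0 : 0 < s) (hs1 : s < 1) :
    ∫ x in T2, u x ^ ((1 - s) + m * s) ≤ (∫ x in T2, u x) ^ (1 - s) * (∫ x in T2, u x ^ m) ^ s := by
  have h1s : 0 < 1 - s := by linarith
  have hpq : (1 / (1 - s)).HolderConjugate (1 / s) := by
    rw [Real.holderConjugate_iff]
    constructor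
    · rw [lt_div_iff₀ h1s]; linarith
    · simp
  have c1 : Continuous fun x => u x ^ (1 - s) := hu.rpow_const fun x => Or.inr h1s.le
  have c2 : Continuous fun x => (u x ^ m) ^ s := (hu.pow m).rpow_const fun x => Or.inr hs0.le
  have mem : ∀ (f : (Fin 2 → ℝ) → ℝ), Continuous f → ∀ r, MemLp f r (volume.restrict T2) := by
    intro f hf r
    obtain ⟨B, hB⟩ := (isCompact_T2.image hf.norm).bddAbove
    refine MemLp.of_bound hf.aestronglyMeasurable B ?_
    filter_upwards [ae_restrict_mem measurableSet_T2] with x hx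
    exact hB ⟨x, hx, rfl⟩
  have := integral_mul_le_Lp_mul_Lq_of_nonneg (μ := volume.restrict T2) hpq
    (f := fun x => u x ^ (1 - s)) (g := fun x => (u x ^ m) ^ s)
    (Filter.Eventually.of_forall fun x => Real.rpow_nonneg (h0 x) _)
    (Filter.Eventually.of_forall fun x => Real.rpow_nonneg (pow_nonneg (h0 x) _) _)
    (mem _ c1 _) (mem _ c2 _)
  have e1 : ∀ x, (u x ^ (1 - s)) ^ (1 / (1 - s)) = u x := by
    intro x; rw [← Real.rpow_mul (h0 x), mul_one_div_cancel h1s.ne', Real.rpow_one]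
  have e2 : ∀ x, ((u x ^ m) ^ s) ^ (1 / s) = u x ^ m := by
    intro x; rw [← Real.rpow_mul (pow_nonneg (h0 x) _), mul_one_div_cancel hs0.ne', Real.rpow_one]
  have e3 : ∀ x, u x ^ (1 - s) * (u x ^ m) ^ s = u x ^ ((1 - s) + m * s) := by
    intro x
    rw [← Real.rpow_natCast, ← Real.rpow_mul (h0 x), Real.rpow_add_of_nonneg (h0 x) h1s.le (by positivity)]
  simp only [e1, e2, e3, one_div_one_div] at this
  exact this

/-- `L^p` bound for `∇v` for the Stokes-type system
`ρ h = ∇·(μ 𝔻v) − ∇P`, `∇·v = 0` on the torus, for viscosities with a small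
relative oscillation around `μ̄`. -/
theorem Lp_gradient_bound_small_viscosity_jump
    (p : ℝ) (hp : 2 < p) :
    ∃ δ ∈ Set.Ioo (0:ℝ) 1, ∀ μbar ρM : ℝ, 0 < μbar → 0 < ρM →
      ∃ C > 0, ∀ (μ ρ P : (Fin 2 → ℝ) → ℝ) (v h : (Fin 2 → ℝ) → Fin 2 → ℝ),
        ContDiff ℝ (⊤ : ℕ∞) μ → ContDiff ℝ (⊤ : ℕ∞) ρ → ContDiff ℝ (⊤ : ℕ∞) P →
        ContDiff ℝ (⊤ : ℕ∞) v → ContDiff ℝ (⊤ : ℕ∞) h →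
        Per μ → Per ρ → Per P →
        (∀ i, Per fun x => v x i) → (∀ i, Per fun x => h x i) →
        (∀ x, |μ x / μbar - 1| < δ) →
        (∀ x, 0 ≤ ρ x) → (∀ x, ρ x ≤ ρM) →
        (∀ x, ∑ i, pd (fun y => v y i) i x = 0) →
        (∀ x i, ρ x * h x i
            = (∑ j, pd (fun y => μ y * Dsym v i j y) j x) - pd P i x) →
        (∫ x in T2, (∑ i, ∑ j, (pd (fun y => v y j) i x) ^ 2) ^ (p / 2)) ^ (1 / p)
          ≤ C * (Real.sqrt (∫ x in T2, μ x * ∑ j, ∑ k, (Dsym v j k x) ^ 2)) ^ (2 / p)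
              * (Real.sqrt (∫ x in T2, ρ x * ∑ i, (h x i) ^ 2)) ^ (1 - 2 / p) := by
  set k := ⌈p⌉₊ with hk
  have hkp : p ≤ k := Nat.le_ceil p
  have hk0 : (0:ℝ) < k := by linarith
  obtain ⟨δ, K, hδ0, hδ1, hK, hhigh⟩ := high k
  refine ⟨δ, ⟨hδ0, by linarith⟩, fun M R hM hR => ?_⟩
  set s : ℝ := (p / 2 - 1) / k with hs
  have hs0 : 0 < s := by apply div_pos _ hk0; linarith
  have hs1 : s < 1 := by rw [hs, div_lt_one hk0]; linarith
  have hks : k * s = p / 2 - 1 := by rw [hs]; field_simp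
  have hps : p / 2 = (1 - s) + ((k + 1 : ℕ) : ℝ) * s := by push_cast; linarith
  set c1 : ℝ := 8 / M with hc1
  set c2 : ℝ := 8 ^ (k + 1) * (K * (20 / M * ((M ^ 2)⁻¹ * R) ^ k)) + 1 with hc2
  have hc1p : 0 < c1 := by positivity
  have hc2p : 0 < c2 := by positivity
  refine ⟨(c1 ^ (1 - s) * c2 ^ s) ^ (1 / p), by positivity, ?_⟩
  intro μ ρ P v h cμ cρ cP cv ch pμ pρ pP pv ph hδ hρ0 hρ1 hdiv heq
  have H : Sys M μ ρ P v h := ⟨hM, ⟨cμ, pμ⟩, ⟨cρ, pρ⟩, ⟨cP, pP⟩,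
    fun i => ⟨contDiff_pi.mp cv i, pv i⟩, fun i => ⟨contDiff_pi.mp ch i, ph i⟩, hdiv, heq⟩
  have hY := hhigh M R μ ρ P v h H hδ hρ0 hρ1 hR
  have hE := H.Ebd hδ hδ1
  set X := ∫ x in T2, μ x * ∑ j, ∑ k, (Dsym v j k x) ^ 2 with hX
  set HH := ∫ x in T2, ρ x * ∑ i, (h x i) ^ 2 with hHH
  have hX0 : 0 ≤ X := by
    refine integral_nonneg fun x => ?_
    have h1 := (abs_lt.mp (hδ x)).1
    have h2 : 0 < μ x / M := by linarith
    have h3 : 0 < μ x := by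
      have := mul_pos h2 hM
      rwa [div_mul_cancel₀ _ hM.ne'] at this
    exact mul_nonneg h3.le (Finset.sum_nonneg fun i _ => Finset.sum_nonneg fun j _ => sq_nonneg _)
  have hH0 : 0 ≤ HH := by
    refine integral_nonneg fun x => ?_
    exact mul_nonneg (hρ0 x) (Finset.sum_nonneg fun i _ => sq_nonneg _)
  have cw : ∀ l i, Continuous (pd (fun y => v y i) l) := fun l i => ((H.hv i).pd l).cont
  set u : (Fin 2 → ℝ) → ℝ := fun x => ∑ i, ∑ j, (pd (fun y => v y j) i x) ^ 2 with hu
  have cu : Continuous u := by fun_prop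
  have hu0 : ∀ x, 0 ≤ u x := fun x =>
    Finset.sum_nonneg fun i _ => Finset.sum_nonneg fun j _ => sq_nonneg _
  have I1 : ∫ x in T2, u x ≤ c1 * X := by
    have e : ∫ x in T2, u x = ∑ i, ∑ j, ∫ x in T2, (pd (fun y => v y j) i x) ^ 2 := by
      rw [hu, integral_finsetSum _ (fun a _ => intOn_T2 (by fun_prop))]
      refine Finset.sum_congr rfl fun a _ => ?_
      rw [integral_finsetSum _ (fun c _ => intOn_T2 (by fun_prop))]
    rw [e]
    have h1 : ∀ l i, ∫ x in T2, (pd (fun y => v y i) l x) ^ 2 ≤ 2 / M * X :=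
      fun l i => (H.L2v l i).trans hE
    have e8 : c1 * X = 4 * (2 / M * X) := by rw [hc1]; ring
    rw [e8]
    simp only [Fin.sum_univ_two]
    linarith [h1 0 0, h1 0 1, h1 1 0, h1 1 1]
  have I2 : ∫ x in T2, u x ^ (k + 1) ≤ c2 * (X * HH ^ k) := by
    have hpt : ∀ x, u x ^ (k + 1) ≤ 8 ^ (k + 1) *
        ∑ l, ∑ i, |pd (fun y => v y i) l x| ^ (2 * (k + 1)) := by
      intro x
      have := pow5 _ _ _ _ 0 (sq_nonneg (pd (fun y => v y 0) 0 x)) (sq_nonneg (pd (fun y => v y 1) 0 x))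
        (sq_nonneg (pd (fun y => v y 0) 1 x)) (sq_nonneg (pd (fun y => v y 1) 1 x)) le_rfl (k + 1)
      simp only [hu, Fin.sum_univ_two, pow_mul, sq_abs]
      rw [add_zero, zero_pow (Nat.succ_ne_zero k), add_zero] at this
      refine this.trans (le_of_eq ?_)
      ring
    have h1 := integral_mono (μ := volume.restrict T2) (intOn_T2 (by fun_prop))
      (intOn_T2 (by fun_prop)) hpt
    rw [integral_const_mul, integral_finsetSum _ (fun a _ => intOn_T2 (by fun_prop))] at h1
    have h2 : ∀ l, ∫ x in T2, ∑ i, |pd (fun y => v y i) l x| ^ (2 * (k + 1))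
        = ∑ i, ∫ x in T2, |pd (fun y => v y i) l x| ^ (2 * (k + 1)) := fun l =>
      integral_finsetSum _ (fun c _ => intOn_T2 (by fun_prop))
    simp only [h2] at h1
    calc _ ≤ _ := h1
      _ ≤ 8 ^ (k + 1) * (K * ((20 / M * X) * ((M ^ 2)⁻¹ * (R * HH)) ^ k)) := by gcongr
      _ = (c2 - 1) * (X * HH ^ k) := by
          rw [hc2, ← mul_assoc (M ^ 2)⁻¹ R HH, mul_pow _ HH]; ring
      _ ≤ c2 * (X * HH ^ k) := by gcongr; linarith
  have I3 : ∫ x in T2, u x ^ (p / 2) ≤ (c1 ^ (1 - s) * c2 ^ s) * X * HH ^ (p / 2 - 1) := by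
    have h1 := holder_interp cu hu0 (k + 1) hs0 hs1
    rw [← hps] at h1
    refine h1.trans ?_
    have n1 : 0 ≤ ∫ x in T2, u x := integral_nonneg hu0
    have n2 : 0 ≤ ∫ x in T2, u x ^ (k + 1) := integral_nonneg fun x => pow_nonneg (hu0 x) _
    have h1s : 0 ≤ 1 - s := by linarith
    calc _ ≤ (c1 * X) ^ (1 - s) * (c2 * (X * HH ^ k)) ^ s := by gcongr
      _ = (c1 ^ (1 - s) * c2 ^ s) * (X ^ (1 - s) * X ^ s) * (HH ^ k) ^ s := by
          rw [Real.mul_rpow hc1p.le hX0, Real.mul_rpow hc2p.le (by positivity),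
            Real.mul_rpow hX0 (by positivity)]
          ring
      _ = _ := by
          rw [← Real.rpow_add_of_nonneg hX0 h1s hs0.le, ← Real.rpow_natCast, ← Real.rpow_mul hH0, hks]
          simp
  have hp0 : 0 < p := by linarith
  have n3 : 0 ≤ ∫ x in T2, u x ^ (p / 2) := integral_nonneg fun x => Real.rpow_nonneg (hu0 x) _
  calc _ ≤ ((c1 ^ (1 - s) * c2 ^ s) * X * HH ^ (p / 2 - 1)) ^ (1 / p) := by gcongr
    _ = (c1 ^ (1 - s) * c2 ^ s) ^ (1 / p) * X ^ (1 / p) * (HH ^ (p / 2 - 1)) ^ (1 / p) := by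
        rw [Real.mul_rpow (by positivity) (by positivity), Real.mul_rpow (by positivity) hX0]
    _ = _ := by
        rw [Real.sqrt_eq_rpow, Real.sqrt_eq_rpow, ← Real.rpow_mul hX0, ← Real.rpow_mul hH0,
          ← Real.rpow_mul hH0]
        have x1 : 1 / 2 * (2 / p) = 1 / p := by field_simp
        have x2 : 1 / 2 * (1 - 2 / p) = (p / 2 - 1) * (1 / p) := by field_simp
        rw [x1, x2]
end
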